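/- Let S = sgp⟨A | u = v⟩ be the one-relator monoid presented by A = {a_1,…,a_n} with n ≥ 2, where u, v ∈ A^* and |v| ≤ |u| ≤ 3. Then S is biautomatic if one of the following holds: (i) |u| = 3 and |v| = 0; (ii) |u| = |v| = 3; (iii) |u| = 2 and the relation u = v is not of the form ab = a or ab = b for distinct letters a, b ∈ A. Moreover, if u = v is of the form ab = a or ab = b for distinct a, b ∈ A, then S is not biautomatic. -/

import Mathlib

/-!  Common definitions, following the conventions of the paper
"Automaticity of one-relator semigroups with length less than or equal to three".

Words over an alphabet `α` are modelled as `List α`; the empty word is `[]`.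
The padded alphabet `A(2,$)` is modelled inside `Option α × Option α`,
where `none` plays the role of the padding symbol `$` (the pair `(none, none)`
never occurs in a padded convolution). -/

/-- A regular set of words: one accepted by a DFA with finitely many states. -/
abbrev IsReg {α : Type*} (L : Set (List α)) : Prop :=
  Language.IsRegular (L : Language α)

/-- Right-padded convolution `(x,y)δᴿ`: align the two words letter by letter
from the left and pad the shorter one on the right with the padding symbol. -/
def padR {α : Type*} (x y : List α) : List (Option α × Option α) :=
  (x.map some ++ List.replicate (y.length - x.length) none).zip
    (y.map some ++ List.replicate (x.length - y.length) none)

/-- Left-padded convolution `(x,y)δᴸ`: align the two words letter by letter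
from the right and pad the shorter one on the left with the padding symbol. -/
def padL {α : Type*} (x y : List α) : List (Option α × Option α) :=
  (List.replicate (y.length - x.length) none ++ x.map some).zip
    (List.replicate (x.length - y.length) none ++ y.map some)

/-- One elementary rewriting step: replace a factor `u` by `v`
for some defining relation `(u, v) ∈ R` (in either direction via `Relation.EqvGen`). -/
def OneStep {α : Type*} (R : Set (List α × List α)) (x y : List α) : Prop :=
  ∃ p u v s, (u, v) ∈ R ∧ x = p ++ u ++ s ∧ y = p ++ v ++ s

/-- Equality of two words in the semigroup `sgp⁺⟨α ∣ R⟩` (resp. the monoid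
`sgp⟨α ∣ R⟩`): the congruence on words generated by the relations `R`. -/
def WordEq {α : Type*} (R : Set (List α × List α)) : List α → List α → Prop :=
  Relation.EqvGen (OneStep R)

/-- Expansion of a word over an abstract generating set `β` into a word over the
presentation alphabet `α`, where `g b` is a word representing the generator `b`. -/
def expandW {α β : Type*} (g : β → List α) (w : List β) : List α :=
  (w.map g).flatten

/-- `(g, L)` is an automatic structure for the semigroup `sgp⁺⟨α ∣ R⟩` with
respect to the finite generating set indexed by `β`:  each generator `b` is the
element of the semigroup represented by the nonempty word `g b`, the language
`L ⊆ β⁺` is regular and maps onto the semigroup, and `L_ε^$` together with all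
`L_b^$` (right multiplication, right padding) are regular. -/
structure SgpAutoStruct {α β : Type*} (R : Set (List α × List α))
    (g : β → List α) (L : Set (List β)) : Prop where
  gen_ne : ∀ b, g b ≠ []
  reg : IsReg L
  ne : ∀ w ∈ L, w ≠ []
  onto : ∀ w : List α, w ≠ [] → ∃ x ∈ L, WordEq R (expandW g x) w
  eq_reg : IsReg {p | ∃ x ∈ L, ∃ y ∈ L,
      WordEq R (expandW g x) (expandW g y) ∧ p = padR x y}
  mul_reg : ∀ b : β, IsReg {p | ∃ x ∈ L, ∃ y ∈ L,
      WordEq R (expandW g x ++ g b) (expandW g y) ∧ p = padR x y}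

/-- A prefix-automatic structure for `sgp⁺⟨α ∣ R⟩`: an automatic structure for
which moreover `L'_= = {(x,y)δᴿ : x ∈ L, y ∈ Pref(L), x = y in S}` is regular. -/
structure SgpPrefixAutoStruct {α β : Type*} (R : Set (List α × List α))
    (g : β → List α) (L : Set (List β)) extends SgpAutoStruct R g L : Prop where
  pre_reg : IsReg {p | ∃ x ∈ L, ∃ y : List β, (∃ z ∈ L, y <+: z) ∧
      WordEq R (expandW g x) (expandW g y) ∧ p = padR x y}

/-- A biautomatic structure for the semigroup `sgp⁺⟨α ∣ R⟩`: the languages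
`L_b^$`, `_bL^$`, `^$L_b` and `_b^$L` are regular for every `b ∈ β ∪ {ε}`. -/
structure SgpBiautoStruct {α β : Type*} (R : Set (List α × List α))
    (g : β → List α) (L : Set (List β)) : Prop where
  gen_ne : ∀ b, g b ≠ []
  reg : IsReg L
  ne : ∀ w ∈ L, w ≠ []
  onto : ∀ w : List α, w ≠ [] → ∃ x ∈ L, WordEq R (expandW g x) w
  eqR_reg : IsReg {p | ∃ x ∈ L, ∃ y ∈ L,
      WordEq R (expandW g x) (expandW g y) ∧ p = padR x y}
  eqL_reg : IsReg {p | ∃ x ∈ L, ∃ y ∈ L,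
      WordEq R (expandW g x) (expandW g y) ∧ p = padL x y}
  mulRR_reg : ∀ b : β, IsReg {p | ∃ x ∈ L, ∃ y ∈ L,
      WordEq R (expandW g x ++ g b) (expandW g y) ∧ p = padR x y}
  mulLR_reg : ∀ b : β, IsReg {p | ∃ x ∈ L, ∃ y ∈ L,
      WordEq R (g b ++ expandW g x) (expandW g y) ∧ p = padR x y}
  mulRL_reg : ∀ b : β, IsReg {p | ∃ x ∈ L, ∃ y ∈ L,
      WordEq R (expandW g x ++ g b) (expandW g y) ∧ p = padL x y}
  mulLL_reg : ∀ b : β, IsReg {p | ∃ x ∈ L, ∃ y ∈ L,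
      WordEq R (g b ++ expandW g x) (expandW g y) ∧ p = padL x y}

/-- The semigroup `sgp⁺⟨α ∣ R⟩` is automatic: it admits an automatic structure
over some finite generating set. -/
def SgpAutomatic {α : Type*} (R : Set (List α × List α)) : Prop :=
  ∃ (β : Type) (_ : Fintype β) (g : β → List α) (L : Set (List β)),
    SgpAutoStruct R g L

/-- The semigroup `sgp⁺⟨α ∣ R⟩` is prefix-automatic. -/
def SgpPrefixAutomatic {α : Type*} (R : Set (List α × List α)) : Prop :=
  ∃ (β : Type) (_ : Fintype β) (g : β → List α) (L : Set (List β)),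
    SgpPrefixAutoStruct R g L

/-- The semigroup `sgp⁺⟨α ∣ R⟩` is biautomatic. -/
def SgpBiautomatic {α : Type*} (R : Set (List α × List α)) : Prop :=
  ∃ (β : Type) (_ : Fintype β) (g : β → List α) (L : Set (List β)),
    SgpBiautoStruct R g L

/-- `(g, L)` is an automatic structure for the monoid `sgp⟨α ∣ R⟩` with respect
to a finite generating set indexed by `β`; generators may represent any element
of the monoid (in particular the identity, represented by the empty word). -/
structure MonAutoStruct {α β : Type*} (R : Set (List α × List α))
    (g : β → List α) (L : Set (List β)) : Prop where
  reg : IsReg L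
  ne : ∀ w ∈ L, w ≠ []
  onto : ∀ w : List α, ∃ x ∈ L, WordEq R (expandW g x) w
  eq_reg : IsReg {p | ∃ x ∈ L, ∃ y ∈ L,
      WordEq R (expandW g x) (expandW g y) ∧ p = padR x y}
  mul_reg : ∀ b : β, IsReg {p | ∃ x ∈ L, ∃ y ∈ L,
      WordEq R (expandW g x ++ g b) (expandW g y) ∧ p = padR x y}

/-- A prefix-automatic structure for the monoid `sgp⟨α ∣ R⟩`. -/
structure MonPrefixAutoStruct {α β : Type*} (R : Set (List α × List α))
    (g : β → List α) (L : Set (List β)) extends MonAutoStruct R g L : Prop where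
  pre_reg : IsReg {p | ∃ x ∈ L, ∃ y : List β, (∃ z ∈ L, y <+: z) ∧
      WordEq R (expandW g x) (expandW g y) ∧ p = padR x y}

/-- A biautomatic structure for the monoid `sgp⟨α ∣ R⟩`. -/
structure MonBiautoStruct {α β : Type*} (R : Set (List α × List α))
    (g : β → List α) (L : Set (List β)) : Prop where
  reg : IsReg L
  ne : ∀ w ∈ L, w ≠ []
  onto : ∀ w : List α, ∃ x ∈ L, WordEq R (expandW g x) w
  eqR_reg : IsReg {p | ∃ x ∈ L, ∃ y ∈ L,
      WordEq R (expandW g x) (expandW g y) ∧ p = padR x y}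
  eqL_reg : IsReg {p | ∃ x ∈ L, ∃ y ∈ L,
      WordEq R (expandW g x) (expandW g y) ∧ p = padL x y}
  mulRR_reg : ∀ b : β, IsReg {p | ∃ x ∈ L, ∃ y ∈ L,
      WordEq R (expandW g x ++ g b) (expandW g y) ∧ p = padR x y}
  mulLR_reg : ∀ b : β, IsReg {p | ∃ x ∈ L, ∃ y ∈ L,
      WordEq R (g b ++ expandW g x) (expandW g y) ∧ p = padR x y}
  mulRL_reg : ∀ b : β, IsReg {p | ∃ x ∈ L, ∃ y ∈ L,
      WordEq R (expandW g x ++ g b) (expandW g y) ∧ p = padL x y}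
  mulLL_reg : ∀ b : β, IsReg {p | ∃ x ∈ L, ∃ y ∈ L,
      WordEq R (g b ++ expandW g x) (expandW g y) ∧ p = padL x y}

/-- The monoid `sgp⟨α ∣ R⟩` is automatic. -/
def MonAutomatic {α : Type*} (R : Set (List α × List α)) : Prop :=
  ∃ (β : Type) (_ : Fintype β) (g : β → List α) (L : Set (List β)),
    MonAutoStruct R g L

/-- The monoid `sgp⟨α ∣ R⟩` is prefix-automatic. -/
def MonPrefixAutomatic {α : Type*} (R : Set (List α × List α)) : Prop :=
  ∃ (β : Type) (_ : Fintype β) (g : β → List α) (L : Set (List β)),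
    MonPrefixAutoStruct R g L

/-- The monoid `sgp⟨α ∣ R⟩` is biautomatic. -/
def MonBiautomatic {α : Type*} (R : Set (List α × List α)) : Prop :=
  ∃ (β : Type) (_ : Fintype β) (g : β → List α) (L : Set (List β)),
    MonBiautoStruct R g L

/-- The defining relations of `S¹ = sgp⁺⟨α, e ∣ R, ea = ae = a, ee = e⟩`,
the monoid obtained from `S = sgp⁺⟨α ∣ R⟩` by adjoining an identity element,
presented as a semigroup over the alphabet `Option α` where `none` is the new
identity letter `e`. -/
def adjoinOne {α : Type*} (R : Set (List α × List α)) :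
    Set (List (Option α) × List (Option α)) :=
  {q | ∃ p ∈ R, q = (p.1.map some, p.2.map some)} ∪
    {q | ∃ a : α, q = ([none, some a], [some a])} ∪
    {q | ∃ a : α, q = ([some a, none], [some a])} ∪
    {([none, none], [none])}



/-! ### Regularity tools -/

theorem reg_of_inv {σ : Type} {F : Type} (P : Language σ) (D : List σ → F)
    (hfin : (Set.range D).Finite)
    (h : ∀ z z' t, D z = D z' → z ++ t ∈ P → z' ++ t ∈ P) : P.IsRegular := by
  classical
  apply Language.IsRegular.of_finite_range_leftQuotient
  have hch : ∀ d : Set.range D, ∃ z, D z = d.1 := fun d => d.2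
  choose f hf using hch
  have : Finite (Set.range D) := hfin
  refine (Set.finite_range (fun d : Set.range D => P.leftQuotient (f d))).subset ?_
  rintro _ ⟨z, rfl⟩
  refine ⟨⟨D z, z, rfl⟩, ?_⟩
  have hz := hf ⟨D z, z, rfl⟩
  ext t
  exact ⟨h _ _ t hz, h _ _ t hz.symm⟩

theorem reg_empty {σ : Type} : IsReg (∅ : Set (List σ)) := by
  apply reg_of_inv (F := Unit) _ (fun _ => ()) (Set.toFinite _)
  intro z z' t _ h
  exact h.elim

theorem reg_union {σ : Type} {A B : Set (List σ)} (hA : IsReg A) (hB : IsReg B) :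
    IsReg (A ∪ B) := Language.IsRegular.add hA hB

theorem reg_inter {σ : Type} {A B : Set (List σ)} (hA : IsReg A) (hB : IsReg B) :
    IsReg (A ∩ B) := Language.IsRegular.inf hA hB

theorem reg_biUnion {σ ι : Type} {s : Set ι} (hs : s.Finite) (A : ι → Set (List σ))
    (hA : ∀ i ∈ s, IsReg (A i)) : IsReg (⋃ i ∈ s, A i) := by
  induction s, hs using Set.Finite.induction_on with
  | empty => simpa using reg_empty
  | insert _ _ ih =>
    rw [Set.biUnion_insert]
    exact reg_union (hA _ (by simp)) (ih (fun i hi => hA i (by simp [hi])))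

theorem reg_reverse {σ : Type} {A : Set (List σ)} (hA : IsReg A) :
    IsReg {w : List σ | w.reverse ∈ A} := Language.IsRegular.reverse hA

theorem reg_filterMap {σ τ : Type} {A : Set (List τ)} (hA : IsReg A) (f : σ → Option τ) :
    IsReg {w : List σ | w.filterMap f ∈ A} := by
  apply reg_of_inv _ (fun z => Language.leftQuotient (A : Language τ) (z.filterMap f))
  · exact hA.finite_range_leftQuotient.subset (by rintro _ ⟨z, rfl⟩; exact ⟨_, rfl⟩)
  · intro z z' t hD ht
    change (z ++ t).filterMap f ∈ A at ht
    change (z' ++ t).filterMap f ∈ A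
    rw [List.filterMap_append] at ht ⊢
    have : t.filterMap f ∈ Language.leftQuotient (A : Language τ) (z.filterMap f) := ht
    rw [show Language.leftQuotient (A : Language τ) (z.filterMap f) = _ from hD] at this
    exact this

/-- a closed finite family of languages containing `P` -/
theorem reg_of_closed {σ : Type} (P : Language σ) (F : Set (Language σ)) (hF : F.Finite)
    (hP : P ∈ F) (h : ∀ Q ∈ F, ∀ a, Q.leftQuotient [a] ∈ F) : P.IsRegular := by
  apply Language.IsRegular.of_finite_range_leftQuotient
  refine hF.subset ?_
  rintro _ ⟨z, rfl⟩
  induction z using List.reverseRecOn with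
  | nil => exact hP
  | append_singleton z a ih =>
    rw [Language.leftQuotient_append]
    exact h _ ih a

/-! ### padding -/

section pad
variable {β : Type}

@[simp] theorem padR_nil_nil : padR ([] : List β) [] = [] := by simp [padR]
@[simp] theorem padR_cons_cons (a b : β) (x y) :
    padR (a :: x) (b :: y) = (some a, some b) :: padR x y := by simp [padR]
@[simp] theorem padR_nil_cons (b : β) (y) :
    padR [] (b :: y) = (none, some b) :: padR [] y := by
  simp [padR, List.replicate_succ]
@[simp] theorem padR_cons_nil (a : β) (x) :
    padR (a :: x) [] = (some a, none) :: padR x [] := by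
  simp [padR, List.replicate_succ]

theorem padL_eq (x y : List β) : padL x y = (padR x.reverse y.reverse).reverse := by
  unfold padL padR
  simp only [List.zip]
  rw [List.reverse_zipWith (by simp; omega)]
  simp

theorem padR_eq (x y : List β) : padR x y = (padL x.reverse y.reverse).reverse := by
  simp [padL_eq]

theorem padR_fst (x y : List β) : (padR x y).filterMap Prod.fst = x := by
  induction x generalizing y with
  | nil => induction y with
    | nil => simp
    | cons b y ih => simp [ih]
  | cons a x ih => cases y with
    | nil => simp [ih]
    | cons b y => simp [ih]

theorem padR_snd (x y : List β) : (padR x y).filterMap Prod.snd = y := by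
  induction x generalizing y with
  | nil => induction y with
    | nil => simp
    | cons b y ih => simp [ih]
  | cons a x ih => cases y with
    | nil => simpa using ih []
    | cons b y => simp [ih]

theorem padR_inj {x y x' y' : List β} (h : padR x y = padR x' y') : x = x' ∧ y = y' := by
  constructor
  · rw [← padR_fst x y, h, padR_fst]
  · rw [← padR_snd x y, h, padR_snd]

theorem padR_prefix_fst (n : ℕ) (x y : List β) :
    ((padR x y).take n).filterMap Prod.fst = x.take n := by
  induction n generalizing x y with
  | zero => simp
  | succ n ih => cases x <;> cases y <;> simp [ih]

theorem padR_prefix_snd (n : ℕ) (x y : List β) :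
    ((padR x y).take n).filterMap Prod.snd = y.take n := by
  induction n generalizing x y with
  | zero => simp
  | succ n ih => cases x <;> cases y <;> simp [ih]

theorem reg_pad : IsReg {p | ∃ x y : List β, p = padR x y} := by
  set W : Language (Option β × Option β) := {p | ∃ x y : List β, p = padR x y} with hW
  set WL : Language (Option β × Option β) := {p | ∃ y : List β, p = padR [] y} with hWL
  set WR : Language (Option β × Option β) := {p | ∃ x : List β, p = padR x []} with hWR
  set E : Language (Option β × Option β) := 0 with hE
  have mW : ∀ p, p ∈ W ↔ ∃ x y : List β, p = padR x y := fun p => Iff.rfl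
  have mWL : ∀ p, p ∈ WL ↔ ∃ y : List β, p = padR [] y := fun p => Iff.rfl
  have mWR : ∀ p, p ∈ WR ↔ ∃ y : List β, p = padR y [] := fun p => Iff.rfl
  refine reg_of_closed W {W, WL, WR, E} (by simp) (by simp) ?_
  have key : ∀ Q ∈ ({W, WL, WR, E} : Set (Language (Option β × Option β))), ∀ a,
      (Q.leftQuotient [a] = W) ∨ (Q.leftQuotient [a] = WL) ∨ (Q.leftQuotient [a] = WR) ∨
        (Q.leftQuotient [a] = E) := by
    rintro Q (rfl | rfl | rfl | rfl) ⟨a | a, b | b⟩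
    · right; right; right
      ext t
      simp only [Language.mem_leftQuotient, mW, hE, Language.notMem_zero, iff_false]
      rintro ⟨_ | _, _ | _, h⟩ <;> simp at h
    · right; left
      ext t
      simp only [Language.mem_leftQuotient, mW, mWL]
      constructor
      · rintro ⟨_ | _, _ | _, h⟩ <;> simp at h
        exact ⟨_, h.2⟩
      · rintro ⟨y, rfl⟩
        exact ⟨[], b :: y, by simp⟩
    · right; right; left
      ext t
      simp only [Language.mem_leftQuotient, mW, mWR]
      constructor
      · rintro ⟨_ | _, _ | _, h⟩ <;> simp at h
        exact ⟨_, h.2⟩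
      · rintro ⟨y, rfl⟩
        exact ⟨a :: y, [], by simp⟩
    · left
      ext t
      simp only [Language.mem_leftQuotient, mW]
      constructor
      · rintro ⟨_ | _, _ | _, h⟩ <;> simp at h
        exact ⟨_, _, h.2⟩
      · rintro ⟨x, y, rfl⟩
        exact ⟨a :: x, b :: y, by simp⟩
    · right; right; right
      ext t
      simp only [Language.mem_leftQuotient, mWL, hE, Language.notMem_zero, iff_false]
      rintro ⟨_ | _, h⟩ <;> simp at h
    · right; left
      ext t
      simp only [Language.mem_leftQuotient, mWL]
      constructor
      · rintro ⟨_ | _, h⟩ <;> simp at h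
        exact ⟨_, h.2⟩
      · rintro ⟨y, rfl⟩
        exact ⟨b :: y, by simp⟩
    · right; right; right
      ext t
      simp only [Language.mem_leftQuotient, mWL, hE, Language.notMem_zero, iff_false]
      rintro ⟨_ | _, h⟩ <;> simp at h
    · right; right; right
      ext t
      simp only [Language.mem_leftQuotient, mWL, hE, Language.notMem_zero, iff_false]
      rintro ⟨_ | _, h⟩ <;> simp at h
    · right; right; right
      ext t
      simp only [Language.mem_leftQuotient, mWR, hE, Language.notMem_zero, iff_false]
      rintro ⟨_ | _, h⟩ <;> simp at h
    · right; right; right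
      ext t
      simp only [Language.mem_leftQuotient, mWR, hE, Language.notMem_zero, iff_false]
      rintro ⟨_ | _, h⟩ <;> simp at h
    · right; right; left
      ext t
      simp only [Language.mem_leftQuotient, mWR]
      constructor
      · rintro ⟨_ | _, h⟩ <;> simp at h
        exact ⟨_, h.2⟩
      · rintro ⟨y, rfl⟩
        exact ⟨a :: y, by simp⟩
    · right; right; right
      ext t
      simp only [Language.mem_leftQuotient, mWR, hE, Language.notMem_zero, iff_false]
      rintro ⟨_ | _, h⟩ <;> simp at h
    all_goals
      right; right; right
      ext t
      simp [Language.mem_leftQuotient, hE, Language.notMem_zero]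
  intro Q hQ a
  rcases key Q hQ a with h | h | h | h <;> rw [h] <;> simp

end pad

/-! ### Transducers -/

inductive TPath {Q σ : Type} (step : Q → List σ → List σ → Q → Prop) :
    Q → List σ → List σ → Q → Prop
  | nil (q : Q) : TPath step q [] [] q
  | snoc {q q' q'' : Q} {x y a b : List σ} : TPath step q x y q' → step q' a b q'' →
      TPath step q (x ++ a) (y ++ b) q''

namespace TPath
variable {Q σ : Type} {step : Q → List σ → List σ → Q → Prop}

theorem single {q q' : Q} {a b : List σ} (h : step q a b q') : TPath step q a b q' := by
  simpa using TPath.snoc (TPath.nil q) h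

theorem trans {q q' q'' : Q} {x y a b : List σ} (h : TPath step q x y q')
    (h' : TPath step q' a b q'') : TPath step q (x ++ a) (y ++ b) q'' := by
  induction h' with
  | nil => simpa using h
  | snoc _ hs ih =>
    rw [← List.append_assoc, ← List.append_assoc]
    exact TPath.snoc ih hs

theorem rev {q q' : Q} {x y : List σ} (h : TPath step q x y q') :
    TPath (fun q a b q' => step q' a.reverse b.reverse q) q' x.reverse y.reverse q := by
  induction h with
  | nil => exact TPath.nil _
  | snoc _ hs ih =>
    rw [List.reverse_append, List.reverse_append]
    exact trans (single (by simpa using hs)) ih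

theorem lag_eq (lag : Q → ℤ)
    (hlag : ∀ q a b q', step q a b q' → lag q' = lag q + b.length - a.length)
    {q q' : Q} {x y : List σ} (h : TPath step q x y q') :
    lag q' = lag q + y.length - x.length := by
  induction h with
  | nil => simp
  | snoc _ hs ih =>
    have := hlag _ _ _ _ hs
    push_cast [List.length_append]
    omega

theorem mem_fin (F : Set Q) (hF : ∀ q a b q', step q a b q' → q ∈ F ∧ q' ∈ F)
    {q q' : Q} {x y : List σ} (hq : q ∈ F) (h : TPath step q x y q') : q' ∈ F := by
  cases h with
  | nil => exact hq
  | snoc _ hs => exact (hF _ _ _ _ hs).2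

theorem split (N : ℕ) (hN : ∀ q a b q', step q a b q' → a.length ≤ N ∧ b.length ≤ N)
    {q q' : Q} {x y : List σ} (h : TPath step q x y q') :
    ∀ (z1 z2 x' y' : List σ), x = z1 ++ x' → y = z2 ++ y' →
      ∃ r s t x'' y'', TPath step q (z1 ++ s) (z2 ++ t) r ∧ TPath step r x'' y'' q' ∧
        x' = s ++ x'' ∧ y' = t ++ y'' ∧ (s.length ≤ N ∨ t.length ≤ N) := by
  induction h with
  | nil =>
    intro z1 z2 x' y' hx hy
    simp only [List.nil_eq, List.append_eq_nil_iff] at hx hy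
    obtain ⟨rfl, rfl⟩ := hx
    obtain ⟨rfl, rfl⟩ := hy
    exact ⟨q, [], [], [], [], TPath.nil q, TPath.nil q, by simp⟩
  | @snoc r1 r2 x y a b hp hs ih =>
    intro z1 z2 x' y' hx hy
    by_cases hc : z1.length ≤ x.length ∧ z2.length ≤ y.length
    · obtain ⟨hc1, hc2⟩ := hc
      have e1 : x = z1 ++ x.drop z1.length := by
        have := congrArg (List.take z1.length) hx
        rw [List.take_append_of_le_length hc1, List.take_left] at this
        conv_lhs => rw [← List.take_append_drop z1.length x, this]
      have e2 : y = z2 ++ y.drop z2.length := by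
        have := congrArg (List.take z2.length) hy
        rw [List.take_append_of_le_length hc2, List.take_left] at this
        conv_lhs => rw [← List.take_append_drop z2.length y, this]
      obtain ⟨r, s, t, x'', y'', h1, h2, h3, h4, h5⟩ := ih z1 z2 _ _ e1 e2
      refine ⟨r, s, t, x'' ++ a, y'' ++ b, h1, TPath.snoc h2 hs, ?_, ?_, h5⟩
      · rw [e1, List.append_assoc, List.append_right_inj] at hx
        rw [← hx, h3, List.append_assoc]
      · rw [e2, List.append_assoc, List.append_right_inj] at hy
        rw [← hy, h4, List.append_assoc]
    · refine ⟨r2, x', y', [], [], ?_, TPath.nil _, by simp, by simp, ?_⟩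
      · rw [← hx, ← hy]; exact TPath.snoc hp hs
      · have l1 := congrArg List.length hx
        have l2 := congrArg List.length hy
        have := hN _ _ _ _ hs
        simp only [List.length_append] at l1 l2
        omega

theorem regR [Finite σ] (F : Set Q) (hFf : F.Finite)
    (hF : ∀ q a b q', step q a b q' → q ∈ F ∧ q' ∈ F)
    (N K : ℕ) (hN : ∀ q a b q', step q a b q' → a.length ≤ N ∧ b.length ≤ N)
    (lag : Q → ℤ) (hlag : ∀ q a b q', step q a b q' → lag q' = lag q + b.length - a.length)
    (hK : ∀ q ∈ F, |lag q| ≤ K)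
    {L1 L2 : Set (List σ)} (hL1 : IsReg L1) (hL2 : IsReg L2) (q0 q1 : Q) (hq0 : q0 ∈ F) :
    IsReg {p | ∃ x ∈ L1, ∃ y ∈ L2, TPath step q0 x y q1 ∧ p = padR x y} := by
  classical
  set B : ℕ := N + 4 * K with hB
  let f1 : List (Option σ × Option σ) → List σ := fun z => z.filterMap Prod.fst
  let f2 : List (Option σ × Option σ) → List σ := fun z => z.filterMap Prod.snd
  let W : Language (Option σ × Option σ) := {p | ∃ x y : List σ, p = padR x y}
  have hW : W.IsRegular := reg_pad
  let S : List (Option σ × Option σ) → Set (Q × List σ × List σ) := fun z =>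
    {r | TPath step q0 (f1 z ++ r.2.1) (f2 z ++ r.2.2) r.1 ∧ r.2.1.length ≤ B ∧ r.2.2.length ≤ B}
  have hSfin : {r : Q × List σ × List σ | r.1 ∈ F ∧ r.2.1.length ≤ B ∧ r.2.2.length ≤ B}.Finite := by
    have h1 : {l : List σ | l.length ≤ B}.Finite := List.finite_length_le σ B
    refine (hFf.prod (h1.prod h1)).subset ?_
    rintro ⟨a, b, c⟩ ⟨h, h', h''⟩
    exact ⟨h, h', h''⟩
  let D : List (Option σ × Option σ) →
      Language (Option σ × Option σ) × Language σ × Language σ × Set (Q × List σ × List σ) :=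
    fun z => (W.leftQuotient z, Language.leftQuotient L1 (f1 z), Language.leftQuotient L2 (f2 z), S z)
  apply reg_of_inv _ D
  · refine (hW.finite_range_leftQuotient.prod (hL1.finite_range_leftQuotient.prod
      (hL2.finite_range_leftQuotient.prod hSfin.finite_subsets))).subset ?_
    rintro _ ⟨z, rfl⟩
    refine ⟨⟨_, rfl⟩, ⟨_, rfl⟩, ⟨_, rfl⟩, ?_⟩
    rintro r ⟨h, h', h''⟩
    exact ⟨mem_fin F hF hq0 h, h', h''⟩
  · intro z z' t hD ht
    simp only [D, Prod.mk.injEq] at hD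
    obtain ⟨d1, d2, d3, d4⟩ := hD
    obtain ⟨x, hx, y, hy, hp, e⟩ := ht
    have ex : f1 z ++ f1 t = x := by
      rw [← padR_fst x y, ← e]; simp [f1]
    have ey : f2 z ++ f2 t = y := by
      rw [← padR_snd x y, ← e]; simp [f2]
    have w1 : t ∈ W.leftQuotient z := ⟨x, y, e⟩
    rw [d1] at w1
    obtain ⟨x1, y1, e1⟩ := w1
    have w2 : f1 t ∈ Language.leftQuotient L1 (f1 z) := by
      change f1 z ++ f1 t ∈ L1; rwa [ex]
    rw [d2] at w2
    have w3 : f2 t ∈ Language.leftQuotient L2 (f2 z) := by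
      change f2 z ++ f2 t ∈ L2; rwa [ey]
    rw [d3] at w3
    have ex1 : f1 z' ++ f1 t = x1 := by
      rw [← padR_fst x1 y1, ← e1]; simp [f1]
    have ey1 : f2 z' ++ f2 t = y1 := by
      rw [← padR_snd x1 y1, ← e1]; simp [f2]
    obtain ⟨r, s, u, x'', y'', h1, h2, h3, h4, h5⟩ := split N hN hp (f1 z) (f2 z) _ _ ex.symm ey.symm
    have hz : z = (padR x y).take z.length := by rw [← e]; simp
    have l1 : (f1 z).length = min z.length x.length := by
      have : f1 z = x.take z.length := by
        conv_lhs => rw [hz]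
        exact padR_prefix_fst _ _ _
      rw [this, List.length_take]
    have l2 : (f2 z).length = min z.length y.length := by
      have : f2 z = y.take z.length := by
        conv_lhs => rw [hz]
        exact padR_prefix_snd _ _ _
      rw [this, List.length_take]
    have hrF := mem_fin F hF hq0 h1
    have k0 := abs_le.1 (hK _ hq0)
    have k1 := abs_le.1 (hK _ hrF)
    have k2 := abs_le.1 (hK _ (mem_fin F hF hq0 hp))
    have g1 := lag_eq lag hlag h1
    have g2 := lag_eq lag hlag hp
    push_cast [List.length_append] at g1
    have hr : (r, s, u) ∈ S z := ⟨h1, by simp only []; omega, by simp only []; omega⟩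
    rw [d4] at hr
    refine ⟨x1, ?_, y1, ?_, ?_, e1⟩
    · rw [← ex1]; exact w2
    · rw [← ey1]; exact w3
    · rw [← ex1, ← ey1, h3, h4, ← List.append_assoc, ← List.append_assoc]
      exact trans hr.1 h2

theorem regL [Finite σ] (F : Set Q) (hFf : F.Finite)
    (hF : ∀ q a b q', step q a b q' → q ∈ F ∧ q' ∈ F)
    (N K : ℕ) (hN : ∀ q a b q', step q a b q' → a.length ≤ N ∧ b.length ≤ N)
    (lag : Q → ℤ) (hlag : ∀ q a b q', step q a b q' → lag q' = lag q + b.length - a.length)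
    (hK : ∀ q ∈ F, |lag q| ≤ K)
    {L1 L2 : Set (List σ)} (hL1 : IsReg L1) (hL2 : IsReg L2) (q0 q1 : Q) (hq1 : q1 ∈ F) :
    IsReg {p | ∃ x ∈ L1, ∃ y ∈ L2, TPath step q0 x y q1 ∧ p = padL x y} := by
  have := regR (step := fun q a b q' => step q' a.reverse b.reverse q) F hFf
    (fun q a b q' h => (hF _ _ _ _ h).symm) N K
    (fun q a b q' h => by simpa using hN _ _ _ _ h) (fun q => - lag q)
    (fun q a b q' h => by have := hlag _ _ _ _ h; simp at this; omega)
    (fun q h => by simpa using hK q h) (reg_reverse hL1) (reg_reverse hL2) q1 q0 hq1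
  have := reg_reverse this
  convert this using 1
  ext p
  constructor
  · rintro ⟨x, hx, y, hy, h, rfl⟩
    exact ⟨x.reverse, by simpa using hx, y.reverse, by simpa using hy, rev h, by simp [padL_eq]⟩
  · rintro ⟨x, hx, y, hy, h, e⟩
    refine ⟨x.reverse, hx, y.reverse, hy, ?_, ?_⟩
    · simpa using rev h
    · rw [padL_eq]; simp [← e]

end TPath



/-! ### Word equality -/

namespace WordEq
variable {α : Type} {R : Set (List α × List α)}

theorem refl (x : List α) : WordEq R x x := Relation.EqvGen.refl x
theorem symm {x y : List α} (h : WordEq R x y) : WordEq R y x := Relation.EqvGen.symm _ _ h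
theorem trans {x y z : List α} (h : WordEq R x y) (h' : WordEq R y z) : WordEq R x z :=
  Relation.EqvGen.trans _ _ _ h h'
theorem of_eq {x y : List α} (h : x = y) : WordEq R x y := h ▸ refl x

theorem ctx {x y : List α} (h : WordEq R x y) (p s : List α) :
    WordEq R (p ++ x ++ s) (p ++ y ++ s) := by
  induction h with
  | rel x y h =>
    obtain ⟨p', u, v, s', h, rfl, rfl⟩ := h
    exact Relation.EqvGen.rel _ _ ⟨p ++ p', u, v, s' ++ s, h, by simp, by simp⟩
  | refl x => exact refl _
  | symm _ _ _ ih => exact symm ih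
  | trans _ _ _ _ _ ih ih' => exact trans ih ih'

theorem app {x y x' y' : List α} (h : WordEq R x y) (h' : WordEq R x' y') :
    WordEq R (x ++ x') (y ++ y') := by
  have h1 := ctx h [] x'
  have h2 := ctx h' y []
  simp only [List.nil_append, List.append_nil] at h1 h2
  exact trans h1 h2

theorem rule {u v : List α} (h : (u, v) ∈ R) : WordEq R u v :=
  Relation.EqvGen.rel _ _ ⟨[], u, v, [], h, by simp, by simp⟩

/-- map along a homomorphism -/
theorem hom {β : Type} {R' : Set (List β × List β)} (f : α → List β)
    (hf : ∀ u v, (u, v) ∈ R → WordEq R' (expandW f u) (expandW f v))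
    {x y : List α} (h : WordEq R x y) : WordEq R' (expandW f x) (expandW f y) := by
  induction h with
  | rel x y h =>
    obtain ⟨p', u, v, s', h, rfl, rfl⟩ := h
    have := ctx (hf u v h) (expandW f p') (expandW f s')
    simpa [expandW] using this
  | refl x => exact refl _
  | symm _ _ _ ih => exact symm ih
  | trans _ _ _ _ _ ih ih' => exact trans ih ih'

end WordEq

@[simp] theorem expandW_nil {α β : Type} (f : α → List β) : expandW f [] = [] := rfl
@[simp] theorem expandW_cons {α β : Type} (f : α → List β) (a : α) (x : List α) :
    expandW f (a :: x) = f a ++ expandW f x := by simp [expandW]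
@[simp] theorem expandW_append {α β : Type} (f : α → List β) (x y : List α) :
    expandW f (x ++ y) = expandW f x ++ expandW f y := by simp [expandW]

def Rrev {α : Type} (R : Set (List α × List α)) : Set (List α × List α) :=
  {p | (p.1.reverse, p.2.reverse) ∈ R}

theorem Rrev_Rrev {α : Type} (R : Set (List α × List α)) : Rrev (Rrev R) = R := by
  ext ⟨x, y⟩; simp [Rrev]

theorem OneStep.rev {α : Type} {R : Set (List α × List α)} {x y : List α} (h : OneStep R x y) :
    OneStep (Rrev R) x.reverse y.reverse := by
  obtain ⟨p, u, v, s, h, rfl, rfl⟩ := h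
  exact ⟨s.reverse, u.reverse, v.reverse, p.reverse, by simpa [Rrev] using h, by simp, by simp⟩

theorem WordEq.rev {α : Type} {R : Set (List α × List α)} {x y : List α} (h : WordEq R x y) :
    WordEq (Rrev R) x.reverse y.reverse := by
  induction h with
  | rel x y h => exact Relation.EqvGen.rel _ _ h.rev
  | refl x => exact WordEq.refl _
  | symm _ _ _ ih => exact WordEq.symm ih
  | trans _ _ _ _ _ ih ih' => exact WordEq.trans ih ih'

theorem WordEq.of_rev {α : Type} {R : Set (List α × List α)} {x y : List α}
    (h : WordEq (Rrev R) x.reverse y.reverse) : WordEq R x y := by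
  have := h.rev
  simpa [Rrev_Rrev] using this

/-! ### Difference machine -/

def dstep {α γ : Type} (R : Set (List α × List α)) (g : γ → List α) (N : ℕ) :
    (List α × ℤ) → List γ → List γ → (List α × ℤ) → Prop := fun q a b q' =>
  (q.1.length ≤ N ∧ |q.2| ≤ N) ∧ (q'.1.length ≤ N ∧ |q'.2| ≤ N) ∧
    (a.length ≤ N ∧ b.length ≤ N) ∧ q'.2 = q.2 + b.length - a.length ∧
    WordEq R (expandW g a ++ q'.1) (q.1 ++ expandW g b)

def RM {α γ : Type} (R : Set (List α × List α)) (g : γ → List α) (N : ℕ)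
    (w : List γ) (c : List α) (y : List γ) : Prop :=
  ∃ n : ℤ, |n| ≤ N ∧ TPath (dstep R g N) ([], 0) w y (c, n)

theorem dpath_sound {α γ : Type} {R : Set (List α × List α)} {g : γ → List α} {N : ℕ}
    {q q' : List α × ℤ} {x y : List γ} (h : TPath (dstep R g N) q x y q') :
    WordEq R (expandW g x ++ q'.1) (q.1 ++ expandW g y) := by
  induction h with
  | nil => simpa using WordEq.refl _
  | snoc _ hs ih =>
    have h1 := hs.2.2.2.2
    simp only [expandW_append, List.append_assoc]
    refine (WordEq.app (WordEq.refl _) h1).trans ?_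
    rw [← List.append_assoc, ← List.append_assoc]
    exact WordEq.app ih (WordEq.refl _)

theorem RM.sound {α γ : Type} {R : Set (List α × List α)} {g : γ → List α} {N : ℕ}
    {w y : List γ} {c : List α} (h : RM R g N w c y) :
    WordEq R (expandW g w ++ c) (expandW g y) := by
  obtain ⟨n, _, h⟩ := h
  simpa using dpath_sound h

theorem finZ (N : ℕ) : {n : ℤ | |n| ≤ N}.Finite := by
  have : {n : ℤ | |n| ≤ N} = Set.Icc (-(N : ℤ)) N := by
    ext n; simp [abs_le]
  rw [this]; exact Set.finite_Icc _ _

theorem RM.regR {α γ : Type} [Finite α] [Finite γ] (R : Set (List α × List α)) (g : γ → List α)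
    (N : ℕ) (c : List α) (hc : c.length ≤ N) {L1 L2 : Set (List γ)} (h1 : IsReg L1)
    (h2 : IsReg L2) :
    IsReg {p | ∃ x ∈ L1, ∃ y ∈ L2, RM R g N x c y ∧ p = padR x y} := by
  have key : {p | ∃ x ∈ L1, ∃ y ∈ L2, RM R g N x c y ∧ p = padR x y} =
      ⋃ n ∈ {n : ℤ | |n| ≤ N}, {p | ∃ x ∈ L1, ∃ y ∈ L2,
        TPath (dstep R g N) ([], 0) x y (c, n) ∧ p = padR x y} := by
    ext p
    simp only [RM, Set.mem_iUnion, Set.mem_ofPred_eq]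
    constructor
    · rintro ⟨x, hx, y, hy, ⟨n, hn, h⟩, e⟩
      exact ⟨n, hn, x, hx, y, hy, h, e⟩
    · rintro ⟨n, hn, x, hx, y, hy, h, e⟩
      exact ⟨x, hx, y, hy, ⟨n, hn, h⟩, e⟩
  rw [key]
  refine reg_biUnion (finZ N) _ fun n hn => ?_
  exact TPath.regR {q : List α × ℤ | q.1.length ≤ N ∧ |q.2| ≤ N}
    (((List.finite_length_le α N).prod (finZ N)).subset fun q hq => ⟨hq.1, hq.2⟩)
    (fun q a b q' h => ⟨h.1, h.2.1⟩) N N (fun q a b q' h => h.2.2.1) (fun q => q.2)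
    (fun q a b q' h => h.2.2.2.1) (fun q h => h.2) h1 h2 _ _ (by simp)

theorem RM.regL {α γ : Type} [Finite α] [Finite γ] (R : Set (List α × List α)) (g : γ → List α)
    (N : ℕ) (c : List α) (hc : c.length ≤ N) {L1 L2 : Set (List γ)} (h1 : IsReg L1)
    (h2 : IsReg L2) :
    IsReg {p | ∃ x ∈ L1, ∃ y ∈ L2, RM R g N x c y ∧ p = padL x y} := by
  have key : {p | ∃ x ∈ L1, ∃ y ∈ L2, RM R g N x c y ∧ p = padL x y} =
      ⋃ n ∈ {n : ℤ | |n| ≤ N}, {p | ∃ x ∈ L1, ∃ y ∈ L2,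
        TPath (dstep R g N) ([], 0) x y (c, n) ∧ p = padL x y} := by
    ext p
    simp only [RM, Set.mem_iUnion, Set.mem_ofPred_eq]
    constructor
    · rintro ⟨x, hx, y, hy, ⟨n, hn, h⟩, e⟩
      exact ⟨n, hn, x, hx, y, hy, h, e⟩
    · rintro ⟨n, hn, x, hx, y, hy, h, e⟩
      exact ⟨x, hx, y, hy, ⟨n, hn, h⟩, e⟩
  rw [key]
  refine reg_biUnion (finZ N) _ fun n hn => ?_
  exact TPath.regL {q : List α × ℤ | q.1.length ≤ N ∧ |q.2| ≤ N}
    (((List.finite_length_le α N).prod (finZ N)).subset fun q hq => ⟨hq.1, hq.2⟩)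
    (fun q a b q' h => ⟨h.1, h.2.1⟩) N N (fun q a b q' h => h.2.2.1) (fun q => q.2)
    (fun q a b q' h => h.2.2.2.1) (fun q h => h.2) h1 h2 _ _ ⟨hc, hn⟩

def gs {α : Type} : α → List α := fun a => [a]
def go {α : Type} : Option α → List α := fun o => o.toList

@[simp] theorem expandW_gs {α : Type} (w : List α) : expandW gs w = w := by
  induction w with
  | nil => rfl
  | cons a w ih => simp [ih, gs]

@[simp] theorem expandW_go {α : Type} (w : List α) : expandW go (w.map some) = w := by
  induction w with
  | nil => rfl
  | cons a w ih => simp [ih, go]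

theorem dpath_lift {α : Type} {R : Set (List α × List α)} {N : ℕ}
    {q q' : List α × ℤ} {x y : List α} (h : TPath (dstep R gs N) q x y q') :
    TPath (dstep R go N) q (x.map some) (y.map some) q' := by
  induction h with
  | nil => exact TPath.nil _
  | snoc _ hs ih =>
    rw [List.map_append, List.map_append]
    refine TPath.snoc ih ?_
    obtain ⟨h1, h2, h3, h4, h5⟩ := hs
    exact ⟨h1, h2, by simpa using h3, by simpa using h4, by simpa using h5⟩

theorem RM.lift1 {α : Type} {R : Set (List α × List α)} {N : ℕ} (hN : 1 ≤ N)
    {x y c : List α} (h : RM R gs N x c y) :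
    RM R go N (none :: x.map some) c (none :: y.map some) := by
  obtain ⟨n, hn, h⟩ := h
  refine ⟨n, hn, ?_⟩
  refine TPath.trans (q' := ([], 0)) (x := [none]) (y := [none]) (TPath.single ?_) (dpath_lift h)
  exact ⟨by simp, by simp, by simpa using hN, by simp, WordEq.of_eq (by simp [go])⟩

theorem RM.lift2 {α : Type} {R : Set (List α × List α)} {N : ℕ} (hN : 1 ≤ N)
    {x y c : List α} (hc : c.length ≤ N) (h : RM R gs N x c y) :
    RM R go N (x.map some ++ [none]) c (y.map some ++ [none]) := by
  obtain ⟨n, hn, h⟩ := h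
  refine ⟨n, hn, ?_⟩
  refine TPath.trans (dpath_lift h) (TPath.single ?_)
  exact ⟨⟨hc, hn⟩, ⟨hc, hn⟩, by simpa using hN, by simp, WordEq.of_eq (by simp [go])⟩

theorem RM.copy {α : Type} (R : Set (List α × List α)) {N : ℕ} (hN : 1 ≤ N) (w : List α) :
    TPath (dstep R gs N) ([], 0) w w ([], 0) := by
  induction w using List.reverseRecOn with
  | nil => exact TPath.nil _
  | append_singleton w a ih =>
    exact TPath.snoc ih ⟨by simp, by simp, by simpa using hN, by simp, WordEq.of_eq (by simp)⟩

theorem reg_shape {α : Type} : IsReg {w : List (Option α) | ∃ x : List α, w = none :: x.map some} := by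
  set W : Language (Option α) := {w | ∃ x : List α, w = none :: x.map some} with hW
  set V : Language (Option α) := {w | ∃ x : List α, w = x.map some} with hV
  have mW : ∀ p, p ∈ W ↔ ∃ x : List α, p = none :: x.map some := fun p => Iff.rfl
  have mV : ∀ p, p ∈ V ↔ ∃ x : List α, p = x.map some := fun p => Iff.rfl
  refine reg_of_closed W {W, V, 0} (by simp) (by simp) ?_
  rintro Q (rfl | rfl | rfl) (_ | a)
  · right; left
    ext t; simp [mW, mV, Language.mem_leftQuotient]
  · right; right
    ext t; simp [mW, Language.mem_leftQuotient]
  · right; right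
    ext t
    simp only [mV, Language.mem_leftQuotient, Language.notMem_zero, iff_false]
    rintro ⟨_ | _, h⟩ <;> simp at h
  · right; left
    ext t
    simp only [mV, Language.mem_leftQuotient]
    constructor
    · rintro ⟨_ | _, h⟩ <;> simp at h
      exact ⟨_, h.2⟩
    · rintro ⟨x, rfl⟩
      exact ⟨a :: x, by simp⟩
  · right; right
    ext t; simp [Language.mem_leftQuotient]
  · right; right
    ext t; simp [Language.mem_leftQuotient]

/-- Main criterion. -/
theorem biauto_of_RM {α : Type} [Fintype α] (R : Set (List α × List α)) (L : Set (List α))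
    (hL : IsReg L) (onto : ∀ w, ∃ x ∈ L, WordEq R x w)
    (uniq : ∀ x ∈ L, ∀ y ∈ L, WordEq R x y → x = y) (N : ℕ) (hN : 1 ≤ N)
    (hR : ∀ w ∈ L, ∀ b, ∃ y ∈ L, RM R gs N w [b] y)
    (hLm : ∀ w ∈ L, ∀ b, ∃ y ∈ L, RM (Rrev R) gs N w.reverse [b] y.reverse) :
    MonBiautomatic R := by
  set L' : Set (List (Option α)) := {w | ∃ x ∈ L, w = none :: x.map some} with hL'
  have eL' : L' = {w | ∃ x : List α, w = none :: x.map some} ∩ {w | w.filterMap id ∈ L} := by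
    ext w
    constructor
    · rintro ⟨x, hx, rfl⟩
      exact ⟨⟨x, rfl⟩, by simpa using hx⟩
    · rintro ⟨⟨x, rfl⟩, h⟩
      exact ⟨x, by simpa using h, rfl⟩
  have regL' : IsReg L' := by rw [eL']; exact reg_inter reg_shape (reg_filterMap hL id)
  have ex : ∀ x : List α, expandW go (none :: x.map some) = x := by intro x; simp [go]
  have exr : ∀ x : List α, expandW go ((x.map some).reverse ++ [none]) = x.reverse := by
    intro x; rw [← List.map_reverse, expandW_append, expandW_go]; simp [go]
  -- right multiplication by `c`
  have right : ∀ c : List α, c.length ≤ N → (∀ w ∈ L, ∃ y ∈ L, RM R gs N w c y) →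
      ∀ x ∈ L', ∀ y ∈ L', WordEq R (expandW go x ++ c) (expandW go y) ↔ RM R go N x c y := by
    rintro c hc h _ ⟨x, hx, rfl⟩ _ ⟨y, hy, rfl⟩
    constructor
    · intro hw
      obtain ⟨y', hy', h'⟩ := h x hx
      have h2 := h'.sound
      rw [expandW_gs, expandW_gs] at h2
      rw [ex, ex] at hw
      have := uniq y hy y' hy' (hw.symm.trans h2)
      subst this
      exact h'.lift1 hN
    · intro h; exact h.sound
  have left : ∀ c : List α, c.length ≤ N → c.reverse = c →
      (∀ w ∈ L, ∃ y ∈ L, RM (Rrev R) gs N w.reverse c y.reverse) →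
      ∀ x ∈ L', ∀ y ∈ L', WordEq R (c ++ expandW go x) (expandW go y) ↔
        RM (Rrev R) go N x.reverse c y.reverse := by
    rintro c hc hcr h _ ⟨x, hx, rfl⟩ _ ⟨y, hy, rfl⟩
    constructor
    · intro hw
      obtain ⟨y', hy', h'⟩ := h x hx
      have h2 := h'.sound
      rw [expandW_gs, expandW_gs] at h2
      rw [ex, ex] at hw
      have h3 : WordEq R (c ++ x) y' := by
        apply WordEq.of_rev
        rw [List.reverse_append, hcr]; exact h2
      have := uniq y hy y' hy' (hw.symm.trans h3)
      subst this
      have := h'.lift2 hN hc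
      simpa using this
    · intro h
      have h2 := h.sound
      rw [List.reverse_cons, List.reverse_cons, exr, exr] at h2
      rw [ex, ex]
      apply WordEq.of_rev
      rw [List.reverse_append, hcr]; exact h2
  have hcopy : ∀ w ∈ L, ∃ y ∈ L, RM R gs N w [] y := fun w hw =>
    ⟨w, hw, 0, by simp, RM.copy R hN w⟩
  have lreg : ∀ c : List α, c.length ≤ N → c.reverse = c →
      (∀ w ∈ L, ∃ y ∈ L, RM (Rrev R) gs N w.reverse c y.reverse) →
      IsReg {p | ∃ x ∈ L', ∃ y ∈ L', WordEq R (c ++ expandW go x) (expandW go y) ∧ p = padR x y} ∧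
      IsReg {p | ∃ x ∈ L', ∃ y ∈ L', WordEq R (c ++ expandW go x) (expandW go y) ∧ p = padL x y} := by
    intro c hc hcr h
    constructor
    · have := reg_reverse (RM.regL (Rrev R) go N c hc (reg_reverse regL') (reg_reverse regL'))
      convert this using 1
      ext p
      constructor
      · rintro ⟨x, hx, y, hy, hw, rfl⟩
        exact ⟨x.reverse, by simpa using hx, y.reverse, by simpa using hy,
          (left c hc hcr h x hx y hy).1 hw, by simp [padR_eq]⟩
      · rintro ⟨x, hx, y, hy, hw, e⟩
        refine ⟨x.reverse, hx, y.reverse, hy, (left c hc hcr h _ hx _ hy).2 (by simpa using hw), ?_⟩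
        rw [padR_eq]; simp [← e]
    · have := reg_reverse (RM.regR (Rrev R) go N c hc (reg_reverse regL') (reg_reverse regL'))
      convert this using 1
      ext p
      constructor
      · rintro ⟨x, hx, y, hy, hw, rfl⟩
        exact ⟨x.reverse, by simpa using hx, y.reverse, by simpa using hy,
          (left c hc hcr h x hx y hy).1 hw, by simp [padL_eq]⟩
      · rintro ⟨x, hx, y, hy, hw, e⟩
        refine ⟨x.reverse, hx, y.reverse, hy, (left c hc hcr h _ hx _ hy).2 (by simpa using hw), ?_⟩
        rw [padL_eq]; simp [← e]
  have rreg : ∀ c : List α, c.length ≤ N → (∀ w ∈ L, ∃ y ∈ L, RM R gs N w c y) →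
      IsReg {p | ∃ x ∈ L', ∃ y ∈ L', WordEq R (expandW go x ++ c) (expandW go y) ∧ p = padR x y} ∧
      IsReg {p | ∃ x ∈ L', ∃ y ∈ L', WordEq R (expandW go x ++ c) (expandW go y) ∧ p = padL x y} := by
    intro c hc h
    constructor
    · convert RM.regR R go N c hc regL' regL' using 1
      ext p
      constructor
      · rintro ⟨x, hx, y, hy, hw, e⟩
        exact ⟨x, hx, y, hy, (right c hc h x hx y hy).1 hw, e⟩
      · rintro ⟨x, hx, y, hy, hw, e⟩
        exact ⟨x, hx, y, hy, (right c hc h x hx y hy).2 hw, e⟩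
    · convert RM.regL R go N c hc regL' regL' using 1
      ext p
      constructor
      · rintro ⟨x, hx, y, hy, hw, e⟩
        exact ⟨x, hx, y, hy, (right c hc h x hx y hy).1 hw, e⟩
      · rintro ⟨x, hx, y, hy, hw, e⟩
        exact ⟨x, hx, y, hy, (right c hc h x hx y hy).2 hw, e⟩
  have hcopyL : ∀ w ∈ L, ∃ y ∈ L, RM (Rrev R) gs N w.reverse [] y.reverse := fun w hw =>
    ⟨w, hw, 0, by simp, RM.copy _ hN _⟩
  refine ⟨Option α, inferInstance, go, L', regL', ?_, ?_, ?_, ?_, ?_, ?_, ?_, ?_⟩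
  · rintro _ ⟨x, _, rfl⟩; simp
  · intro w
    obtain ⟨x, hx, h⟩ := onto w
    exact ⟨_, ⟨x, hx, rfl⟩, by rw [ex]; exact h⟩
  · simpa using (rreg [] (by simp) hcopy).1
  · simpa using (rreg [] (by simp) hcopy).2
  · rintro (_ | b)
    · exact (rreg [] (by simp) hcopy).1
    · exact (rreg [b] (by simpa using hN) (fun w hw => hR w hw b)).1
  · rintro (_ | b)
    · exact (lreg [] (by simp) rfl hcopyL).1
    · exact (lreg [b] (by simpa using hN) rfl (fun w hw => hLm w hw b)).1
  · rintro (_ | b)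
    · exact (rreg [] (by simp) hcopy).2
    · exact (rreg [b] (by simpa using hN) (fun w hw => hR w hw b)).2
  · rintro (_ | b)
    · exact (lreg [] (by simp) rfl hcopyL).2
    · exact (lreg [b] (by simpa using hN) rfl (fun w hw => hLm w hw b)).2

/-- Transfer along an isomorphism of presented monoids. -/
theorem biauto_transfer {α β : Type} (R : Set (List α × List α)) (R' : Set (List β × List β))
    (f : β → List α) (i : α → List β)
    (h1 : ∀ u v, (u, v) ∈ R' → WordEq R (expandW f u) (expandW f v))
    (h2 : ∀ u v, (u, v) ∈ R → WordEq R' (expandW i u) (expandW i v))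
    (h3 : ∀ b, WordEq R' (expandW i (f b)) [b]) (h4 : ∀ a, WordEq R (expandW f (i a)) [a])
    (h : MonBiautomatic R') : MonBiautomatic R := by
  have e3 : ∀ x : List β, WordEq R' (expandW i (expandW f x)) x := by
    intro x
    induction x with
    | nil => exact WordEq.refl _
    | cons b x ih => simpa using WordEq.app (h3 b) ih
  have e4 : ∀ x : List α, WordEq R (expandW f (expandW i x)) x := by
    intro x
    induction x with
    | nil => exact WordEq.refl _
    | cons b x ih => simpa using WordEq.app (h4 b) ih
  have key : ∀ x y : List β, WordEq R (expandW f x) (expandW f y) ↔ WordEq R' x y := by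
    intro x y
    constructor
    · intro h
      exact ((e3 x).symm.trans (WordEq.hom i h2 h)).trans (e3 y)
    · intro h; exact WordEq.hom f h1 h
  obtain ⟨γ, hγ, g, L, hs⟩ := h
  have eg : ∀ x : List γ, expandW (fun c => expandW f (g c)) x = expandW f (expandW g x) := by
    intro x
    induction x with
    | nil => rfl
    | cons c x ih => simp [ih]
  refine ⟨γ, hγ, fun c => expandW f (g c), L, hs.reg, hs.ne, ?_, ?_, ?_, ?_, ?_, ?_, ?_⟩
  · intro w
    obtain ⟨x, hx, h⟩ := hs.onto (expandW i w)
    exact ⟨x, hx, by rw [eg]; exact ((key _ _).2 h).trans (e4 w)⟩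
  · simpa only [eg, key] using hs.eqR_reg
  · simpa only [eg, key] using hs.eqL_reg
  · simpa only [eg, ← expandW_append, key] using hs.mulRR_reg
  · simpa only [eg, ← expandW_append, key] using hs.mulLR_reg
  · simpa only [eg, ← expandW_append, key] using hs.mulRL_reg
  · simpa only [eg, ← expandW_append, key] using hs.mulLL_reg

theorem biauto_congr {α : Type} (R R' : Set (List α × List α))
    (h1 : ∀ u v, (u, v) ∈ R' → WordEq R u v) (h2 : ∀ u v, (u, v) ∈ R → WordEq R' u v)
    (h : MonBiautomatic R') : MonBiautomatic R := by
  refine biauto_transfer R R' gs gs ?_ ?_ ?_ ?_ h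
  · simpa using h1
  · simpa using h2
  · intro b; simp only [expandW_gs]; exact WordEq.refl _
  · intro b; simp only [expandW_gs]; exact WordEq.refl _

/-- Reversal. -/
theorem biauto_rev {α : Type} (R : Set (List α × List α))
    (h : MonBiautomatic R) : MonBiautomatic (Rrev R) := by
  obtain ⟨γ, hγ, g, L, hs⟩ := h
  have eg : ∀ x : List γ, expandW (fun c => (g c).reverse) x = (expandW g x.reverse).reverse := by
    intro x
    induction x with
    | nil => rfl
    | cons c x ih => simp [ih]
  have ew : ∀ x y, WordEq (Rrev R) x y ↔ WordEq R x.reverse y.reverse := by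
    intro x y
    constructor
    · intro h; have := h.rev; rwa [Rrev_Rrev] at this
    · intro h; have := h.rev; simpa using this
  have hset : ∀ (P : List γ → List γ → Prop),
      ({p | ∃ x ∈ {w : List γ | w.reverse ∈ L}, ∃ y ∈ {w : List γ | w.reverse ∈ L},
        P x.reverse y.reverse ∧ p = padR x y} =
      {p | p.reverse ∈ {p | ∃ x ∈ L, ∃ y ∈ L, P x y ∧ p = padL x y}}) ∧
      ({p | ∃ x ∈ {w : List γ | w.reverse ∈ L}, ∃ y ∈ {w : List γ | w.reverse ∈ L},
        P x.reverse y.reverse ∧ p = padL x y} =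
      {p | p.reverse ∈ {p | ∃ x ∈ L, ∃ y ∈ L, P x y ∧ p = padR x y}}) := by
    intro P
    constructor
    · ext p
      constructor
      · rintro ⟨x, hx, y, hy, hP, rfl⟩
        exact ⟨_, hx, _, hy, hP, by simp [padR_eq]⟩
      · rintro ⟨x, hx, y, hy, hP, e⟩
        exact ⟨x.reverse, by simpa using hx, y.reverse, by simpa using hy, by simpa using hP,
          by rw [padR_eq]; simp [← e]⟩
    · ext p
      constructor
      · rintro ⟨x, hx, y, hy, hP, rfl⟩
        exact ⟨_, hx, _, hy, hP, by simp [padL_eq]⟩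
      · rintro ⟨x, hx, y, hy, hP, e⟩
        exact ⟨x.reverse, by simpa using hx, y.reverse, by simpa using hy, by simpa using hP,
          by rw [padL_eq]; simp [← e]⟩
  refine ⟨γ, hγ, fun c => (g c).reverse, {w | w.reverse ∈ L}, reg_reverse hs.reg, ?_, ?_,
    ?_, ?_, ?_, ?_, ?_, ?_⟩
  · intro w hw; simpa using hs.ne _ hw
  · intro w
    obtain ⟨x, hx, h⟩ := hs.onto w.reverse
    exact ⟨x.reverse, by simpa using hx, by rw [eg, ew]; simpa using h⟩
  · simp only [eg, ew, List.reverse_reverse]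
    rw [(hset (fun x y => WordEq R (expandW g x) (expandW g y))).1]
    exact reg_reverse hs.eqL_reg
  · simp only [eg, ew, List.reverse_reverse]
    rw [(hset (fun x y => WordEq R (expandW g x) (expandW g y))).2]
    exact reg_reverse hs.eqR_reg
  · intro b
    simp only [eg, ew, List.reverse_reverse, List.reverse_append]
    rw [(hset (fun x y => WordEq R (g b ++ expandW g x) (expandW g y))).1]
    exact reg_reverse (hs.mulLL_reg b)
  · intro b
    simp only [eg, ew, List.reverse_reverse, List.reverse_append]
    rw [(hset (fun x y => WordEq R (expandW g x ++ g b) (expandW g y))).1]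
    exact reg_reverse (hs.mulRL_reg b)
  · intro b
    simp only [eg, ew, List.reverse_reverse, List.reverse_append]
    rw [(hset (fun x y => WordEq R (g b ++ expandW g x) (expandW g y))).2]
    exact reg_reverse (hs.mulLR_reg b)
  · intro b
    simp only [eg, ew, List.reverse_reverse, List.reverse_append]
    rw [(hset (fun x y => WordEq R (expandW g x ++ g b) (expandW g y))).2]
    exact reg_reverse (hs.mulRR_reg b)



/-! ### Rewriting systems -/

def Irr {α : Type} (R : Set (List α × List α)) (w : List α) : Prop :=
  ∀ l r, (l, r) ∈ R → ¬ l <:+: w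

abbrev Red {α : Type} (R : Set (List α × List α)) : List α → List α → Prop :=
  Relation.ReflTransGen (OneStep R)

def Joinable {α : Type} (R : Set (List α × List α)) (a b : List α) : Prop :=
  ∃ c, Red R a c ∧ Red R b c

theorem infix_append_cases {α : Type} {l x y : List α} :
    l <:+: x ++ y ↔ l <:+: x ∨ l <:+: y ∨ ∃ p q, l = p ++ q ∧ p <:+ x ∧ q <+: y := by
  constructor
  · rintro ⟨s, t, h⟩
    rw [List.append_assoc, List.append_eq_append_iff] at h
    rcases h with ⟨a, h1, h2⟩ | ⟨c, h1, h2⟩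
    · rw [List.append_eq_append_iff] at h2
      rcases h2 with ⟨b, h3, h4⟩ | ⟨b, h3, h4⟩
      · left; exact ⟨s, b, by rw [h1, h3]; simp⟩
      · right; right; exact ⟨a, b, h3, ⟨s, h1.symm⟩, ⟨t, h4.symm⟩⟩
    · right; left; exact ⟨c, t, by rw [h2]; simp⟩
  · rintro (⟨s, t, rfl⟩ | ⟨s, t, rfl⟩ | ⟨p, q, rfl, ⟨s, rfl⟩, ⟨t, rfl⟩⟩)
    · exact ⟨s, t ++ y, by simp⟩
    · exact ⟨x ++ s, t, by simp⟩
    · exact ⟨s, t, by simp⟩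

theorem reg_factor {α : Type} (l : List α) : IsReg {w : List α | l <:+: w} := by
  apply reg_of_inv _ (fun z => ((l <:+: z), {p | p <+: l ∧ p <:+ z}))
  · have hf : {p : List α | p <+: l}.Finite := by
      refine (l.inits.finite_toSet).subset ?_
      intro p hp; simpa using hp
    refine ((Set.toFinite (Set.univ : Set Prop)).prod hf.finite_subsets).subset ?_
    rintro _ ⟨z, rfl⟩
    exact ⟨trivial, fun p hp => hp.1⟩
  · intro z z' t hD ht
    simp only [Prod.mk.injEq] at hD
    obtain ⟨d1, d2⟩ := hD
    change l <:+: z ++ t at ht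
    change l <:+: z' ++ t
    rw [infix_append_cases] at ht ⊢
    rcases ht with h | h | ⟨p, q, e, h1, h2⟩
    · left; rwa [← d1]
    · right; left; exact h
    · right; right
      have : p ∈ {p | p <+: l ∧ p <:+ z} := ⟨⟨q, e.symm⟩, h1⟩
      rw [d2] at this
      exact ⟨p, q, e, this.2, h2⟩

theorem reg_irr {α : Type} {R : Set (List α × List α)} (hR : R.Finite) : IsReg {w | Irr R w} := by
  have h : IsReg (⋃ p ∈ R, {w : List α | p.1 <:+: w}) := reg_biUnion hR _ fun p _ => reg_factor p.1
  have h2 : IsReg (⋃ p ∈ R, {w : List α | p.1 <:+: w})ᶜ := Language.IsRegular.compl h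
  convert h2 using 1
  ext w
  simp only [Set.mem_ofPred_eq, Irr, Set.mem_compl_iff, Set.mem_iUnion, not_exists]
  exact ⟨fun h p hp => h p.1 p.2 hp, fun h l r hp => h (l, r) hp⟩

theorem Irr.of_factor {α : Type} {R : Set (List α × List α)} {x y : List α} (h : Irr R y)
    (hx : x <:+: y) : Irr R x := fun l r hl hl' => h l r hl (hl'.trans hx)

theorem Irr.left {α : Type} {R : Set (List α × List α)} {x y : List α} (h : Irr R (x ++ y)) :
    Irr R x := h.of_factor (List.prefix_append x y).isInfix
theorem Irr.right {α : Type} {R : Set (List α × List α)} {x y : List α} (h : Irr R (x ++ y)) :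
    Irr R y := h.of_factor (List.suffix_append x y).isInfix

theorem Irr.rev {α : Type} {R : Set (List α × List α)} {x : List α} (h : Irr R x) :
    Irr (Rrev R) x.reverse := by
  intro l r hl hi
  refine h l.reverse r.reverse hl ?_
  obtain ⟨p, q, hpq⟩ := hi
  exact ⟨q.reverse, p.reverse, by rw [← List.reverse_reverse x, ← hpq]; simp⟩

theorem Irr.of_rev {α : Type} {R : Set (List α × List α)} {x : List α} (h : Irr (Rrev R) x) :
    Irr R x.reverse := by
  have := h.rev; rwa [Rrev_Rrev] at this

theorem not_irr {α : Type} {R : Set (List α × List α)} {x : List α} (h : ¬ Irr R x) :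
    ∃ y, OneStep R x y := by
  simp only [Irr, not_forall, not_not] at h
  obtain ⟨l, r, hl, s, t, e⟩ := h
  exact ⟨s ++ r ++ t, s, l, r, t, hl, e.symm, rfl⟩

theorem Irr.no_step {α : Type} {R : Set (List α × List α)} {x y : List α} (h : Irr R x) :
    ¬ OneStep R x y := by
  rintro ⟨p, u, v, s, hu, rfl, rfl⟩
  exact h u v hu ⟨p, s, by simp⟩

theorem Red.wordEq {α : Type} {R : Set (List α × List α)} {x y : List α} (h : Red R x y) :
    WordEq R x y := by
  induction h with
  | refl => exact WordEq.refl _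
  | tail _ h ih => exact ih.trans (Relation.EqvGen.rel _ _ h)

theorem Red.ctx {α : Type} {R : Set (List α × List α)} {x y : List α} (h : Red R x y)
    (p s : List α) : Red R (p ++ x ++ s) (p ++ y ++ s) := by
  induction h with
  | refl => exact Relation.ReflTransGen.refl
  | tail _ h ih =>
    refine ih.tail ?_
    obtain ⟨p', u, v, s', h, rfl, rfl⟩ := h
    exact ⟨p ++ p', u, v, s' ++ s, h, by simp, by simp⟩

theorem Joinable.ctx {α : Type} {R : Set (List α × List α)} {x y : List α} (h : Joinable R x y)
    (p s : List α) : Joinable R (p ++ x ++ s) (p ++ y ++ s) := by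
  obtain ⟨c, h1, h2⟩ := h
  exact ⟨_, h1.ctx p s, h2.ctx p s⟩

theorem Joinable.symm {α : Type} {R : Set (List α × List α)} {x y : List α} (h : Joinable R x y) :
    Joinable R y x := by
  obtain ⟨c, h1, h2⟩ := h
  exact ⟨_, h2, h1⟩

theorem Joinable.of_eq {α : Type} {R : Set (List α × List α)} {x y : List α} (h : x = y) :
    Joinable R x y := ⟨y, h ▸ Relation.ReflTransGen.refl, Relation.ReflTransGen.refl⟩

theorem red_step {α : Type} {R : Set (List α × List α)} {l r : List α} (p s : List α)
    (h : (l, r) ∈ R) : Red R (p ++ l ++ s) (p ++ r ++ s) :=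
  Relation.ReflTransGen.single ⟨p, l, r, s, h, rfl, rfl⟩

/-- all critical pairs are joinable -/
def CritPairs {α : Type} (R : Set (List α × List α)) : Prop :=
  ∀ l1 r1 l2 r2, (l1, r1) ∈ R → (l2, r2) ∈ R →
    (∀ x z y, l1 = x ++ z → l2 = z ++ y → z ≠ [] → Joinable R (r1 ++ y) (x ++ r2)) ∧
    (∀ x y, l1 = x ++ l2 ++ y → Joinable R r1 (x ++ r2 ++ y))

theorem local_confl_aux {α : Type} {R : Set (List α × List α)} (hC : CritPairs R)
    {l1 r1 l2 r2 s1 s2 d : List α} (h1 : (l1, r1) ∈ R) (h2 : (l2, r2) ∈ R)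
    (e : l1 ++ s1 = d ++ (l2 ++ s2)) : Joinable R (r1 ++ s1) (d ++ r2 ++ s2) := by
  have disj : ∀ f, Joinable R (r1 ++ (f ++ l2 ++ s2)) (l1 ++ f ++ r2 ++ s2) := by
    intro f
    refine ⟨r1 ++ f ++ r2 ++ s2, ?_, ?_⟩
    · have := red_step (r1 ++ f) s2 h2
      simpa using this
    · have := red_step [] (f ++ r2 ++ s2) h1
      simpa using this
  rw [List.append_eq_append_iff] at e
  rcases e with ⟨f, rfl, rfl⟩ | ⟨f, rfl, e⟩
  · simpa using disj f
  · rw [List.append_eq_append_iff] at e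
    rcases e with ⟨g, rfl, rfl⟩ | ⟨g, rfl, rfl⟩
    · have := ((hC _ _ _ _ h1 h2).2 d g (by simp)).ctx [] s1
      simpa using this
    · by_cases hf : f = []
      · subst hf
        simpa using disj []
      · have := ((hC _ _ _ _ h1 h2).1 d f g rfl rfl hf).ctx [] s2
        simpa using this

theorem local_confl {α : Type} {R : Set (List α × List α)} (hC : CritPairs R)
    {w a b : List α} (ha : OneStep R w a) (hb : OneStep R w b) : Joinable R a b := by
  obtain ⟨p1, l1, r1, s1, h1, rfl, rfl⟩ := ha
  obtain ⟨p2, l2, r2, s2, h2, e, rfl⟩ := hb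
  rw [List.append_assoc, List.append_assoc, List.append_eq_append_iff] at e
  rcases e with ⟨d, rfl, e⟩ | ⟨d, rfl, e⟩
  · have := (local_confl_aux hC h1 h2 e).ctx p1 []
    simpa using this
  · have := ((local_confl_aux hC h2 h1 e).ctx p2 []).symm
    simpa using this

def Terminates {α : Type} (R : Set (List α × List α)) : Prop :=
  ∃ μ : List α → ℕ, ∀ l r, (l, r) ∈ R → ∀ p s, μ (p ++ r ++ s) < μ (p ++ l ++ s)

theorem exists_nf {α : Type} {R : Set (List α × List α)} (hT : Terminates R) (w : List α) :
    ∃ y, Irr R y ∧ Red R w y := by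
  obtain ⟨μ, hμ⟩ := hT
  induction h : μ w using Nat.strong_induction_on generalizing w with
  | _ n ih =>
    by_cases hi : Irr R w
    · exact ⟨w, hi, Relation.ReflTransGen.refl⟩
    · obtain ⟨y, hy⟩ := not_irr hi
      have hlt : μ y < μ w := by
        obtain ⟨p, l, r, s, hl, rfl, rfl⟩ := hy
        exact hμ l r hl p s
      obtain ⟨z, hz, hr⟩ := ih _ (h ▸ hlt) y rfl
      exact ⟨z, hz, Relation.ReflTransGen.head hy hr⟩

theorem nf_unique_red {α : Type} {R : Set (List α × List α)} (hT : Terminates R)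
    (hC : CritPairs R) (w : List α) : ∀ x y, Irr R x → Irr R y → Red R w x → Red R w y → x = y := by
  have hT' := hT
  obtain ⟨μ, hμ⟩ := hT
  have hdec : ∀ w y, OneStep R w y → μ y < μ w := by
    rintro w y ⟨p, l, r, s, hl, rfl, rfl⟩
    exact hμ l r hl p s
  induction h : μ w using Nat.strong_induction_on generalizing w with
  | _ n ih =>
    intro x y hx hy rx ry
    rcases Relation.ReflTransGen.cases_head rx with rfl | ⟨a, ha, rx⟩
    · rcases Relation.ReflTransGen.cases_head ry with rfl | ⟨b, hb, ry⟩
      · rfl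
      · exact (hx.no_step hb).elim
    · rcases Relation.ReflTransGen.cases_head ry with rfl | ⟨b, hb, ry⟩
      · exact (hy.no_step ha).elim
      · obtain ⟨c, rac, rbc⟩ := local_confl hC ha hb
        obtain ⟨z, hz, rz⟩ := exists_nf hT' c
        have e1 := ih _ (h ▸ hdec _ _ ha) a rfl x z hx hz rx (rac.trans rz)
        have e2 := ih _ (h ▸ hdec _ _ hb) b rfl y z hy hz ry (rbc.trans rz)
        rw [e1, e2]

theorem nf_unique {α : Type} {R : Set (List α × List α)} (hT : Terminates R)
    (hC : CritPairs R) {x y : List α} (hx : Irr R x) (hy : Irr R y) (h : WordEq R x y) : x = y := by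
  choose f hf hr using exists_nf hT (R := R)
  have key : f x = f y := by
    clear hx hy
    induction h with
    | rel x y h =>
      exact nf_unique_red hT hC x _ _ (hf x) (hf y) (hr x) (Relation.ReflTransGen.head h (hr y))
    | refl => rfl
    | symm _ _ _ ih => exact ih.symm
    | trans _ _ _ _ _ ih ih' => exact ih.trans ih'
  have e1 := nf_unique_red hT hC x _ _ hx (hf x) Relation.ReflTransGen.refl (hr x)
  have e2 := nf_unique_red hT hC y _ _ hy (hf y) Relation.ReflTransGen.refl (hr y)
  rw [e1, e2, key]

/-- right multiplication is realised by the bounded difference machine -/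
def GoodR {α : Type} (R : Set (List α × List α)) (N : ℕ) : Prop :=
  ∀ p l r b, (l ++ [b], r) ∈ R → Irr R (p ++ l) →
    ∃ y, Irr R y ∧ RM R gs N (p ++ l) [b] y

theorem RM_one {α : Type} {R : Set (List α × List α)} {N : ℕ} (p a d c : List α) (hN : 1 ≤ N)
    (ha : a.length ≤ N) (hd : d.length ≤ N) (hc : c.length ≤ N) (h : WordEq R (a ++ c) d) :
    RM R gs N (p ++ a) c (p ++ d) := by
  have : |(d.length : ℤ) - a.length| ≤ N := by rw [abs_le]; omega
  refine ⟨(d.length : ℤ) - a.length, this, TPath.snoc (RM.copy R hN p) ?_⟩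
  exact ⟨by simp, ⟨hc, this⟩, ⟨ha, hd⟩, by simp, by simpa using h⟩

theorem GoodR.all {α : Type} {R : Set (List α × List α)} {N : ℕ} (hN : 1 ≤ N)
    (hne : ∀ r, ([], r) ∉ R)
    (h : GoodR R N) (w : List α) (b : α) (hw : Irr R w) : ∃ y, Irr R y ∧ RM R gs N w [b] y := by
  by_cases hi : Irr R (w ++ [b])
  · refine ⟨_, hi, ?_⟩
    simpa using RM_one (R := R) w [] [b] [b] hN (by simp) (by simpa using hN) (by simpa using hN)
      (WordEq.refl _)
  · simp only [Irr, not_forall, not_not] at hi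
    obtain ⟨l, r, hl, s, t, e⟩ := hi
    rcases List.eq_nil_or_concat' t with rfl | ⟨t, b', rfl⟩
    · rcases List.eq_nil_or_concat' l with rfl | ⟨l, b', rfl⟩
      · exact (hne r hl).elim
      · rw [List.append_nil, ← List.append_assoc] at e
        obtain ⟨rfl, e2⟩ := List.append_inj' e rfl
        simp only [List.cons.injEq, and_true] at e2
        subst e2
        exact h s l r b' hl hw
    · rw [← List.append_assoc] at e
      obtain ⟨rfl, e2⟩ := List.append_inj' e rfl
      exact (hw l r hl ⟨s, t, by simp⟩).elim

theorem biauto_of_rewriting {α : Type} [Fintype α] (R : Set (List α × List α)) (hfin : R.Finite)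
    (hT : Terminates R) (hC : CritPairs R) (N : ℕ) (hN : 1 ≤ N)
    (h1 : GoodR R N) (h2 : GoodR (Rrev R) N) : MonBiautomatic R := by
  have hne : ∀ r, ([], r) ∉ R := by
    intro r hr
    obtain ⟨y, hy, -⟩ := exists_nf hT []
    exact hy _ _ hr ⟨[], _, rfl⟩
  refine biauto_of_RM R {w | Irr R w} (reg_irr hfin) ?_ ?_ N hN ?_ ?_
  · intro w
    obtain ⟨y, hy, hr⟩ := exists_nf hT w
    exact ⟨y, hy, hr.wordEq.symm⟩
  · intro x hx y hy h
    exact nf_unique hT hC hx hy h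
  · intro w hw b
    exact h1.all hN hne w b hw
  · intro w hw b
    obtain ⟨y, hy, h⟩ := h2.all hN (fun r hr => hne r.reverse (by simpa [Rrev] using hr))
      w.reverse b (Irr.rev hw)
    exact ⟨y.reverse, hy.of_rev, by simpa using h⟩


set_option linter.unusedSimpArgs false
set_option linter.flexible false

/-! ### Generic tools for the concrete systems -/

theorem RM_ext {α : Type} {R : Set (List α × List α)} {N : ℕ} {w c y : List α}
    (h : RM R gs N w c y) (hc : c.length ≤ N) (a b c' : List α) (ha : a.length ≤ N)
    (hb : b.length ≤ N) (hc' : c'.length ≤ N) (he : WordEq R (a ++ c') (c ++ b))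
    (hlag : |((y ++ b).length : ℤ) - (w ++ a).length| ≤ N) : RM R gs N (w ++ a) c' (y ++ b) := by
  obtain ⟨n, hn, hp⟩ := h
  have hl := hp.lag_eq (fun q => q.2) (fun q a b q' h => h.2.2.2.1)
  simp only [zero_add] at hl
  have hlag' : |n + b.length - a.length| ≤ N := by
    have : n + b.length - a.length = ((y ++ b).length : ℤ) - (w ++ a).length := by
      simp only [List.length_append]; push_cast; omega
    rw [this]; exact hlag
  refine ⟨n + b.length - a.length, hlag', TPath.snoc hp ?_⟩
  exact ⟨⟨hc, hn⟩, ⟨hc', hlag'⟩, ⟨ha, hb⟩, rfl, by simpa using he⟩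

theorem irr_snoc {α : Type} {R : Set (List α × List α)} {z : List α} {p : α} :
    Irr R (z ++ [p]) ↔ Irr R z ∧ ∀ l r, (l, r) ∈ R → ¬ l <:+ z ++ [p] := by
  simp only [Irr, List.infix_concat_iff]
  constructor
  · intro h
    exact ⟨fun l r hl hi => h l r hl (Or.inr hi), fun l r hl hi => h l r hl (Or.inl hi)⟩
  · rintro ⟨h1, h2⟩ l r hl (hi | hi)
    · exact h2 l r hl hi
    · exact h1 l r hl hi

theorem suf_rev {α : Type} {a b : List α} : a <:+ b ↔ a.reverse <+: b.reverse :=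
  ⟨fun ⟨q, hq⟩ => ⟨q.reverse, by simp [← hq]⟩,
    fun ⟨q, hq⟩ => ⟨q.reverse, by have := congrArg List.reverse hq; simpa using this⟩⟩

theorem spl1 {α : Type} {a : α} {x z : List α} : [a] = x ++ z ↔
    (x = [] ∧ z = [a]) ∨ (x = [a] ∧ z = []) := by
  rcases x with _ | ⟨x1, x⟩ <;> simp
  · tauto
  · grind
theorem spl2 {α : Type} {a b : α} {x z : List α} : [a, b] = x ++ z ↔
    (x = [] ∧ z = [a, b]) ∨ (x = [a] ∧ z = [b]) ∨ (x = [a, b] ∧ z = []) := by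
  rcases x with _ | ⟨x1, x⟩
  · simp; exact eq_comm
  · simp only [List.cons_append, List.cons.injEq, spl1]; simp; grind
theorem spl3 {α : Type} {a b c : α} {x z : List α} : [a, b, c] = x ++ z ↔
    (x = [] ∧ z = [a, b, c]) ∨ (x = [a] ∧ z = [b, c]) ∨ (x = [a, b] ∧ z = [c]) ∨
    (x = [a, b, c] ∧ z = []) := by
  rcases x with _ | ⟨x1, x⟩
  · simp; exact eq_comm
  · simp only [List.cons_append, List.cons.injEq, spl2]; simp; grind
theorem spl4 {α : Type} {a b c d : α} {x z : List α} : [a, b, c, d] = x ++ z ↔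
    (x = [] ∧ z = [a, b, c, d]) ∨ (x = [a] ∧ z = [b, c, d]) ∨ (x = [a, b] ∧ z = [c, d]) ∨
    (x = [a, b, c] ∧ z = [d]) ∨ (x = [a, b, c, d] ∧ z = []) := by
  rcases x with _ | ⟨x1, x⟩
  · simp; exact eq_comm
  · simp only [List.cons_append, List.cons.injEq, spl3]; simp; grind
theorem spl5 {α : Type} {a b c d e : α} {x z : List α} : [a, b, c, d, e] = x ++ z ↔
    (x = [] ∧ z = [a, b, c, d, e]) ∨ (x = [a] ∧ z = [b, c, d, e]) ∨ (x = [a, b] ∧ z = [c, d, e]) ∨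
    (x = [a, b, c] ∧ z = [d, e]) ∨ (x = [a, b, c, d] ∧ z = [e]) ∨ (x = [a, b, c, d, e] ∧ z = []) := by
  rcases x with _ | ⟨x1, x⟩
  · simp; exact eq_comm
  · simp only [List.cons_append, List.cons.injEq, spl4]; simp; grind

theorem Rrev_single {α : Type} (u v : List α) : Rrev {(u, v)} = {(u.reverse, v.reverse)} := by
  ext ⟨a, b⟩
  simp only [Rrev, Set.mem_ofPred_eq, Set.mem_singleton_iff, Prod.mk.injEq]
  constructor
  · rintro ⟨rfl, rfl⟩; simp
  · rintro ⟨rfl, rfl⟩; simp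

theorem crit_single {α : Type} (u v : List α)
    (h : ∀ x z y, u = x ++ z → u = z ++ y → z ≠ [] → Joinable {(u, v)} (v ++ y) (x ++ v)) :
    CritPairs {(u, v)} := by
  intro l1 r1 l2 r2 h1 h2
  simp only [Set.mem_singleton_iff, Prod.mk.injEq] at h1 h2
  obtain ⟨rfl, rfl⟩ := h1
  obtain ⟨rfl, rfl⟩ := h2
  refine ⟨h, fun x y e => ?_⟩
  have := congrArg List.length e
  simp only [List.length_append] at this
  have hx : x = [] := by apply List.eq_nil_of_length_eq_zero; omega
  have hy : y = [] := by apply List.eq_nil_of_length_eq_zero; omega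
  subst hx hy
  exact Joinable.of_eq (by simp)

theorem swap_rel {α : Type} (u v : List α) (h : MonBiautomatic {(v, u)}) :
    MonBiautomatic {(u, v)} := by
  refine biauto_congr {(u, v)} {(v, u)} ?_ ?_ h
  · rintro l r h
    simp only [Set.mem_singleton_iff, Prod.mk.injEq] at h
    obtain ⟨rfl, rfl⟩ := h
    exact (WordEq.rule (Set.mem_singleton _)).symm
  · rintro l r h
    simp only [Set.mem_singleton_iff, Prod.mk.injEq] at h
    obtain ⟨rfl, rfl⟩ := h
    exact (WordEq.rule (Set.mem_singleton _)).symm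

/-- trivial relation -/
theorem bi_refl {α : Type} [Fintype α] (u : List α) : MonBiautomatic {(u, u)} := by
  refine biauto_congr {(u, u)} ∅ ?_ ?_ ?_
  · rintro l r h; simp at h
  · rintro l r h
    simp only [Set.mem_singleton_iff, Prod.mk.injEq] at h
    obtain ⟨rfl, rfl⟩ := h
    exact WordEq.refl _
  · refine biauto_of_rewriting ∅ Set.finite_empty ⟨fun _ => 0, by simp⟩ ?_ 1 le_rfl ?_ ?_
    · intro l1 r1 l2 r2 h; simp at h
    · intro p l r b h; simp at h
    · intro p l r b h; simp [Rrev] at h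

/-! ### Rules with short right-hand sides whose result is irreducible at once -/

theorem goodR_single {α : Type} (u v : List α) (N : ℕ) (hN : 1 ≤ N) (hu : u.length ≤ N)
    (hv : v.length ≤ N)
    (h : ∀ p l b, u = l ++ [b] → Irr {(u, v)} (p ++ l) → Irr {(u, v)} (p ++ v)) :
    GoodR {(u, v)} N := by
  intro p l r b hm hi
  simp only [Set.mem_singleton_iff, Prod.mk.injEq] at hm
  obtain ⟨e, rfl⟩ := hm
  have hl := congrArg List.length e
  simp only [List.length_append, List.length_singleton] at hl
  exact ⟨p ++ r, h p l b e.symm hi,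
    RM_one p l r [b] hN (by omega) hv (by simpa using hN) (WordEq.rule (by simp [e]))⟩

theorem bi_del {α : Type} [Fintype α] (u : List α) (hu0 : u ≠ [])
    (h : ∀ x z y, u = x ++ z → u = z ++ y → z ≠ [] → x = y) : MonBiautomatic {(u, [])} := by
  have hl : 1 ≤ u.length := List.length_pos_iff.2 hu0
  refine biauto_of_rewriting _ (Set.finite_singleton _) ⟨List.length, ?_⟩ ?_ u.length hl ?_ ?_
  · intro l r h p s
    simp only [Set.mem_singleton_iff, Prod.mk.injEq] at h
    obtain ⟨rfl, rfl⟩ := h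
    simp; omega
  · refine crit_single _ _ fun x z y h1 h2 h3 => Joinable.of_eq ?_
    simp [h x z y h1 h2 h3]
  · exact goodR_single _ _ _ hl le_rfl (by simp) fun p l b _ hi => by simpa using hi.left
  · rw [Rrev_single]
    exact goodR_single _ _ _ hl (by simp) (by simp) fun p l b _ hi => by simpa using hi.left

theorem bi_del2 {α : Type} [Fintype α] (a b : α) : MonBiautomatic {([a, b], ([] : List α))} := by
  refine bi_del _ (by simp) ?_
  intro x z y h1 h2 h3
  simp only [spl1, spl2, spl3] at h1 h2
  aesop

theorem bi_del3 {α : Type} [Fintype α] (a b c : α) (h : ¬ (a = c ∧ a ≠ b)) :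
    MonBiautomatic {([a, b, c], ([] : List α))} := by
  refine bi_del _ (by simp) ?_
  intro x z y h1 h2 h3
  simp only [spl1, spl2, spl3] at h1 h2
  grind

theorem bi_idem {α : Type} [Fintype α] (a : α) : MonBiautomatic {([a, a], [a])} := by
  have hrev : Rrev {([a, a], [a])} = {([a, a], [a])} := by rw [Rrev_single]; simp
  have hg : GoodR {([a, a], [a])} 2 := by
    refine goodR_single _ _ _ (by simp) (by simp) (by simp) fun p l b e hi => ?_
    have : l = [a] := by
      simp only [spl1, spl2, spl3] at e; aesop
    subst this; exact hi
  refine biauto_of_rewriting _ (Set.finite_singleton _) ⟨List.length, ?_⟩ ?_ 2 (by simp) hg ?_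
  · intro l r h p s
    simp only [Set.mem_singleton_iff, Prod.mk.injEq] at h
    obtain ⟨rfl, rfl⟩ := h
    simp
  · refine crit_single _ _ fun x z y h1 h2 h3 => Joinable.of_eq ?_
    simp only [spl1, spl2, spl3] at h1 h2
    aesop
  · rw [hrev]; exact hg

/-- elimination of a letter -/
theorem bi_elim {α : Type} [Fintype α] (c : α) (v : List α) (hv : c ∉ v) :
    MonBiautomatic {([c], v)} := by
  classical
  have hg : ∀ v : List α, c ∉ v → GoodR {([c], v)} (v.length + 1) := by
    intro v hv
    refine goodR_single _ _ _ (by simp) (by simp) (by simp) fun p l b e hi => ?_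
    have hc : ∀ w : List α, Irr {([c], v)} w ↔ c ∉ w := by
      intro w
      simp [Irr, List.singleton_infix_iff]
    rw [hc] at hi ⊢
    simp only [List.mem_append, not_or] at hi ⊢
    exact ⟨hi.1, hv⟩
  refine biauto_of_rewriting _ (Set.finite_singleton _) ⟨List.count c, ?_⟩ ?_ (v.length + 1) (by simp) (hg v hv) ?_
  · intro l r h p s
    simp only [Set.mem_singleton_iff, Prod.mk.injEq] at h
    obtain ⟨rfl, rfl⟩ := h
    simp [List.count_eq_zero_of_not_mem hv]
  · refine crit_single _ _ fun x z y h1 h2 h3 => Joinable.of_eq ?_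
    simp only [spl1, spl2, spl3] at h1 h2
    aesop
  · rw [Rrev_single]; simpa using hg v.reverse (by simpa using hv)

/-! ### Termination of length preserving rules -/

def bval {α : Type} [DecidableEq α] (c : α) : List α → ℕ
  | [] => 0
  | x :: w => (if x = c then 2 ^ w.length else 0) + bval c w

theorem bval_lt {α : Type} [DecidableEq α] (c : α) (w : List α) : bval c w < 2 ^ w.length := by
  induction w with
  | nil => simp [bval]
  | cons x w ih =>
    simp only [bval, List.length_cons, pow_succ]
    split <;> omega

theorem bval_append {α : Type} [DecidableEq α] (c : α) (x y : List α) :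
    bval c (x ++ y) = bval c x * 2 ^ y.length + bval c y := by
  induction x with
  | nil => simp [bval]
  | cons a x ih =>
    simp only [List.cons_append, bval, ih, List.length_append, pow_add]
    split <;> ring

theorem bval_exists {α : Type} [DecidableEq α] (l r : List α) (hl : l.length = r.length)
    (hne : l ≠ r) : ∃ c, bval c r < bval c l := by
  induction l generalizing r with
  | nil => cases r with
    | nil => exact (hne rfl).elim
    | cons => simp at hl
  | cons x l ih =>
    cases r with
    | nil => simp at hl
    | cons y r =>
      simp only [List.length_cons, Nat.add_right_cancel_iff] at hl
      by_cases hxy : x = y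
      · subst hxy
        obtain ⟨c, hc⟩ := ih r hl (by simpa using hne)
        refine ⟨c, ?_⟩
        simp only [bval, hl]; omega
      · refine ⟨x, ?_⟩
        have := bval_lt x r
        simp only [bval, if_true, if_neg (Ne.symm hxy), hl]
        omega

theorem term_homog {α : Type} (u v : List α) (hl : u.length = v.length) (hne : u ≠ v) :
    Terminates {(u, v)} := by
  classical
  obtain ⟨c, hc⟩ := bval_exists u v hl hne
  refine ⟨bval c, ?_⟩
  intro l r h p s
  simp only [Set.mem_singleton_iff, Prod.mk.injEq] at h
  obtain ⟨rfl, rfl⟩ := h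
  simp only [bval_append, hl]
  have : 0 < 2 ^ s.length := by positivity
  nlinarith

/-! ### S4 : aba = aca -/
theorem bi_aba_aca {α : Type} [Fintype α] (a b c : α) (hab : a ≠ b) (hbc : b ≠ c) :
    MonBiautomatic {([a, b, a], [a, c, a])} := by
  have hrev : Rrev {([a, b, a], [a, c, a])} = {([a, b, a], [a, c, a])} := by
    rw [Rrev_single]; simp
  have hg : GoodR {([a, b, a], [a, c, a])} 3 := by
    refine goodR_single _ _ _ (by simp) (by simp) (by simp) fun p l b' e hi => ?_
    have : l = [a, b] := by
      simp only [spl1, spl2, spl3] at e; aesop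
    subst this
    have h1 : Irr {([a, b, a], [a, c, a])} (p ++ [a]) := hi.of_factor ⟨[], [b], by simp⟩
    rw [show p ++ [a, c, a] = (p ++ [a]) ++ [c] ++ [a] by simp, irr_snoc, irr_snoc]
    refine ⟨⟨h1, ?_⟩, ?_⟩
    · intro l r h
      simp only [Set.mem_singleton_iff, Prod.mk.injEq] at h
      obtain ⟨rfl, rfl⟩ := h
      simp [suf_rev]; grind
    · intro l r h
      simp only [Set.mem_singleton_iff, Prod.mk.injEq] at h
      obtain ⟨rfl, rfl⟩ := h
      simp [suf_rev]; grind
  refine biauto_of_rewriting _ (Set.finite_singleton _) (term_homog _ _ rfl (by simpa using hbc)) ?_ 3 (by simp) hg ?_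
  · refine crit_single _ _ fun x z y h1 h2 h3 => ?_
    simp only [spl1, spl2, spl3] at h1 h2
    have : (x = [] ∧ y = []) ∨ (x = [a, b] ∧ y = [b, a]) := by grind
    rcases this with ⟨rfl, rfl⟩ | ⟨rfl, rfl⟩
    · exact Joinable.of_eq (by simp)
    · refine ⟨[a, c, a, c, a], ?_, ?_⟩
      · have := red_step (R := {([a, b, a], [a, c, a])}) [a, c] [] (Set.mem_singleton _)
        simpa using this
      · have := red_step (R := {([a, b, a], [a, c, a])}) [] [c, a] (Set.mem_singleton _)
        simpa using this
  · rw [hrev]; exact hg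


set_option linter.unusedSimpArgs false
set_option linter.flexible false

/-! ### Length preserving rules with unbordered left-hand side -/

theorem sweep {α : Type} (u v : List α) (hl : u.length = v.length) (hne : u ≠ v) (N : ℕ)
    (hN : 1 ≤ N) (hu : u.length ≤ N) (I : List α → Prop)
    (hI1 : ∀ y, I y → Irr {(u, v)} y) (hI0 : ∀ w, Irr {(u, v)} (w ++ v) → I (w ++ v))
    (hI2 : ∀ y p s t, u = p ++ s → v = s ++ t → p ≠ [] → s ≠ [] → I y → I (y ++ t)) :
    GoodR {(u, v)} N := by
  have key : ∀ n : ℕ, ∀ w : List α, w.length = n → Irr {(u, v)} w →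
      ∃ y, I y ∧ RM {(u, v)} gs N w v y ∧ y.length = w.length + v.length := by
    intro n
    induction n using Nat.strong_induction_on with
    | _ n ih =>
      intro w hw hi
      by_cases hwv : Irr {(u, v)} (w ++ v)
      · refine ⟨w ++ v, hI0 w hwv, ?_, by simp⟩
        simpa using RM_one (R := {(u, v)}) w [] v v hN (by simp) (hl ▸ hu) (hl ▸ hu) (WordEq.refl _)
      · have : u <:+: w ++ v := by
          simp only [Irr, not_forall, not_not] at hwv
          obtain ⟨l, r, h, h'⟩ := hwv
          simp only [Set.mem_singleton_iff, Prod.mk.injEq] at h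
          obtain ⟨rfl, rfl⟩ := h
          exact h'
        rw [infix_append_cases] at this
        rcases this with h | h | ⟨p, s, e, ⟨w1, rfl⟩, ⟨t, et⟩⟩
        · exact (hi u v rfl h).elim
        · exact (hne (h.eq_of_length hl)).elim
        · have hs : s ≠ [] := by
            rintro rfl
            rw [List.append_nil] at e
            subst e
            exact hi _ v rfl ⟨w1, [], by simp⟩
          have hp : p ≠ [] := by
            rintro rfl
            rw [List.nil_append] at e
            subst e
            have := congrArg List.length et
            simp only [List.length_append] at this
            have : t = [] := by apply List.eq_nil_of_length_eq_zero; omega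
            subst this
            exact hne (by simpa using et)
          have hlp := List.length_pos_iff.2 hp
          obtain ⟨y, h1, h2, h3⟩ := ih w1.length (by simp at hw; omega) w1 rfl hi.left
          have l1 := congrArg List.length e
          have l2 := congrArg List.length et
          simp only [List.length_append] at l1 l2
          refine ⟨y ++ t, hI2 y p s t e et.symm hp hs h1, ?_, ?_⟩
          · refine RM_ext h2 (by omega) p t v (by omega) (by omega) (by omega) ?_ ?_
            · have : WordEq {(u, v)} (u ++ t) (v ++ t) := (WordEq.rule (Set.mem_singleton _)).app (WordEq.refl t)
              rw [← et, ← List.append_assoc, ← e, et]; exact this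
            · simp only [List.length_append]; rw [abs_le]; push_cast; omega
          · simp only [List.length_append]; omega
  intro p l r b hm hi
  simp only [Set.mem_singleton_iff, Prod.mk.injEq] at hm
  obtain ⟨e, rfl⟩ := hm
  obtain ⟨y, h1, h2, h3⟩ := key _ p rfl hi.left
  have l1 := congrArg List.length e
  simp only [List.length_append, List.length_singleton] at l1
  refine ⟨y, hI1 y h1, ?_⟩
  have := RM_ext h2 (by omega) l [] [b] (by omega) (by simp) (by simpa using hN)
    (by rw [e, List.append_nil]; exact WordEq.rule rfl)
    (by simp only [List.length_append, List.length_nil]; rw [abs_le]; push_cast; omega)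
  simpa using this

theorem good2 {α : Type} (a b c d : α) (hab : a ≠ b) (hne : [a, b] ≠ [c, d]) :
    GoodR {([a, b], [c, d])} 2 := by
  refine sweep [a, b] [c, d] rfl hne 2 (by simp) (by simp)
    (fun y => Irr {([a, b], [c, d])} y ∧ ∃ z, y = z ++ [d]) (fun y h => h.1) ?_ ?_
  · intro w h; exact ⟨h, w ++ [c], by simp⟩
  · rintro y p s t e1 e2 hp hs ⟨hi, z, rfl⟩
    have : t = [d] := by simp only [spl2] at e1 e2; grind
    subst this
    refine ⟨?_, _, rfl⟩
    rw [irr_snoc]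
    refine ⟨hi, ?_⟩
    rintro l r h
    simp only [Set.mem_singleton_iff, Prod.mk.injEq] at h
    obtain ⟨rfl, rfl⟩ := h
    simp [suf_rev]; grind

theorem bi_unb2 {α : Type} [Fintype α] (a b c d : α) (hab : a ≠ b) (hne : [a, b] ≠ [c, d]) :
    MonBiautomatic {([a, b], [c, d])} := by
  refine biauto_of_rewriting _ (Set.finite_singleton _) (term_homog _ _ rfl hne) ?_ 2 (by simp)
    (good2 a b c d hab hne) ?_
  · refine crit_single _ _ fun x z y h1 h2 h3 => Joinable.of_eq ?_
    simp only [spl2] at h1 h2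
    have : x = [] ∧ y = [] := by grind
    simp [this]
  · rw [Rrev_single]
    refine good2 b a d c (Ne.symm hab) ?_
    simp only [ne_eq, List.cons.injEq, and_true] at hne ⊢; tauto

theorem good3 {α : Type} (a b c d e f : α) (hac : a ≠ c) (hne : [a, b, c] ≠ [d, e, f]) :
    GoodR {([a, b, c], [d, e, f])} 3 := by
  have hsn : ∀ z p, Irr {([a, b, c], [d, e, f])} (z ++ [p]) ↔ Irr {([a, b, c], [d, e, f])} z ∧
      ¬ [a, b, c] <:+ z ++ [p] := by
    intro z p; rw [irr_snoc]; simp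
  by_cases h1 : c = d
  · by_cases h2 : b = d ∧ c = e
    · obtain ⟨rfl, rfl⟩ := h2
      subst h1
      refine sweep [a, c, c] [c, c, f] rfl hne 3 (by simp) (by simp)
        (fun y => Irr {([a, c, c], [c, c, f])} y ∧
          ((∃ z, y = z ++ [c, f]) ∨ (∃ z, y = z ++ [f, f]))) (fun y h => h.1) ?_ ?_
      · intro w h; exact ⟨h, Or.inl ⟨w ++ [c], by simp⟩⟩
      · rintro y p s t e1 e2 hp hs ⟨hi, hz⟩
        have : t = [f] ∨ t = [c, f] := by simp only [spl3] at e1 e2; grind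
        rcases this with rfl | rfl
        · refine ⟨?_, Or.inr ?_⟩
          · rw [hsn]
            refine ⟨hi, ?_⟩
            rcases hz with ⟨z, rfl⟩ | ⟨z, rfl⟩ <;> (simp [suf_rev]; try grind)
          · rcases hz with ⟨z, rfl⟩ | ⟨z, rfl⟩
            · exact ⟨z ++ [c], by simp⟩
            · exact ⟨z ++ [f], by simp⟩
        · refine ⟨?_, Or.inl ⟨y, rfl⟩⟩
          rw [show y ++ [c, f] = y ++ [c] ++ [f] by simp, hsn, hsn]
          refine ⟨⟨hi, ?_⟩, ?_⟩ <;>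
          rcases hz with ⟨z, rfl⟩ | ⟨z, rfl⟩ <;> (simp [suf_rev]; try grind)
    · subst h1
      refine sweep [a, b, c] [c, e, f] rfl hne 3 (by simp) (by simp)
        (fun y => Irr {([a, b, c], [c, e, f])} y ∧ (∃ z, y = z ++ [e, f])) (fun y h => h.1) ?_ ?_
      · intro w h; exact ⟨h, ⟨w ++ [c], by simp⟩⟩
      · rintro y p s t e1 e2 hp hs ⟨hi, ⟨z, rfl⟩⟩
        have : t = [e, f] := by simp only [spl3] at e1 e2; grind
        subst this
        refine ⟨?_, ⟨_, rfl⟩⟩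
        rw [show z ++ [e, f] ++ [e, f] = z ++ [e, f] ++ [e] ++ [f] by simp, hsn, hsn]
        refine ⟨⟨hi, ?_⟩, ?_⟩ <;> (simp [suf_rev]; try grind)
  · refine sweep [a, b, c] [d, e, f] rfl hne 3 (by simp) (by simp)
      (fun y => Irr {([a, b, c], [d, e, f])} y ∧
          ((∃ z, y = z ++ [e, f]) ∨ (∃ z, y = z ++ [f, f]))) (fun y h => h.1) ?_ ?_
    · intro w h; exact ⟨h, Or.inl ⟨w ++ [d], by simp⟩⟩
    · rintro y p s t e1 e2 hp hs ⟨hi, hz⟩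
      have : t = [f] ∧ c = e := by simp only [spl3] at e1 e2; grind
      obtain ⟨rfl, rfl⟩ := this
      refine ⟨?_, Or.inr ?_⟩
      · rw [hsn]
        refine ⟨hi, ?_⟩
        rcases hz with ⟨z, rfl⟩ | ⟨z, rfl⟩ <;> (simp [suf_rev]; try grind)
      · rcases hz with ⟨z, rfl⟩ | ⟨z, rfl⟩
        · exact ⟨z ++ [c], by simp⟩
        · exact ⟨z ++ [f], by simp⟩

theorem bi_unb3 {α : Type} [Fintype α] (a b c d e f : α) (hac : a ≠ c)
    (hne : [a, b, c] ≠ [d, e, f]) : MonBiautomatic {([a, b, c], [d, e, f])} := by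
  refine biauto_of_rewriting _ (Set.finite_singleton _) (term_homog _ _ rfl hne) ?_ 3 (by simp)
    (good3 a b c d e f hac hne) ?_
  · refine crit_single _ _ fun x z y h1 h2 h3 => Joinable.of_eq ?_
    simp only [spl3] at h1 h2
    have : x = [] ∧ y = [] := by grind
    simp [this]
  · rw [Rrev_single]
    refine good3 c b a f e d (Ne.symm hac) ?_
    simp only [ne_eq, List.cons.injEq, and_true] at hne ⊢; tauto

/-! ### aba = 1 -/

theorem bi_aba {α : Type} [Fintype α] (a b : α) (hab : a ≠ b) :
    MonBiautomatic {([a, b, a], ([] : List α))} := by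
  classical
  let R' : Set (List (Option α) × List (Option α)) :=
    {([some a, none], []), ([none, some a], []), ([some b], [none, none])}
  have hbi : MonBiautomatic R' := by
    have hrev : Rrev R' = R' := by
      ext ⟨l, r⟩
      simp only [R', Rrev, Set.mem_ofPred_eq, Set.mem_insert_iff, Set.mem_singleton_iff,
        Prod.mk.injEq, List.reverse_eq_iff]
      simp; tauto
    have hg : GoodR R' 2 := by
      intro p l r b' hm hi
      simp only [R', Set.mem_insert_iff, Set.mem_singleton_iff, Prod.mk.injEq] at hm
      rcases hm with ⟨e, rfl⟩ | ⟨e, rfl⟩ | ⟨e, rfl⟩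
      · refine ⟨p, hi.left, ?_⟩
        have he : l.length + 1 = 2 := by simpa using congrArg List.length e
        simpa using RM_one (R := R') (N := 2) p l [] [b'] (by simp) (by omega) (by simp) (by simp)
          (by rw [e]; exact WordEq.rule (by simp [R']))
      · refine ⟨p, hi.left, ?_⟩
        have he : l.length + 1 = 2 := by simpa using congrArg List.length e
        simpa using RM_one (R := R') (N := 2) p l [] [b'] (by simp) (by omega) (by simp) (by simp)
          (by rw [e]; exact WordEq.rule (by simp [R']))
      · have hh := e.symm
        rw [spl1] at hh
        obtain ⟨rfl, h'⟩ : l = [] ∧ b' = some b := by grind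
        subst h'
        rw [List.append_nil] at hi
        have hmem : ∀ x ∈ R', x = ([some a, none], []) ∨ x = ([none, some a], []) ∨ x = ([some b], [none, none]) := by
          intro x hx; simpa [R'] using hx
        rcases List.eq_nil_or_concat' p with rfl | ⟨q, c, rfl⟩
        · refine ⟨[none, none], ?_, ?_⟩
          · intro l r hl
            rcases hmem _ hl with h | h | h <;> simp only [Prod.mk.injEq] at h <;>
              obtain ⟨rfl, rfl⟩ := h
            · intro h; have := h.subset (show some a ∈ _ by simp); simp at this
            · intro h; have := h.subset (show some a ∈ _ by simp); simp at this
            · intro h; have := h.subset (show some b ∈ _ by simp); simp at this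
          · simpa using RM_one (R := R') (N := 2) [] [] [none, none] [some b] (by simp) (by simp) (by simp) (by simp)
              (WordEq.rule (by simp [R']))
        · by_cases hc : c = some a
          · subst hc
            -- q a b -> q t
            have hR : RM R' gs 2 (q ++ [some a]) [some b] (q ++ [none]) := by
              refine RM_one (R := R') (N := 2) q [some a] [none] [some b] (by simp) (by simp) (by simp) (by simp) ?_
              have e1 : WordEq R' ([some a] ++ [some b]) ([some a] ++ [none, none]) :=
                (WordEq.refl _).app (WordEq.rule (by simp [R']))
              have e2 : WordEq R' ([some a, none] ++ [none]) ([] ++ [none]) :=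
                (WordEq.rule (by simp [R'])).app (WordEq.refl _)
              exact e1.trans (by simpa using e2)
            rcases List.eq_nil_or_concat' q with rfl | ⟨q', c', rfl⟩
            · refine ⟨_, ?_, hR⟩
              intro l r hl
              rcases hmem _ hl with h | h | h <;> simp only [Prod.mk.injEq] at h <;>
                obtain ⟨rfl, rfl⟩ := h
              · intro h; have := h.length_le; simp at this
              · intro h; have := h.length_le; simp at this
              · intro h; have := h.subset (show some b ∈ _ by simp); simp at this
            · by_cases hc' : c' = some a
              · subst hc'
                refine ⟨q', hi.left.left, ?_⟩
                have := RM_one (R := R') (N := 2) q' [some a, some a] [] [some b] (by simp) (by simp) (by simp) (by simp) ?_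
                · simpa using this
                · have e1 : WordEq R' ([some a, some a] ++ [some b]) ([some a, some a] ++ [none, none]) :=
                    (WordEq.refl _).app (WordEq.rule (by simp [R']))
                  have e2 : WordEq R' ([some a, none]) ([]) := (WordEq.rule (by simp [R']))
                  have e3 := e2.ctx [some a] [none]
                  exact e1.trans ((by simpa using e3 : WordEq R' ([some a, some a] ++ [none, none]) [some a, none]).trans e2)
              · refine ⟨_, ?_, by simpa using hR⟩
                rw [show q' ++ [c', none] = q' ++ [c'] ++ [none] by simp, irr_snoc]
                refine ⟨hi.left, ?_⟩
                intro l r hl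
                rcases hmem _ hl with h | h | h <;> simp only [Prod.mk.injEq] at h <;>
                  obtain ⟨rfl, rfl⟩ := h <;> simp [suf_rev, Ne.symm hc']
          · refine ⟨q ++ [c] ++ [none, none], ?_, ?_⟩
            · rw [show q ++ [c] ++ [none, none] = q ++ [c] ++ [none] ++ [none] by simp, irr_snoc, irr_snoc]
              refine ⟨⟨hi, ?_⟩, ?_⟩ <;>
              · intro l r hl
                rcases hmem _ hl with h | h | h <;> simp only [Prod.mk.injEq] at h <;>
                  obtain ⟨rfl, rfl⟩ := h <;> simp [suf_rev, Ne.symm hc]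
            · simpa using RM_one (R := R') (N := 2) (q ++ [c]) [] [none, none] [some b] (by simp) (by simp) (by simp) (by simp)
                (WordEq.rule (by simp [R']))
    refine biauto_of_rewriting R' (by simp [R']) ⟨fun w => w.length + 2 * w.count (some b), ?_⟩ ?_ 2 (by simp) hg (by rw [hrev]; exact hg)
    · intro l r hl p s
      simp only [R', Set.mem_insert_iff, Set.mem_singleton_iff, Prod.mk.injEq] at hl
      rcases hl with ⟨rfl, rfl⟩ | ⟨rfl, rfl⟩ | ⟨rfl, rfl⟩
      · simp [List.count_cons]; omega
      · simp [List.count_cons]; omega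
      · simp [List.count_cons]; omega
    · intro l1 r1 l2 r2 h1 h2
      simp only [R', Set.mem_insert_iff, Set.mem_singleton_iff, Prod.mk.injEq] at h1 h2
      have hab' : some a ≠ some b := by simpa using hab
      rcases h1 with ⟨rfl, rfl⟩ | ⟨rfl, rfl⟩ | ⟨rfl, rfl⟩ <;>
      rcases h2 with ⟨rfl, rfl⟩ | ⟨rfl, rfl⟩ | ⟨rfl, rfl⟩ <;>
      refine ⟨fun x z y e1 e2 e3 => Joinable.of_eq ?_, fun x y e => Joinable.of_eq ?_⟩ <;>
      (simp only [spl1, spl2, List.append_assoc, List.cons_append, List.nil_append, List.cons.injEq,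
        reduceCtorEq, List.append_nil] at *
       try grind)
  refine biauto_transfer {([a, b, a], ([] : List α))} R' (fun o => o.elim [a, b] fun c => [c])
    (fun c => [some c]) ?_ ?_ ?_ ?_ hbi
  · intro l r hl
    have r1 : WordEq {([a, b, a], ([] : List α))} [a, b, a] [] := WordEq.rule rfl
    have r2 : WordEq {([a, b, a], ([] : List α))} [a, b] [b, a] := by
      have e1 := r1.ctx [] [b, a]
      have e2 := r1.ctx [a, b] []
      simp only [List.nil_append, List.append_nil, List.cons_append] at e1 e2
      exact e2.symm.trans e1
    simp only [R', Set.mem_insert_iff, Set.mem_singleton_iff, Prod.mk.injEq] at hl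
    rcases hl with ⟨rfl, rfl⟩ | ⟨rfl, rfl⟩ | ⟨rfl, rfl⟩
    · simpa using (r2.ctx [a] []).trans (by simpa using r1)
    · simpa using r1
    · have := r1.ctx [] [b]
      simpa using this.symm
  · intro l r hl
    simp only [Set.mem_singleton_iff, Prod.mk.injEq] at hl
    obtain ⟨rfl, rfl⟩ := hl
    have e1 : WordEq R' [some b] [none, none] := WordEq.rule (by simp [R'])
    have e2 : WordEq R' [some a, none] [] := WordEq.rule (by simp [R'])
    have e3 : WordEq R' [none, some a] [] := WordEq.rule (by simp [R'])
    have e4 := (e1.ctx [some a] [some a]).trans (by simpa using e2.ctx [] [none, some a])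
    simpa using e4.trans (by simpa using e3)
  · intro o
    cases o with
    | some c => simpa using WordEq.refl _
    | none =>
      have e1 : WordEq R' [some b] [none, none] := WordEq.rule (by simp [R'])
      have e2 : WordEq R' [some a, none] [] := WordEq.rule (by simp [R'])
      simpa using (e1.ctx [some a] []).trans (by simpa using e2.ctx [] [none])
  · intro c
    simpa using WordEq.refl _


set_option linter.unusedSimpArgs false
set_option linter.flexible false

/-! ### Systems with a central power of a letter -/

theorem red1 {α : Type} {R : Set (List α × List α)} {a b : List α} (p l r s : List α)
    (h : (l, r) ∈ R) (e1 : a = p ++ l ++ s) (e2 : b = p ++ r ++ s) : Red R a b := by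
  subst e1 e2; exact red_step p s h

theorem Joinable.of_red {α : Type} {R : Set (List α × List α)} {a b : List α} (h : Red R b a) :
    Joinable R a b := ⟨a, Relation.ReflTransGen.refl, h⟩

theorem term_bval {α : Type} [DecidableEq α] (R : Set (List α × List α)) (c : α)
    (h : ∀ l r, (l, r) ∈ R → l.length = r.length ∧ bval c r < bval c l) : Terminates R := by
  refine ⟨bval c, ?_⟩
  intro l r hl p s
  obtain ⟨h1, h2⟩ := h l r hl
  simp only [bval_append, h1]
  have : 0 < 2 ^ s.length := by positivity
  nlinarith

/-- a letter outside all left-hand sides separates -/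
theorem irr_sep {α : Type} {R : Set (List α × List α)} {w0 t : List α} (h0 : Irr R w0)
    (ht : Irr R t) (hd : w0 = [] ∨ ∃ w d, w0 = w ++ [d] ∧ ∀ l r, (l, r) ∈ R → d ∉ l) :
    Irr R (w0 ++ t) := by
  rcases hd with rfl | ⟨w, d, rfl, hd⟩
  · simpa using ht
  · intro l r hl hi
    rw [infix_append_cases] at hi
    rcases hi with h | h | ⟨p, q, rfl, h1, h2⟩
    · exact h0 l r hl h
    · exact ht l r hl h
    · rcases List.eq_nil_or_concat' p with rfl | ⟨p, d', rfl⟩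
      · exact ht _ r hl (by simpa using h2.isInfix)
      · have : d' = d := by
          obtain ⟨q, hq⟩ := h1
          rw [← List.append_assoc] at hq
          have := (List.append_inj' hq rfl).2
          simpa using this
        subst this
        exact hd _ r hl (by simp)

theorem irr_app_rep {α : Type} {R : Set (List α × List α)} {y : List α} (x : α) (j : ℕ)
    (hy : Irr R y) (h : ∀ l r, (l, r) ∈ R → ¬ [x] <:+ l) (hne : ∀ r, ([], r) ∉ R) :
    Irr R (y ++ List.replicate j x) := by
  induction j with
  | zero => simpa using hy
  | succ j ih =>
    rw [List.replicate_succ', ← List.append_assoc, irr_snoc]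
    refine ⟨ih, ?_⟩
    intro l r hl hs
    rcases List.eq_nil_or_concat' l with rfl | ⟨l', d, rfl⟩
    · exact hne r hl
    · have : d = x := by
        obtain ⟨q, hq⟩ := hs
        rw [← List.append_assoc] at hq
        have := (List.append_inj' hq rfl).2
        simpa using this
      subst this
      exact h _ r hl (by simp)

theorem split_block {α : Type} (P : α → Prop) (w : List α) : ∃ w0 s, w = w0 ++ s ∧ (∀ a ∈ s, P a) ∧
    (w0 = [] ∨ ∃ w d, w0 = w ++ [d] ∧ ¬ P d) := by
  induction w using List.reverseRecOn with
  | nil => exact ⟨[], [], by simp⟩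
  | append_singleton w a ih =>
    by_cases ha : P a
    · obtain ⟨w0, s, rfl, h1, h2⟩ := ih
      refine ⟨w0, s ++ [a], by simp, ?_, h2⟩
      intro b hb
      simp only [List.mem_append, List.mem_singleton] at hb
      rcases hb with hb | rfl
      · exact h1 b hb
      · exact ha
    · exact ⟨w ++ [a], [], by simp, by simp, Or.inr ⟨w, a, rfl, ha⟩⟩

theorem prefix_rep {α : Type} {q : List α} {x : α} {n : ℕ} (h : q <+: List.replicate n x) :
    ∃ i ≤ n, q = List.replicate i x := by
  obtain ⟨t, ht⟩ := h
  have := congrArg List.length ht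
  simp only [List.length_append, List.length_replicate] at this
  refine ⟨q.length, by omega, ?_⟩
  rw [List.eq_replicate_iff]
  refine ⟨rfl, fun b hb => ?_⟩
  have hb' : b ∈ List.replicate n x := by rw [← ht]; simp [hb]
  exact List.eq_of_mem_replicate hb'

section central
variable {α : Type} (x z : α) (l' : List α) (n k : ℕ)

def RC : Set (List α × List α) :=
  {(l' ++ [z], List.replicate n x), (z :: List.replicate k x, List.replicate k x ++ [z])}

theorem central_letter (a : α) (ha : a = x ∨ a = z) :
    WordEq (RC x z l' n k) ([a] ++ List.replicate k x) (List.replicate k x ++ [a]) := by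
  rcases ha with rfl | rfl
  · exact WordEq.of_eq (by
      rw [List.singleton_append, ← List.replicate_succ, ← List.replicate_succ'])
  · exact WordEq.rule (by simp [RC])

theorem central_RM (w0 s : List α) (hs : ∀ a ∈ s, a = x ∨ a = z) (N : ℕ) (hN : 1 ≤ N) (hk : k ≤ N) :
    RM (RC x z l' n k) gs N (w0 ++ s) (List.replicate k x) (w0 ++ List.replicate k x ++ s) := by
  induction s using List.reverseRecOn with
  | nil =>
    simpa using RM_one (R := RC x z l' n k) w0 [] (List.replicate k x) (List.replicate k x) hN
      (by simp) (by simpa using hk) (by simpa using hk) (WordEq.refl _)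
  | append_singleton s a ih =>
    have := RM_ext (ih fun b hb => hs b (by simp [hb])) (by simpa using hk) [a] [a]
      (List.replicate k x) (by simpa using hN) (by simpa using hN) (by simpa using hk)
      (central_letter x z l' n k a (hs a (by simp)))
      (by simp only [List.length_append, List.length_replicate, List.length_singleton]
          rw [abs_le]; push_cast; omega)
    simpa using this

theorem central_irr (l'' : List α) (hl : l' ++ [z] = z :: l'') (hlz : ∀ a ∈ l', a = x ∨ a = z)
    (hxz : x ≠ z) (w0 s : List α)
    (hd : w0 = [] ∨ ∃ w d, w0 = w ++ [d] ∧ ¬ (d = x ∨ d = z)) (hi : Irr (RC x z l' n k) (w0 ++ s)) :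
    Irr (RC x z l' n k) (w0 ++ List.replicate k x ++ s) := by
  rw [List.append_assoc]
  apply irr_sep hi.left
  · intro l r hlr h
    rw [infix_append_cases] at h
    have hz : ∃ t, l = z :: t := by
      simp only [RC, Set.mem_insert_iff, Set.mem_singleton_iff, Prod.mk.injEq] at hlr
      rcases hlr with ⟨rfl, -⟩ | ⟨rfl, -⟩
      · exact ⟨_, hl⟩
      · exact ⟨_, rfl⟩
    obtain ⟨t, rfl⟩ := hz
    rcases h with h | h | ⟨p, q, e, h1, h2⟩
    · have := h.subset (List.mem_cons_self)
      exact hxz (List.eq_of_mem_replicate this).symm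
    · exact hi.right _ r hlr h
    · rcases p with _ | ⟨p1, p⟩
      · rw [List.nil_append] at e
        rw [e] at hlr
        exact hi.right _ r hlr h2.isInfix
      · simp only [List.cons_append, List.cons.injEq] at e
        obtain ⟨rfl, -⟩ := e
        have := h1.subset (List.mem_cons_self)
        exact hxz (List.eq_of_mem_replicate this).symm
  · rcases hd with hd | ⟨w, d, e, hd⟩
    · exact Or.inl hd
    · refine Or.inr ⟨w, d, e, ?_⟩
      intro l r hlr hm
      simp only [RC, Set.mem_insert_iff, Set.mem_singleton_iff, Prod.mk.injEq] at hlr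
      rcases hlr with ⟨rfl, -⟩ | ⟨rfl, -⟩
      · simp only [List.mem_append, List.mem_singleton] at hm
        rcases hm with hm | hm
        · exact hd (hlz d hm)
        · exact hd (Or.inr hm)
      · simp only [List.mem_cons, List.mem_replicate] at hm
        tauto

theorem central_good1 (l'' : List α) (hl : l' ++ [z] = z :: l'') (hlz : ∀ a ∈ l', a = x ∨ a = z)
    (hxz : x ≠ z) (hnk : n ≤ k) (hk : 1 ≤ k) (N : ℕ) (hN : N = n + k + l'.length + 1) :
    GoodR (RC x z l' n k) N := by
  intro p l r b hm hi
  have hm' := hm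
  simp only [RC, Set.mem_insert_iff, Set.mem_singleton_iff, Prod.mk.injEq] at hm
  rcases hm with ⟨e, rfl⟩ | ⟨e, rfl⟩
  · obtain ⟨rfl, e2⟩ := List.append_inj' e rfl
    simp only [List.cons.injEq, and_true] at e2
    subst e2
    by_cases hp : Irr (RC x b l n k) (p ++ List.replicate n x)
    · exact ⟨_, hp, RM_one p l (List.replicate n x) [b] (by omega) (by omega) (by simp; omega)
        (by simp; omega) (WordEq.rule hm')⟩
    · simp only [Irr, not_forall, not_not] at hp
      obtain ⟨l1, r1, h1, h2⟩ := hp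
      rw [infix_append_cases] at h2
      rcases h2 with h2 | h2 | ⟨p', q', rfl, ⟨q, hq⟩, h4⟩
      · exact (hi.left _ r1 h1 h2).elim
      · exfalso
        have : b ∈ l1 := by
          simp only [RC, Set.mem_insert_iff, Set.mem_singleton_iff, Prod.mk.injEq] at h1
          rcases h1 with ⟨rfl, -⟩ | ⟨rfl, -⟩ <;> simp
        exact hxz (List.eq_of_mem_replicate (h2.subset this)).symm
      · obtain ⟨i, hin, rfl⟩ := prefix_rep h4
        have h1' := h1
        simp only [RC, Set.mem_insert_iff, Set.mem_singleton_iff, Prod.mk.injEq] at h1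
        rcases h1 with ⟨e, rfl⟩ | ⟨e, -⟩
        · exfalso
          rcases i with _ | i
          · simp only [List.replicate_zero, List.append_nil] at h1'
            refine hi.left _ _ h1' ⟨q, [], by simp [hq]⟩
          · rw [List.replicate_succ', ← List.append_assoc] at e
            have := List.append_inj' e rfl
            exact hxz (by simpa using this.2)
        · -- p' = b :: x^(k-i)
          have hlen := congrArg List.length e
          simp only [List.length_append, List.length_cons, List.length_replicate] at hlen
          have hp' : p' = b :: List.replicate (k - i) x := by
            have : b :: List.replicate k x = (b :: List.replicate (k - i) x) ++ List.replicate i x := by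
              simp; omega
            rw [this] at e
            exact List.append_inj_left' e rfl
          subst hp'
          obtain ⟨w0, s, hws, hs, hd⟩ := split_block (fun a => a = x ∨ a = b) (q ++ [b])
          have hpe : p = w0 ++ (s ++ List.replicate (n - i) x) ++ List.replicate (k - n) x := by
            rw [← hq, show q ++ b :: List.replicate (k - i) x = (q ++ [b]) ++ List.replicate (k - i) x by simp,
              hws, show k - i = (n - i) + (k - n) by omega, List.replicate_add]
            simp
          have hI : Irr (RC x b l n k) (w0 ++ (s ++ List.replicate (n - i) x)) := by
            have := hi.left; rw [hpe] at this; exact this.left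
          refine ⟨_, central_irr x b l n k l'' hl hlz hxz _ _ hd hI, ?_⟩
          have hR := central_RM x b l n k w0 s hs N (by omega) (by omega)
          have := RM_ext hR (by simp; omega) (List.replicate (k - i) x ++ l) (List.replicate (n - i) x) [b]
            (by simp; omega) (by simp; omega) (by simp; omega) ?_ ?_
          · rw [← hws] at this
            rw [← hq]
            simpa using this
          · have e1 : WordEq (RC x b l n k) (List.replicate (k - i) x ++ (l ++ [b])) (List.replicate (k - i) x ++ List.replicate n x) :=
              (WordEq.refl _).app (WordEq.rule hm')
            have e2 : List.replicate (k - i) x ++ List.replicate n x = List.replicate k x ++ List.replicate (n - i) x := by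
              rw [← List.replicate_add, ← List.replicate_add]; congr 1; omega
            rw [← e2]; simpa using e1
          · simp only [List.length_append, List.length_replicate]
            rw [abs_le]; push_cast; omega
  · have e1 : l = z :: List.replicate (k - 1) x ∧ b = x := by
      obtain ⟨k, rfl⟩ : ∃ k', k = k' + 1 := ⟨k - 1, by omega⟩
      rw [List.replicate_succ', ← List.cons_append] at e
      have := List.append_inj' e rfl
      simpa using this
    obtain ⟨rfl, rfl⟩ := e1
    obtain ⟨w0, s, hws, hs, hd⟩ := split_block (fun a => a = b ∨ a = z) (p ++ [z])
    have hI : Irr (RC b z l' n k) (w0 ++ s) := by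
      rw [← hws]
      rw [show p ++ z :: List.replicate (k - 1) b = p ++ [z] ++ List.replicate (k - 1) b by simp] at hi
      exact hi.left
    refine ⟨_, central_irr b z l' n k l'' hl hlz hxz _ _ hd hI, ?_⟩
    have hR := central_RM b z l' n k w0 s hs N (by omega) (by omega)
    have := RM_ext hR (by simp; omega) (List.replicate (k - 1) b) [] [b]
            (by simp; omega) (by simp) (by simp; omega) ?_ ?_
    · rw [← hws] at this
      simpa using this
    · refine WordEq.of_eq ?_
      rw [← List.replicate_succ']
      simp; omega
    · simp only [List.length_append, List.length_replicate, List.length_nil]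
      rw [abs_le]; push_cast; omega

theorem central_good2 (hpal : (l' ++ [z]).reverse = l' ++ [z]) 
    (hxz : x ≠ z) (hk : 1 ≤ k) (N : ℕ) (hN : N = n + k + l'.length + 1) :
    GoodR (Rrev (RC x z l' n k)) N := by
  have hR : Rrev (RC x z l' n k) =
      {(l' ++ [z], List.replicate n x), (List.replicate k x ++ [z], z :: List.replicate k x)} := by
    ext ⟨l, r⟩
    simp only [RC, Rrev, Set.mem_ofPred_eq, Set.mem_insert_iff, Set.mem_singleton_iff,
        Prod.mk.injEq, List.reverse_eq_iff, hpal]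
    simp
  rw [hR]
  set R := ({(l' ++ [z], List.replicate n x), (List.replicate k x ++ [z], z :: List.replicate k x)} : Set (List α × List α)) with hRdef
  have hx : ∀ l r, (l, r) ∈ R → ¬ [x] <:+ l := by
    intro l r h
    simp only [hRdef, Set.mem_insert_iff, Set.mem_singleton_iff, Prod.mk.injEq] at h
    rcases h with ⟨rfl, -⟩ | ⟨rfl, -⟩ <;> simp [suf_rev, hxz]
  have hne : ∀ r, ([], r) ∉ R := by
    intro r h
    simp [hRdef] at h
  have good1 : ∀ p, Irr R (p ++ l') → ∃ y, Irr R y ∧ RM R gs N (p ++ l') [z] y ∧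
      |(y.length : ℤ) - (p ++ l').length| ≤ N := by
    intro p hi
    refine ⟨_, irr_app_rep x n hi.left hx hne, RM_one p l' (List.replicate n x) [z] (by omega) (by omega) (by simp; omega)
        (by simp; omega) (WordEq.rule (by simp [hRdef])), ?_⟩
    simp only [List.length_append, List.length_replicate]
    rw [abs_le]; push_cast; omega
  intro p l r b hm hi
  simp only [hRdef, Set.mem_insert_iff, Set.mem_singleton_iff, Prod.mk.injEq] at hm
  rcases hm with ⟨e, rfl⟩ | ⟨e, rfl⟩
  · obtain ⟨rfl, e2⟩ := List.append_inj' e rfl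
    simp only [List.cons.injEq, and_true] at e2
    subst e2
    obtain ⟨y, h1, h2, -⟩ := good1 p hi
    exact ⟨y, h1, h2⟩
  · obtain ⟨rfl, e2⟩ := List.append_inj' e rfl
    simp only [List.cons.injEq, and_true] at e2
    subst e2
    obtain ⟨w0, s, hws, hs, hd⟩ := split_block (fun a => a = x) (p ++ List.replicate k x)
    obtain ⟨m, rfl⟩ : ∃ m, s = List.replicate m x := ⟨s.length, by
      rw [List.eq_replicate_iff]; exact ⟨rfl, hs⟩⟩
    rw [hws] at hi ⊢
    have hm : m = m % k + k * (m / k) := (Nat.mod_add_div m k).symm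
    have hmk : m % k < k := Nat.mod_lt _ (by omega)
    generalize m % k = r at hm hmk
    generalize m / k = j at hm
    subst hm
    rw [List.replicate_add, ← List.append_assoc] at hi ⊢
    have h0 : ∃ y, Irr R y ∧ RM R gs N (w0 ++ List.replicate r x) [b] y ∧
        |(y.length : ℤ) - (w0 ++ List.replicate r x).length| ≤ N := by
      by_cases hI : Irr R (w0 ++ List.replicate r x ++ [b])
      · refine ⟨_, hI, ?_, ?_⟩
        · simpa using RM_one (R := R) (w0 ++ List.replicate r x) [] [b] [b] (by omega) (by simp)
            (by simp; omega) (by simp; omega) (WordEq.refl _)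
        · simp only [List.length_append, List.length_replicate, List.length_singleton]
          rw [abs_le]; push_cast; omega
      · rw [irr_snoc] at hI
        simp only [hi.left, true_and, not_forall, not_not] at hI
        obtain ⟨l1, r1, h1, q, h2⟩ := hI
        simp only [hRdef, Set.mem_insert_iff, Set.mem_singleton_iff, Prod.mk.injEq] at h1
        rcases h1 with ⟨rfl, rfl⟩ | ⟨rfl, rfl⟩
        · rw [← List.append_assoc] at h2
          have h3 := List.append_inj_left' h2 rfl
          rw [← h3]
          apply good1
          rw [h3]; exact hi.left
        · exfalso
          rw [← List.append_assoc] at h2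
          have h3 := List.append_inj_left' h2 rfl
          rw [show k = (k - r - 1 + 1) + r by omega, List.replicate_add, ← List.append_assoc] at h3
          have h4 := List.append_inj_left' h3 rfl
          rw [List.replicate_succ', ← List.append_assoc] at h4
          rcases hd with rfl | ⟨w, d, rfl, hd⟩
          · simp at h4
          · have h5 := List.append_inj' h4 rfl
            exact hd (by simpa using h5.2.symm)
    obtain ⟨y, hy, hRM, hlag⟩ := h0
    have hfin : ∀ j, RM R gs N (w0 ++ List.replicate r x ++ List.replicate (k * j) x) [b] (y ++ List.replicate (k * j) x) := by
      intro j
      induction j with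
      | zero => simpa using hRM
      | succ j ih =>
        have := RM_ext ih (by simp; omega) (List.replicate k x) (List.replicate k x) [b] (by simp; omega) (by simp; omega) (by simp; omega)
          (WordEq.rule (by simp [hRdef])) ?_
        · rw [mul_add, mul_one, List.replicate_add]
          simpa [add_assoc] using this
        · simp only [List.length_append, List.length_replicate] at hlag ⊢
          rw [abs_le] at hlag ⊢; push_cast at hlag ⊢; omega
    exact ⟨_, irr_app_rep x _ hy hx hne, hfin j⟩

end central

theorem bi_central {α : Type} [Fintype α] (x z : α) (l' : List α) (n k : ℕ) (l'' : List α) (hl : l' ++ [z] = z :: l'')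
    (hlz : ∀ a ∈ l', a = x ∨ a = z) (hpal : (l' ++ [z]).reverse = l' ++ [z])
    (hxz : x ≠ z) (hnk : n ≤ k) (hk : 1 ≤ k) (hlen : l'.length + 1 = n)
    (hC : CritPairs (RC x z l' n k)) : MonBiautomatic (RC x z l' n k) := by
  classical
  refine biauto_of_rewriting _ (by simp [RC]) (term_bval _ z ?_) hC _ (by omega)
    (central_good1 x z l' n k l'' hl hlz hxz hnk hk _ rfl) (central_good2 x z l' n k hpal hxz hk _ rfl)
  have hrep : ∀ j, bval z (List.replicate j x) = 0 := by
    intro j; induction j with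
    | zero => rfl
    | succ j ih => simp [List.replicate_succ, bval, ih, hxz]
  intro l r h
  simp only [RC, Set.mem_insert_iff, Set.mem_singleton_iff, Prod.mk.injEq] at h
  rcases h with ⟨rfl, rfl⟩ | ⟨rfl, rfl⟩
  · refine ⟨by simp [hlen], ?_⟩
    rw [hrep, bval_append]; simp [bval]
  · refine ⟨by simp, ?_⟩
    rw [bval_append, hrep]
    simp only [bval, hrep]
    have : 1 < 2 ^ k := Nat.one_lt_two_pow (by omega)
    simp; omega

/-- the second rule is a consequence of the first -/
theorem bi_central_congr {α : Type} (x z : α) (l' : List α) (n k : ℕ)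
    (h : WordEq {(l' ++ [z], List.replicate n x)} (z :: List.replicate k x) (List.replicate k x ++ [z]))
    (hb : MonBiautomatic (RC x z l' n k)) : MonBiautomatic {(l' ++ [z], List.replicate n x)} := by
  refine biauto_congr _ _ ?_ ?_ hb
  · intro l r hl
    simp only [RC, Set.mem_insert_iff, Set.mem_singleton_iff, Prod.mk.injEq] at hl
    rcases hl with ⟨rfl, rfl⟩ | ⟨rfl, rfl⟩
    · exact WordEq.rule rfl
    · exact h
  · intro l r hl
    simp only [Set.mem_singleton_iff, Prod.mk.injEq] at hl
    obtain ⟨rfl, rfl⟩ := hl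
    exact WordEq.rule (by simp [RC])


set_option linter.unusedSimpArgs false
set_option linter.flexible false

theorem crit_of_take {α : Type} (R : Set (List α × List α))
    (H : ∀ l1 r1, (l1, r1) ∈ R → ∀ l2 r2, (l2, r2) ∈ R →
      (∀ k, k < l1.length → k < l2.length → l1.drop (l1.length - (k + 1)) = l2.take (k + 1) →
        Joinable R (r1 ++ l2.drop (k + 1)) (l1.take (l1.length - (k + 1)) ++ r2)) ∧
      (∀ k, k + l2.length < l1.length + 1 → (l1.drop k).take l2.length = l2 →
        Joinable R r1 (l1.take k ++ r2 ++ l1.drop (k + l2.length)))) : CritPairs R := by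
  intro l1 r1 l2 r2 h1 h2
  obtain ⟨H1, H2⟩ := H l1 r1 h1 l2 r2 h2
  constructor
  · intro x z y e1 e2 hz
    obtain ⟨c, z, rfl⟩ := List.exists_cons_of_ne_nil hz
    have := H1 z.length (by simp [e1]; omega) (by simp [e2]) (by simp [e1, e2])
    simpa [e1, e2] using this
  · intro x y e
    have := H2 x.length (by simp [e]) (by simp [e])
    simpa [e] using this

theorem bi_xx_zz {α : Type} [Fintype α] (x z : α) (hxz : x ≠ z) :
    MonBiautomatic {([z, z], [x, x])} := by
  have key := bi_central_congr x z [z] 2 2 ?_ ?_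
  · simpa [List.replicate] using key
  · have h : WordEq {([z] ++ [z], List.replicate 2 x)} [z, z] [x, x] :=
      WordEq.rule (by simp [List.replicate])
    simpa [List.replicate] using (h.symm.ctx [z] []).trans (h.ctx [] [z])
  · refine bi_central x z [z] 2 2 [z] rfl (by simp) (by simp) hxz (by simp) (by simp) (by simp) ?_
    have r1 : ∀ p s, Red (RC x z [z] 2 2) (p ++ [z, z] ++ s) (p ++ [x, x] ++ s) := fun p s =>
      red_step p s (by simp [RC, List.replicate])
    have r2 : ∀ p s, Red (RC x z [z] 2 2) (p ++ [z, x, x] ++ s) (p ++ [x, x, z] ++ s) := fun p s =>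
      red_step p s (by simp [RC, List.replicate])
    have hzx := hxz.symm
    generalize hR : RC x z [z] 2 2 = R at *
    have hm : ∀ l r, (l, r) ∈ R ↔ ((l = [z, z] ∧ r = [x, x]) ∨ (l = [z, x, x] ∧ r = [x, x, z])) := by
      intro l r; simp [← hR, RC, List.replicate]
    have hd : ∀ a, Joinable R a a := fun a => Joinable.of_eq rfl
    have j0 : Joinable R [x, x, z] [z, x, x] := Joinable.of_red (
      (by simpa using r2 [] [] : Red R [z, x, x] [x, x, z]))
    have j1 : Joinable R [x, x, x, x] [z, x, x, z] := Joinable.of_red (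
      (by simpa using r2 [] [z] : Red R [z, x, x, z] [x, x, z, z]).trans ((by simpa using r1 [x, x] [] : Red R [x, x, z, z] [x, x, x, x])))
    apply crit_of_take
    intro l1 r1 h1 l2 r2 h2
    rw [hm] at h1 h2
    rcases h1 with ⟨rfl, rfl⟩ | ⟨rfl, rfl⟩ <;> rcases h2 with ⟨rfl, rfl⟩ | ⟨rfl, rfl⟩ <;>
    refine ⟨fun k hk => ?_, fun k hk => ?_⟩ <;> (have hk' : k < 8 := by simp at hk; try omega) <;>
    interval_cases k <;> simp [hxz, hzx, hd, j0, j1] at hk ⊢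

theorem bi_xxx_zzz {α : Type} [Fintype α] (x z : α) (hxz : x ≠ z) :
    MonBiautomatic {([z, z, z], [x, x, x])} := by
  have key := bi_central_congr x z [z, z] 3 3 ?_ ?_
  · simpa [List.replicate] using key
  · have h : WordEq {([z, z] ++ [z], List.replicate 3 x)} [z, z, z] [x, x, x] :=
      WordEq.rule (by simp [List.replicate])
    simpa [List.replicate] using (h.symm.ctx [z] []).trans (h.ctx [] [z])
  · refine bi_central x z [z, z] 3 3 [z, z] rfl (by simp) (by simp) hxz (by simp) (by simp) (by simp) ?_
    have r1 : ∀ p s, Red (RC x z [z, z] 3 3) (p ++ [z, z, z] ++ s) (p ++ [x, x, x] ++ s) := fun p s =>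
      red_step p s (by simp [RC, List.replicate])
    have r2 : ∀ p s, Red (RC x z [z, z] 3 3) (p ++ [z, x, x, x] ++ s) (p ++ [x, x, x, z] ++ s) := fun p s =>
      red_step p s (by simp [RC, List.replicate])
    have hzx := hxz.symm
    generalize hR : RC x z [z, z] 3 3 = R at *
    have hm : ∀ l r, (l, r) ∈ R ↔ ((l = [z, z, z] ∧ r = [x, x, x]) ∨ (l = [z, x, x, x] ∧ r = [x, x, x, z])) := by
      intro l r; simp [← hR, RC, List.replicate]
    have hd : ∀ a, Joinable R a a := fun a => Joinable.of_eq rfl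
    have j0 : Joinable R [x, x, x, z] [z, x, x, x] := Joinable.of_red (
      (by simpa using r2 [] [] : Red R [z, x, x, x] [x, x, x, z]))
    have j1 : Joinable R [x, x, x, z, z] [z, z, x, x, x] := Joinable.of_red (
      (by simpa using r2 [z] [] : Red R [z, z, x, x, x] [z, x, x, x, z]).trans ((by simpa using r2 [] [z] : Red R [z, x, x, x, z] [x, x, x, z, z])))
    have j2 : Joinable R [x, x, x, x, x, x] [z, z, x, x, x, z] := Joinable.of_red (
      (by simpa using r2 [z] [z] : Red R [z, z, x, x, x, z] [z, x, x, x, z, z]).trans ((by simpa using r2 [] [z, z] : Red R [z, x, x, x, z, z] [x, x, x, z, z, z]).trans ((by simpa using r1 [x, x, x] [] : Red R [x, x, x, z, z, z] [x, x, x, x, x, x]))))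
    apply crit_of_take
    intro l1 r1 h1 l2 r2 h2
    rw [hm] at h1 h2
    rcases h1 with ⟨rfl, rfl⟩ | ⟨rfl, rfl⟩ <;> rcases h2 with ⟨rfl, rfl⟩ | ⟨rfl, rfl⟩ <;>
    refine ⟨fun k hk => ?_, fun k hk => ?_⟩ <;> (have hk' : k < 8 := by simp at hk; try omega) <;>
    interval_cases k <;> simp [hxz, hzx, hd, j0, j1, j2] at hk ⊢

theorem bi_zxz_xxx {α : Type} [Fintype α] (x z : α) (hxz : x ≠ z) :
    MonBiautomatic {([z, x, z], [x, x, x])} := by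
  have key := bi_central_congr x z [z, x] 3 4 ?_ ?_
  · simpa [List.replicate] using key
  · have h : WordEq {([z, x] ++ [z], List.replicate 3 x)} [z, x, z] [x, x, x] :=
      WordEq.rule (by simp [List.replicate])
    simpa [List.replicate] using (h.symm.ctx [z, x] []).trans (h.ctx [] [x, z])
  · refine bi_central x z [z, x] 3 4 [x, z] rfl (by simp) (by simp) hxz (by simp) (by simp) (by simp) ?_
    have r1 : ∀ p s, Red (RC x z [z, x] 3 4) (p ++ [z, x, z] ++ s) (p ++ [x, x, x] ++ s) := fun p s =>
      red_step p s (by simp [RC, List.replicate])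
    have r2 : ∀ p s, Red (RC x z [z, x] 3 4) (p ++ [z, x, x, x, x] ++ s) (p ++ [x, x, x, x, z] ++ s) := fun p s =>
      red_step p s (by simp [RC, List.replicate])
    have hzx := hxz.symm
    generalize hR : RC x z [z, x] 3 4 = R at *
    have hm : ∀ l r, (l, r) ∈ R ↔ ((l = [z, x, z] ∧ r = [x, x, x]) ∨ (l = [z, x, x, x, x] ∧ r = [x, x, x, x, z])) := by
      intro l r; simp [← hR, RC, List.replicate]
    have hd : ∀ a, Joinable R a a := fun a => Joinable.of_eq rfl
    have j0 : Joinable R [x, x, x, x, z] [z, x, x, x, x] := Joinable.of_red (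
      (by simpa using r2 [] [] : Red R [z, x, x, x, x] [x, x, x, x, z]))
    have j1 : Joinable R [x, x, x, x, x, x, x] [z, x, x, x, x, x, z] := Joinable.of_red (
      (by simpa using r2 [] [x, z] : Red R [z, x, x, x, x, x, z] [x, x, x, x, z, x, z]).trans ((by simpa using r1 [x, x, x, x] [] : Red R [x, x, x, x, z, x, z] [x, x, x, x, x, x, x])))
    apply crit_of_take
    intro l1 r1 h1 l2 r2 h2
    rw [hm] at h1 h2
    rcases h1 with ⟨rfl, rfl⟩ | ⟨rfl, rfl⟩ <;> rcases h2 with ⟨rfl, rfl⟩ | ⟨rfl, rfl⟩ <;>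
    refine ⟨fun k hk => ?_, fun k hk => ?_⟩ <;> (have hk' : k < 8 := by simp at hk; try omega) <;>
    interval_cases k <;> simp [hxz, hzx, hd, j0, j1] at hk ⊢



set_option linter.unusedSimpArgs false
set_option linter.flexible false
set_option linter.unusedVariables false
set_option linter.unusedSectionVars false

/-! ### Systems with a Garside-like letter -/

def TR {γ : Type} (x y z w t : γ) (Y : List γ) : Set (List γ × List γ) :=
  {([x, y, x], [t]), ([z, w, z], [t]), (x :: Y ++ [t], t :: Y ++ [x]), ([z, w, t], [t, w, z])}

theorem TR_mem {γ : Type} {x y z w t : γ} {Y l r : List γ} : (l, r) ∈ TR x y z w t Y ↔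
    (l = [x, y, x] ∧ r = [t]) ∨ (l = [z, w, z] ∧ r = [t]) ∨
    (l = x :: Y ++ [t] ∧ r = t :: Y ++ [x]) ∨ (l = [z, w, t] ∧ r = [t, w, z]) := by
  simp [TR]

theorem TR_irr {γ : Type} {x y z w t : γ} {Y v : List γ} {p : γ} :
    Irr (TR x y z w t Y) (v ++ [p]) ↔ Irr (TR x y z w t Y) v ∧ ¬ [x, y, x] <:+ v ++ [p] ∧
      ¬ [z, w, z] <:+ v ++ [p] ∧ ¬ x :: Y ++ [t] <:+ v ++ [p] ∧ ¬ [z, w, t] <:+ v ++ [p] := by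
  rw [irr_snoc]
  simp only [TR_mem]
  constructor
  · rintro ⟨h, h'⟩
    exact ⟨h, h' _ _ (Or.inl ⟨rfl, rfl⟩), h' _ _ (Or.inr (Or.inl ⟨rfl, rfl⟩)),
      h' _ _ (Or.inr (Or.inr (Or.inl ⟨rfl, rfl⟩))), h' _ _ (Or.inr (Or.inr (Or.inr ⟨rfl, rfl⟩)))⟩
  · rintro ⟨h, h1, h2, h3, h4⟩
    refine ⟨h, ?_⟩
    rintro l r (⟨rfl, rfl⟩ | ⟨rfl, rfl⟩ | ⟨rfl, rfl⟩ | ⟨rfl, rfl⟩) <;> assumption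

theorem suf_snoc {γ : Type} {p u : List γ} {a b : γ} : p ++ [a] <:+ u ++ [b] ↔ a = b ∧ p <:+ u := by
  constructor
  · rintro ⟨q, hq⟩
    rw [← List.append_assoc] at hq
    have h := List.append_inj' hq rfl
    exact ⟨by simpa using h.2, q, h.1⟩
  · rintro ⟨rfl, q, rfl⟩
    exact ⟨q, by simp⟩

section T


theorem TR_sweep
    {γ : Type} (x y z w t : γ) (Y : List γ) (hxz : x ≠ z) (hwz : w ≠ z)
    (htx : t ≠ x) (hty : t ≠ y) (htz : t ≠ z) (htw : t ≠ w)
    (hY : (y = x ∧ Y = []) ∨ (y ≠ x ∧ Y = [y])) (hb : y = x ∨ y = z → w ≠ x) (n : ℕ) : ∀ v : List γ, v.length ≤ n → Irr (TR x y z w t Y) v →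
    ∃ u, Irr (TR x y z w t Y) u ∧ RM (TR x y z w t Y) gs 4 v [t] u ∧ u.length = v.length + 1 ∧
      ([t] <:+ u ∨ (Y ++ [x] <:+ u ∧ x :: Y <:+ v ∧ ([x, x] <:+ u → [x, x] <:+ v)) ∨
        ([w, z] <:+ u ∧ [z, w] <:+ v)) := by
  induction n with
  | zero =>
    intro v hv hi
    have : v = [] := List.eq_nil_of_length_eq_zero (by omega)
    subst this
    have hh := RM_one (R := TR x y z w t Y) (N := 4) [] [] [t] [t] (by simp)
      (by simp) (by simp) (by simp) (WordEq.refl _)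
    refine ⟨[t], ?_, by simpa using hh, by simp, by simp⟩
    have := TR_irr (x := x) (y := y) (z := z) (w := w) (t := t) (Y := Y) (v := []) (p := t)
    rw [List.nil_append] at this
    rw [this]
    refine ⟨hi, ?_⟩
    rcases hY with ⟨rfl, rfl⟩ | ⟨hyx, rfl⟩ <;> simp [suf_rev]
  | succ n ih =>
    intro v hv hi
    by_cases h1 : x :: Y <:+ v
    · obtain ⟨v1, rfl⟩ := h1
      obtain ⟨u, hu, hRM, hlen, hinv⟩ := ih v1 (by simp at hv; omega) hi.left
      refine ⟨u ++ (Y ++ [x]), ?_, ?_, ?_, Or.inr (Or.inl ⟨by simp, by simp, ?_⟩)⟩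
      · rcases hY with ⟨rfl, rfl⟩ | ⟨hyx, rfl⟩
        · have hwx := hb (Or.inl rfl)
          rw [List.nil_append, TR_irr]
          refine ⟨hu, ?_⟩
          have hnx : ¬ [y, y] <:+ u := by
            intro hh
            rcases hinv with ⟨u1, rfl⟩ | ⟨-, -, h⟩ | ⟨⟨u1, rfl⟩, -⟩
            · simp [suf_rev] at hh; grind
            · obtain ⟨v2, rfl⟩ := h hh
              exact hi [y, y, y] _ (TR_mem.2 (Or.inl ⟨rfl, rfl⟩)) ⟨v2, [], by simp⟩
            · simp [suf_rev] at hh; grind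
          rw [show [y, y, y] = [y, y] ++ [y] by rfl, suf_snoc, suf_snoc,
            show [z, w, z] = [z, w] ++ [z] by rfl, suf_snoc, show [z, w, t] = [z, w] ++ [t] by rfl, suf_snoc]
          grind
        · rw [show u ++ ([y] ++ [x]) = (u ++ [y]) ++ [x] by simp, TR_irr, TR_irr]
          refine ⟨⟨hu, ?_⟩, ?_⟩
          all_goals
            rcases hinv with ⟨u1, rfl⟩ | ⟨⟨u1, rfl⟩, ⟨v2, rfl⟩, -⟩ | ⟨⟨u1, rfl⟩, -⟩
            · simp [suf_rev]; try grind
            · exact absurd ⟨v2, [y], by simp⟩ (hi [x, y, x] _ (TR_mem.2 (Or.inl ⟨rfl, rfl⟩)))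
            · simp [suf_rev]; try grind
      · refine RM_ext hRM (by simp) _ _ _ ?_ ?_ (by simp) ?_ ?_
        · rcases hY with ⟨rfl, rfl⟩ | ⟨hyx, rfl⟩ <;> simp
        · rcases hY with ⟨rfl, rfl⟩ | ⟨hyx, rfl⟩ <;> simp
        · simpa using WordEq.rule (R := TR x y z w t Y) (u := x :: Y ++ [t]) (v := t :: Y ++ [x]) (by simp [TR])
        · rw [abs_le]; simp [hlen]
      · simp [hlen]; omega
      · rcases hY with ⟨rfl, rfl⟩ | ⟨hyx, rfl⟩
        · intro hh
          have h1 : [y] <:+ u := by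
            rw [List.nil_append, show [y, y] = [y] ++ [y] by rfl, suf_snoc] at hh
            exact hh.2
          have h2 : [y] <:+ v1 := by
            rcases hinv with ⟨u1, rfl⟩ | ⟨-, h, -⟩ | ⟨⟨u1, rfl⟩, -⟩
            · simp [suf_rev] at h1; grind
            · exact h
            · simp [suf_rev] at h1; grind
          obtain ⟨v2, rfl⟩ := h2
          exact ⟨v2, by simp⟩
        · intro hh
          simp [suf_rev] at hh; grind
    by_cases h2 : [z, w] <:+ v
    · obtain ⟨v1, rfl⟩ := h2
      obtain ⟨u, hu, hRM, hlen, hinv⟩ := ih v1 (by simp at hv; omega) hi.left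
      refine ⟨u ++ [w, z], ?_, ?_, ?_, Or.inr (Or.inr ⟨by simp, by simp⟩)⟩
      · rw [show u ++ [w, z] = (u ++ [w]) ++ [z] by simp, TR_irr, TR_irr]
        refine ⟨⟨hu, ?_⟩, ?_⟩
        all_goals
          rcases hinv with ⟨u1, rfl⟩ | ⟨⟨u1, rfl⟩, -, -⟩ | ⟨⟨u1, rfl⟩, ⟨v2, rfl⟩⟩
          · rcases hY with ⟨rfl, rfl⟩ | ⟨hyx, rfl⟩ <;> simp [suf_rev] <;> try grind
          · rcases hY with ⟨rfl, rfl⟩ | ⟨hyx, rfl⟩ <;> simp [suf_rev] <;> try grind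
          · exact absurd ⟨v2, [w], by simp⟩ (hi [z, w, z] _ (TR_mem.2 (Or.inr (Or.inl ⟨rfl, rfl⟩))))
      · refine RM_ext hRM (by simp) _ _ _ (by simp) (by simp) (by simp) ?_ ?_
        · simpa using WordEq.rule (R := TR x y z w t Y) (u := [z, w, t]) (v := [t, w, z]) (by simp [TR])
        · rw [abs_le]; simp [hlen]
      · simp [hlen]
    · have hh := RM_one (R := TR x y z w t Y) (N := 4) v [] [t] [t] (by simp)
        (by simp) (by simp) (by simp) (WordEq.refl _)
      refine ⟨v ++ [t], ?_, by simpa using hh, by simp, by simp⟩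
      rw [TR_irr]
      refine ⟨hi, ?_, ?_, ?_, ?_⟩
      · simp [suf_rev, htx.symm]
      · simp [suf_rev, htz.symm]
      · rintro ⟨q, hq⟩
        rw [← List.append_assoc] at hq
        exact h1 ⟨q, List.append_inj_left' hq rfl⟩
      · rintro ⟨q, hq⟩
        rw [show q ++ [z, w, t] = (q ++ [z, w]) ++ [t] by simp] at hq
        exact h2 ⟨q, List.append_inj_left' hq rfl⟩

theorem TR_good1
    {γ : Type} (x y z w t : γ) (Y : List γ) (hxz : x ≠ z) (hwz : w ≠ z)
    (htx : t ≠ x) (hty : t ≠ y) (htz : t ≠ z) (htw : t ≠ w)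
    (hY : (y = x ∧ Y = []) ∨ (y ≠ x ∧ Y = [y])) (hb : y = x ∨ y = z → w ≠ x) : GoodR (TR x y z w t Y) 4 := by
  intro p l r b hm hi
  have hcase : (l = [x, y] ∧ b = x) ∨ (l = [z, w] ∧ b = z) ∨ b = t := by
    rw [TR_mem] at hm
    rcases hm with ⟨e, -⟩ | ⟨e, -⟩ | ⟨e, -⟩ | ⟨e, -⟩
    · have := List.append_inj' (show l ++ [b] = [x, y] ++ [x] from e) rfl
      simp at this; tauto
    · have := List.append_inj' (show l ++ [b] = [z, w] ++ [z] from e) rfl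
      simp at this; tauto
    · have := List.append_inj' e rfl
      simp at this; tauto
    · have := List.append_inj' (show l ++ [b] = [z, w] ++ [t] from e) rfl
      simp at this; tauto
  rcases hcase with ⟨rfl, rfl⟩ | ⟨rfl, rfl⟩ | rfl
  · obtain ⟨u, hu, hRM, hlen, -⟩ := TR_sweep b y z w t Y hxz hwz htx hty htz htw hY hb _ p le_rfl hi.left
    have := RM_ext hRM (by simp) [b, y] [] [b] (by simp) (by simp) (by simp)
      (WordEq.rule (by simp [TR])) (by rw [abs_le]; simp [hlen])
    exact ⟨u, hu, by simpa using this⟩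
  · obtain ⟨u, hu, hRM, hlen, -⟩ := TR_sweep x y b w t Y hxz hwz htx hty htz htw hY hb _ p le_rfl hi.left
    have := RM_ext hRM (by simp) [b, w] [] [b] (by simp) (by simp) (by simp)
      (WordEq.rule (by simp [TR])) (by rw [abs_le]; simp [hlen])
    exact ⟨u, hu, by simpa using this⟩
  · obtain ⟨u, hu, hRM, -, -⟩ := TR_sweep x y z w b Y hxz hwz htx hty htz htw hY hb _ (p ++ l) le_rfl hi
    exact ⟨u, hu, hRM⟩

theorem TR_rev_mem
    {γ : Type} (x y z w t : γ) (Y : List γ) (hY : (y = x ∧ Y = []) ∨ (y ≠ x ∧ Y = [y])) {l r : List γ} : (l, r) ∈ Rrev (TR x y z w t Y) ↔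
    (l = [x, y, x] ∧ r = [t]) ∨ (l = [z, w, z] ∧ r = [t]) ∨
    (l = t :: Y ++ [x] ∧ r = x :: Y ++ [t]) ∨ (l = [t, w, z] ∧ r = [z, w, t]) := by
  simp only [Rrev, Set.mem_ofPred_eq, TR_mem, List.reverse_eq_iff]
  rcases hY with ⟨rfl, rfl⟩ | ⟨hyx, rfl⟩ <;> simp

theorem TR_rev_irr
    {γ : Type} (x y z w t : γ) (Y : List γ) (hY : (y = x ∧ Y = []) ∨ (y ≠ x ∧ Y = [y])) {v : List γ} {p : γ} :
    Irr (Rrev (TR x y z w t Y)) (v ++ [p]) ↔ Irr (Rrev (TR x y z w t Y)) v ∧ ¬ [x, y, x] <:+ v ++ [p] ∧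
      ¬ [z, w, z] <:+ v ++ [p] ∧ ¬ t :: Y ++ [x] <:+ v ++ [p] ∧ ¬ [t, w, z] <:+ v ++ [p] := by
  rw [irr_snoc]
  simp only [TR_rev_mem x y z w t Y hY]
  constructor
  · rintro ⟨h, h'⟩
    exact ⟨h, h' _ _ (Or.inl ⟨rfl, rfl⟩), h' _ _ (Or.inr (Or.inl ⟨rfl, rfl⟩)),
      h' _ _ (Or.inr (Or.inr (Or.inl ⟨rfl, rfl⟩))), h' _ _ (Or.inr (Or.inr (Or.inr ⟨rfl, rfl⟩)))⟩
  · rintro ⟨h, h1, h2, h3, h4⟩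
    refine ⟨h, ?_⟩
    rintro l r (⟨rfl, rfl⟩ | ⟨rfl, rfl⟩ | ⟨rfl, rfl⟩ | ⟨rfl, rfl⟩) <;> assumption

theorem TR_rev_t
    {γ : Type} (x y z w t : γ) (Y : List γ) (hxz : x ≠ z) (hwz : w ≠ z)
    (htx : t ≠ x) (hty : t ≠ y) (htz : t ≠ z) (htw : t ≠ w)
    (hY : (y = x ∧ Y = []) ∨ (y ≠ x ∧ Y = [y])) (hb : y = x ∨ y = z → w ≠ x) {v : List γ} (h : Irr (Rrev (TR x y z w t Y)) v) :
    Irr (Rrev (TR x y z w t Y)) (v ++ [t]) := by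
  rw [TR_rev_irr x y z w t Y hY]
  refine ⟨h, ?_⟩
  rw [show [x, y, x] = [x, y] ++ [x] by rfl, suf_snoc, suf_snoc,
            show [z, w, z] = [z, w] ++ [z] by rfl, suf_snoc, show [t, w, z] = [t, w] ++ [z] by rfl, suf_snoc]
  grind

theorem TR_rev_sweep
    {γ : Type} (x y z w t : γ) (Y : List γ) (hxz : x ≠ z) (hwz : w ≠ z)
    (htx : t ≠ x) (hty : t ≠ y) (htz : t ≠ z) (htw : t ≠ w)
    (hY : (y = x ∧ Y = []) ∨ (y ≠ x ∧ Y = [y])) (hb : y = x ∨ y = z → w ≠ x) (n : ℕ) : ∀ v : List γ, v.length ≤ n → Irr (Rrev (TR x y z w t Y)) v →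
    ∀ b, b = x ∨ b = z →
    ∃ u, Irr (Rrev (TR x y z w t Y)) u ∧ RM (Rrev (TR x y z w t Y)) gs 4 v [b] u ∧
      u.length ≤ v.length + 1 ∧ v.length ≤ u.length + 1 ∧ ([t] <:+ u ∨ [b] <:+ u) := by
  induction n using Nat.strong_induction_on with
  | _ n ih =>
  intro v hv hi b hb'
  by_cases hI : Irr (Rrev (TR x y z w t Y)) (v ++ [b])
  · have hh := RM_one (R := Rrev (TR x y z w t Y)) (N := 4) v [] [b] [b] (by simp)
        (by simp) (by simp) (by simp) (WordEq.refl _)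
    exact ⟨v ++ [b], hI, by simpa using hh, by simp, by simp; omega, by simp⟩
  · rw [irr_snoc] at hI
    simp only [hi, true_and, not_forall, not_not] at hI
    obtain ⟨l, r, hm, hs⟩ := hI
    have hm' := hm
    rw [TR_rev_mem x y z w t Y hY] at hm
    rcases hm with ⟨rfl, rfl⟩ | ⟨rfl, rfl⟩ | ⟨rfl, rfl⟩ | ⟨rfl, rfl⟩
    · rw [show [x, y, x] = [x, y] ++ [x] by rfl, suf_snoc] at hs
      obtain ⟨rfl, p, rfl⟩ := hs
      refine ⟨p ++ [t], TR_rev_t x y z w t Y hxz hwz htx hty htz htw hY hb hi.left, ?_, ?_, ?_, by simp⟩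
      · exact RM_one _ _ _ _ (by simp) (by simp) (by simp) (by simp) (WordEq.rule hm')
      · simp
      · simp
    · rw [show [z, w, z] = [z, w] ++ [z] by rfl, suf_snoc] at hs
      obtain ⟨rfl, p, rfl⟩ := hs
      refine ⟨p ++ [t], TR_rev_t x y z w t Y hxz hwz htx hty htz htw hY hb hi.left, ?_, ?_, ?_, by simp⟩
      · exact RM_one _ _ _ _ (by simp) (by simp) (by simp) (by simp) (WordEq.rule hm')
      · simp
      · simp
    · rw [suf_snoc] at hs
      obtain ⟨rfl, p, rfl⟩ := hs
      obtain ⟨u, hu, hRM, hl1, hl2, hend⟩ := ih p.length (by simp at hv; omega) p le_rfl hi.left x (Or.inl rfl)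
      refine ⟨u ++ (Y ++ [t]), ?_, ?_, by simp; omega, by simp; omega, Or.inl ⟨u ++ Y, by simp⟩⟩
      · rw [← List.append_assoc]
        apply TR_rev_t x y z w t Y hxz hwz htx hty htz htw hY hb
        rcases hY with ⟨rfl, rfl⟩ | ⟨hyx, rfl⟩
        · simpa using hu
        · rw [TR_rev_irr _ _ _ _ _ _ (Or.inr ⟨hyx, rfl⟩)]
          refine ⟨hu, ?_⟩
          rcases hend with ⟨u, rfl⟩ | ⟨u, rfl⟩ <;> simp [suf_rev] <;> grind
      · refine RM_ext hRM (by simp) _ _ _ ?_ ?_ (by simp) (WordEq.rule hm') ?_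
        · rcases hY with ⟨rfl, rfl⟩ | ⟨hyx, rfl⟩ <;> simp
        · rcases hY with ⟨rfl, rfl⟩ | ⟨hyx, rfl⟩ <;> simp
        · rw [abs_le]; simp; omega
    · rw [show [t, w, z] = [t, w] ++ [z] by rfl, suf_snoc] at hs
      obtain ⟨rfl, p, rfl⟩ := hs
      obtain ⟨u, hu, hRM, hl1, hl2, hend⟩ := ih p.length (by simp at hv; omega) p le_rfl hi.left z (Or.inr rfl)
      refine ⟨u ++ [w, t], ?_, ?_, by simp; omega, by simp; omega, ?_⟩
      · rw [show u ++ [w, t] = (u ++ [w]) ++ [t] by simp]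
        apply TR_rev_t x y z w t Y hxz hwz htx hty htz htw hY hb
        rw [TR_rev_irr _ _ _ _ _ _ hY]
        refine ⟨hu, ?_⟩
        rcases hY with ⟨rfl, rfl⟩ | ⟨hyx, rfl⟩ <;>
        rcases hend with ⟨u, rfl⟩ | ⟨u, rfl⟩ <;> simp [suf_rev] <;> grind
      · refine RM_ext hRM (by simp) _ _ _ (by simp) (by simp) (by simp) (WordEq.rule hm') ?_
        · rw [abs_le]; simp; omega
      · left; exact ⟨u ++ [w], by simp⟩

theorem TR_good2
    {γ : Type} (x y z w t : γ) (Y : List γ) (hxz : x ≠ z) (hwz : w ≠ z)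
    (htx : t ≠ x) (hty : t ≠ y) (htz : t ≠ z) (htw : t ≠ w)
    (hY : (y = x ∧ Y = []) ∨ (y ≠ x ∧ Y = [y])) (hb : y = x ∨ y = z → w ≠ x) : GoodR (Rrev (TR x y z w t Y)) 4 := by
  intro p l r b hm hi
  have hcase : b = x ∨ b = z := by
    rw [TR_rev_mem x y z w t Y hY] at hm
    rcases hm with ⟨e, -⟩ | ⟨e, -⟩ | ⟨e, -⟩ | ⟨e, -⟩
    · have := List.append_inj' (show l ++ [b] = [x, y] ++ [x] from e) rfl
      simp at this; tauto
    · have := List.append_inj' (show l ++ [b] = [z, w] ++ [z] from e) rfl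
      simp at this; tauto
    · have := List.append_inj' e rfl
      simp at this; tauto
    · have := List.append_inj' (show l ++ [b] = [t, w] ++ [z] from e) rfl
      simp at this; tauto
  obtain ⟨u, hu, hRM, -, -⟩ := TR_rev_sweep x y z w t Y hxz hwz htx hty htz htw hY hb _ (p ++ l) le_rfl hi b hcase
  exact ⟨u, hu, hRM⟩

end T


set_option linter.unusedSimpArgs false
set_option linter.flexible false
set_option linter.unusedVariables false
set_option linter.unusedSectionVars false

/-! ### Termination and confluence of the systems with a Garside-like letter -/

/-- interpretation proving termination -/
def tval {γ : Type} [DecidableEq γ] (t : γ) : List γ → ℕ → ℕ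
  | [], n => n
  | a :: l, n => if a = t then tval t l n + 1 else 2 * tval t l n

theorem tval_append {γ : Type} [DecidableEq γ] (t : γ) (u v : List γ) (n : ℕ) :
    tval t (u ++ v) n = tval t u (tval t v n) := by
  induction u with
  | nil => rfl
  | cons a u ih => simp [tval, ih]

theorem tval_pos {γ : Type} [DecidableEq γ] (t : γ) (u : List γ) (n : ℕ) (hn : 1 ≤ n) :
    1 ≤ tval t u n := by
  induction u with
  | nil => exact hn
  | cons a u ih => simp only [tval]; split <;> omega

theorem tval_mono {γ : Type} [DecidableEq γ] (t : γ) (u : List γ) (n m : ℕ) (hn : n < m) :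
    tval t u n < tval t u m := by
  induction u with
  | nil => exact hn
  | cons a u ih => simp only [tval]; split <;> omega

theorem term_tval {γ : Type} [DecidableEq γ] (R : Set (List γ × List γ)) (t : γ)
    (h : ∀ l r, (l, r) ∈ R → ∀ n, 1 ≤ n → tval t r n < tval t l n) : Terminates R := by
  refine ⟨fun w => tval t w 1, ?_⟩
  intro l r hl p s
  simp only [List.append_assoc, tval_append]
  exact tval_mono t p _ _ (h l r hl _ (tval_pos t s 1 le_rfl))

theorem TR_crit {γ : Type} (x y z w t : γ) (Y : List γ) (hxz : x ≠ z) (hwz : w ≠ z)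
  (htx : t ≠ x) (hty : t ≠ y) (htz : t ≠ z) (htw : t ≠ w)
  (hY : (y = x ∧ Y = []) ∨ (y ≠ x ∧ Y = [y])) (hb : y = x ∨ y = z → w ≠ x) :
    CritPairs (TR x y z w t Y) := by
  have hzx := hxz.symm
  have hzw := hwz.symm
  have hd : ∀ a, Joinable (TR x y z w t Y) a a := fun a => Joinable.of_eq rfl
  have r1 : ∀ p s, Red (TR x y z w t Y) (p ++ [x, y, x] ++ s) (p ++ [t] ++ s) := fun p s =>
      red_step p s (by simp [TR])
  have r2 : ∀ p s, Red (TR x y z w t Y) (p ++ [z, w, z] ++ s) (p ++ [t] ++ s) := fun p s =>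
      red_step p s (by simp [TR])
  have r3 : ∀ p s, Red (TR x y z w t Y) (p ++ (x :: Y ++ [t]) ++ s) (p ++ (t :: Y ++ [x]) ++ s) := fun p s =>
      red_step p s (by simp [TR])
  have r4 : ∀ p s, Red (TR x y z w t Y) (p ++ [z, w, t] ++ s) (p ++ [t, w, z] ++ s) := fun p s =>
      red_step p s (by simp [TR])
  have hm : ∀ l r, (l, r) ∈ TR x y z w t Y ↔ _ := fun l r => TR_mem
  generalize hR : TR x y z w t Y = R at *
  have j1 : Joinable R [t, w, z] [z, w, t] := Joinable.of_red (by simpa using r4 [] [])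
  have j2 : Joinable R [t, w, t] [z, w, t, w, z] := Joinable.of_red (
    (by simpa using r4 [] [w, z] : Red R _ [t, w, z, w, z]).trans (by simpa using r2 [t, w] []))
  rcases hY with ⟨rfl, rfl⟩ | ⟨hyx, rfl⟩
  · have j3 : Joinable R [t, y] [y, t] := Joinable.of_red (by simpa using r3 [] [])
    have s4 : Red R [y, y, t] [t, y, y] :=
      (by simpa using r3 [y] [] : Red R [y, y, t] [y, t, y]).trans (by simpa using r3 [] [y])
    have j4 : Joinable R [t, y, y] [y, y, t] := Joinable.of_red s4
    have j5 : Joinable R [t, t] [y, y, t, y] := Joinable.of_red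
      ((by simpa using s4.ctx [] [y] : Red R _ [t, y, y, y]).trans (by simpa using r1 [t] []))
    have hwy := hb (Or.inl rfl)
    have hyw := hwy.symm
    apply crit_of_take
    intro l1 r1 h1 l2 r2 h2
    rw [hm] at h1 h2
    rcases h1 with ⟨rfl, rfl⟩ | ⟨rfl, rfl⟩ | ⟨rfl, rfl⟩ | ⟨rfl, rfl⟩ <;>
    rcases h2 with ⟨rfl, rfl⟩ | ⟨rfl, rfl⟩ | ⟨rfl, rfl⟩ | ⟨rfl, rfl⟩ <;>
    refine ⟨fun k hk => ?_, fun k hk => ?_⟩ <;> (have hk' : k < 8 := by simp at hk; try omega) <;>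
    interval_cases k <;> simp [hxz, hzx, hd, j1, j2, j3, j4, j5, hwz, hzw, hwy, hyw, htx, hty, htz, htw, htx.symm, hty.symm, htz.symm, htw.symm] at hk ⊢
  · have s3 : Red R [x, y, t] [t, y, x] := by simpa using r3 [] []
    have j3 : Joinable R [t, y, x] [x, y, t] := Joinable.of_red s3
    have j5 : Joinable R [t, y, t] [x, y, t, y, x] := Joinable.of_red
      ((by simpa using s3.ctx [] [y, x] : Red R _ [t, y, x, y, x]).trans (by simpa using r1 [t, y] []))
    have hxy := hyx.symm
    apply crit_of_take
    intro l1 r1 h1 l2 r2 h2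
    rw [hm] at h1 h2
    rcases h1 with ⟨rfl, rfl⟩ | ⟨rfl, rfl⟩ | ⟨rfl, rfl⟩ | ⟨rfl, rfl⟩ <;>
    rcases h2 with ⟨rfl, rfl⟩ | ⟨rfl, rfl⟩ | ⟨rfl, rfl⟩ | ⟨rfl, rfl⟩ <;>
    refine ⟨fun k hk => ?_, fun k hk => ?_⟩ <;> (have hk' : k < 8 := by simp at hk; try omega) <;>
    interval_cases k <;> simp [hxz, hzx, hd, j1, j2, j3, j5, hwz, hzw, hyx, hxy, htx, hty, htz, htw, htx.symm, hty.symm, htz.symm, htw.symm] at hk ⊢ <;>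
    (intros; exfalso; grind)

theorem TR_bi {γ : Type} [Fintype γ] (x y z w t : γ) (Y : List γ) (hxz : x ≠ z) (hwz : w ≠ z)
  (htx : t ≠ x) (hty : t ≠ y) (htz : t ≠ z) (htw : t ≠ w)
  (hY : (y = x ∧ Y = []) ∨ (y ≠ x ∧ Y = [y])) (hb : y = x ∨ y = z → w ≠ x) :
    MonBiautomatic (TR x y z w t Y) := by
  classical
  refine biauto_of_rewriting _ (by simp [TR]) (term_tval _ t ?_)
    (TR_crit x y z w t Y hxz hwz htx hty htz htw hY hb) 4 (by simp)
    (TR_good1 x y z w t Y hxz hwz htx hty htz htw hY hb)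
    (TR_good2 x y z w t Y hxz hwz htx hty htz htw hY hb)
  intro l r hm n hn
  rw [TR_mem] at hm
  rcases hY with ⟨rfl, rfl⟩ | ⟨hyx, rfl⟩ <;>
  rcases hm with ⟨rfl, rfl⟩ | ⟨rfl, rfl⟩ | ⟨rfl, rfl⟩ | ⟨rfl, rfl⟩ <;>
    simp [tval, htx.symm, hty.symm, htz.symm, htw.symm] <;> omega

theorem bi_T {α : Type} [Fintype α] (x y z w : α) (hxz : x ≠ z) (hwz : w ≠ z)
    (hb : y = x ∨ y = z → w ≠ x) : MonBiautomatic {([x, y, x], [z, w, z])} := by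
  obtain ⟨Y, hY⟩ : ∃ Y, (y = x ∧ Y = []) ∨ (y ≠ x ∧ Y = [y]) := by
    by_cases h : y = x
    · exact ⟨[], by simp [h]⟩
    · exact ⟨[y], by simp [h]⟩
  have hbi := TR_bi (some x) (some y) (some z) (some w) none (Y.map some) (by simpa) (by simpa)
    (by simp) (by simp) (by simp) (by simp)
    (by rcases hY with ⟨rfl, rfl⟩ | ⟨hyx, rfl⟩ <;> simp [*]) (by simpa)
  have hr : WordEq {([x, y, x], [z, w, z])} [x, y, x] [z, w, z] := WordEq.rule rfl
  refine biauto_transfer _ _ (fun o => match o with | none => [x, y, x] | some a => [a])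
    (fun a => [some a]) ?_ ?_ ?_ ?_ hbi
  · intro l r h
    rw [TR_mem] at h
    rcases h with ⟨rfl, rfl⟩ | ⟨rfl, rfl⟩ | ⟨rfl, rfl⟩ | ⟨rfl, rfl⟩
    · exact WordEq.of_eq (by simp)
    · simpa using hr.symm
    · rcases hY with ⟨rfl, rfl⟩ | ⟨hyx, rfl⟩ <;> exact WordEq.of_eq (by simp)
    · simpa using (hr.ctx [z, w] []).trans (hr.symm.ctx [] [w, z])
  · intro l r h
    simp only [Set.mem_singleton_iff, Prod.mk.injEq] at h
    obtain ⟨rfl, rfl⟩ := h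
    have h1 : WordEq (TR (some x) (some y) (some z) (some w) none (Y.map some)) [some x, some y, some x] [none] :=
      WordEq.rule (by simp [TR])
    have h2 : WordEq (TR (some x) (some y) (some z) (some w) none (Y.map some)) [some z, some w, some z] [none] :=
      WordEq.rule (by simp [TR])
    simpa using h1.trans h2.symm
  · rintro (_ | a)
    · simpa using WordEq.rule (R := TR (some x) (some y) (some z) (some w) none (Y.map some)) (u := [some x, some y, some x]) (v := [none]) (by simp [TR])
    · exact WordEq.of_eq (by simp)
  · intro a
    exact WordEq.of_eq (by simp)


set_option linter.unusedSimpArgs false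
set_option linter.flexible false
set_option linter.unusedVariables false
set_option linter.unusedSectionVars false

/-! ### The braid relation -/

def TB {γ : Type} (x z t : γ) : Set (List γ × List γ) :=
  {([x, z, x], [t]), ([z, x, z], [t]), ([x, t], [t, z]), ([z, t], [t, x])}

theorem TB_mem {γ : Type} {x z t : γ} {l r : List γ} : (l, r) ∈ TB x z t ↔
    (l = [x, z, x] ∧ r = [t]) ∨ (l = [z, x, z] ∧ r = [t]) ∨
    (l = [x, t] ∧ r = [t, z]) ∨ (l = [z, t] ∧ r = [t, x]) := by
  simp [TB]

theorem TB_rev_mem {γ : Type} {x z t : γ} {l r : List γ} : (l, r) ∈ Rrev (TB x z t) ↔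
    (l = [x, z, x] ∧ r = [t]) ∨ (l = [z, x, z] ∧ r = [t]) ∨
    (l = [t, x] ∧ r = [z, t]) ∨ (l = [t, z] ∧ r = [x, t]) := by
  simp [Rrev, TB_mem, List.reverse_eq_iff]

theorem TB_irr {γ : Type} {x z t : γ} {v : List γ} {p : γ} :
    Irr (TB x z t) (v ++ [p]) ↔ Irr (TB x z t) v ∧ ¬ (x = p ∧ [x, z] <:+ v) ∧
      ¬ (z = p ∧ [z, x] <:+ v) ∧ ¬ (t = p ∧ [x] <:+ v) ∧ ¬ (t = p ∧ [z] <:+ v) := by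
  rw [irr_snoc]
  simp only [TB_mem, ← suf_snoc]
  constructor
  · rintro ⟨h, h'⟩
    exact ⟨h, h' _ _ (Or.inl ⟨rfl, rfl⟩), h' _ _ (Or.inr (Or.inl ⟨rfl, rfl⟩)),
      h' _ _ (Or.inr (Or.inr (Or.inl ⟨rfl, rfl⟩))), h' _ _ (Or.inr (Or.inr (Or.inr ⟨rfl, rfl⟩)))⟩
  · rintro ⟨h, h1, h2, h3, h4⟩
    refine ⟨h, ?_⟩
    rintro l r (⟨rfl, rfl⟩ | ⟨rfl, rfl⟩ | ⟨rfl, rfl⟩ | ⟨rfl, rfl⟩) <;> assumption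

section B


theorem TB_sweep
    {γ : Type} (x z t : γ) (hxz : x ≠ z) (htx : t ≠ x) (htz : t ≠ z) (v : List γ) : Irr (TB x z t) v →
    ∃ u, Irr (TB x z t) u ∧ RM (TB x z t) gs 4 v [t] u ∧ u.length = v.length + 1 ∧
      ([x] <:+ u → [z] <:+ v) ∧ ([z] <:+ u → [x] <:+ v) ∧
      ([x, z] <:+ u → [z, x] <:+ v) ∧ ([z, x] <:+ u → [x, z] <:+ v) := by
  have e1 : ∀ (a d : γ) (s : List γ), ([a] <:+ s ++ [d] ↔ a = d) := by
    intro a d s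
    simpa using suf_snoc (p := []) (a := a) (b := d) (u := s)
  have e2 : ∀ (a b d : γ) (s : List γ), ([a, b] <:+ s ++ [d] ↔ b = d ∧ [a] <:+ s) := by
    intro a b d s
    exact suf_snoc (p := [a]) (a := b) (b := d) (u := s)
  induction v using List.reverseRecOn with
  | nil =>
    intro hi
    have hh := RM_one (R := TB x z t) (N := 4) [] [] [t] [t] (by simp)
      (by simp) (by simp) (by simp) (WordEq.refl _)
    refine ⟨[] ++ [t], ?_, by simpa using hh, by simp, ?_⟩
    · rw [TB_irr]; refine ⟨hi, ?_⟩; simp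
    · simp only [e1, e2]; grind
  | append_singleton v c ih =>
    intro hi
    obtain ⟨u, hu, hRM, hlen, i1, i2, i3, i4⟩ := ih hi.left
    have hi' := TB_irr.1 hi
    by_cases hx : c = x
    · subst hx
      refine ⟨u ++ [z], ?_, ?_, by simp [hlen], ?_⟩
      · rw [TB_irr]; refine ⟨hu, ?_⟩; grind
      · exact RM_ext hRM (by simp) _ _ _ (by simp) (by simp) (by simp) (WordEq.rule (by simp [TB]))
          (by rw [abs_le]; simp [hlen])
      · simp only [e1, e2]; grind
    by_cases hz : c = z
    · subst hz
      refine ⟨u ++ [x], ?_, ?_, by simp [hlen], ?_⟩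
      · rw [TB_irr]; refine ⟨hu, ?_⟩; grind
      · exact RM_ext hRM (by simp) _ _ _ (by simp) (by simp) (by simp) (WordEq.rule (by simp [TB]))
          (by rw [abs_le]; simp [hlen])
      · simp only [e1, e2]; grind
    · have hh := RM_one (R := TB x z t) (N := 4) (v ++ [c]) [] [t] [t] (by simp)
        (by simp) (by simp) (by simp) (WordEq.refl _)
      refine ⟨(v ++ [c]) ++ [t], ?_, by simpa using hh, by simp, ?_⟩
      · rw [TB_irr]; refine ⟨hi, ?_⟩; simp only [e1, e2]; grind
      · simp only [e1, e2]; grind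

theorem TB_good1
    {γ : Type} (x z t : γ) (hxz : x ≠ z) (htx : t ≠ x) (htz : t ≠ z) : GoodR (TB x z t) 4 := by
  intro p l r b hm hi
  have hcase : (l = [x, z] ∧ b = x) ∨ (l = [z, x] ∧ b = z) ∨ b = t := by
    rw [TB_mem] at hm
    rcases hm with ⟨e, -⟩ | ⟨e, -⟩ | ⟨e, -⟩ | ⟨e, -⟩
    · have := List.append_inj' (show l ++ [b] = [x, z] ++ [x] from e) rfl
      simp at this; tauto
    · have := List.append_inj' (show l ++ [b] = [z, x] ++ [z] from e) rfl
      simp at this; tauto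
    · have := List.append_inj' (show l ++ [b] = [x] ++ [t] from e) rfl
      simp at this; tauto
    · have := List.append_inj' (show l ++ [b] = [z] ++ [t] from e) rfl
      simp at this; tauto
  rcases hcase with ⟨rfl, rfl⟩ | ⟨rfl, rfl⟩ | rfl
  · obtain ⟨u, hu, hRM, hlen, -⟩ := TB_sweep b z t hxz htx htz p hi.left
    have := RM_ext hRM (by simp) [b, z] [] [b] (by simp) (by simp) (by simp)
      (WordEq.rule (by simp [TB])) (by rw [abs_le]; simp [hlen])
    exact ⟨u, hu, by simpa using this⟩
  · obtain ⟨u, hu, hRM, hlen, -⟩ := TB_sweep x b t hxz htx htz p hi.left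
    have := RM_ext hRM (by simp) [b, x] [] [b] (by simp) (by simp) (by simp)
      (WordEq.rule (by simp [TB])) (by rw [abs_le]; simp [hlen])
    exact ⟨u, hu, by simpa using this⟩
  · obtain ⟨u, hu, hRM, -, -⟩ := TB_sweep x z b hxz htx htz (p ++ l) hi
    exact ⟨u, hu, hRM⟩

theorem TB_rev_t
    {γ : Type} (x z t : γ) (hxz : x ≠ z) (htx : t ≠ x) (htz : t ≠ z) {v : List γ} (h : Irr (Rrev (TB x z t)) v) :
    Irr (Rrev (TB x z t)) (v ++ [t]) := by
  rw [irr_snoc]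
  refine ⟨h, fun l r hm => ?_⟩
  rw [TB_rev_mem] at hm
  rcases hm with ⟨rfl, rfl⟩ | ⟨rfl, rfl⟩ | ⟨rfl, rfl⟩ | ⟨rfl, rfl⟩ <;> simp [suf_rev] <;> grind

theorem TB_rev_sweep
    {γ : Type} (x z t : γ) (hxz : x ≠ z) (htx : t ≠ x) (htz : t ≠ z) (n : ℕ) : ∀ v : List γ, v.length ≤ n → Irr (Rrev (TB x z t)) v →
    ∀ b, b = x ∨ b = z →
    ∃ u, Irr (Rrev (TB x z t)) u ∧ RM (Rrev (TB x z t)) gs 4 v [b] u ∧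
      u.length ≤ v.length + 1 ∧ v.length ≤ u.length + 1 := by
  induction n using Nat.strong_induction_on with
  | _ n ih =>
  intro v hv hi b hb'
  by_cases hI : Irr (Rrev (TB x z t)) (v ++ [b])
  · have hh := RM_one (R := Rrev (TB x z t)) (N := 4) v [] [b] [b] (by simp)
        (by simp) (by simp) (by simp) (WordEq.refl _)
    exact ⟨v ++ [b], hI, by simpa using hh, by simp, by simp; omega⟩
  · rw [irr_snoc] at hI
    simp only [hi, true_and, not_forall, not_not] at hI
    obtain ⟨l, r, hm, hs⟩ := hI
    have hm' := hm
    rw [TB_rev_mem] at hm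
    rcases hm with ⟨rfl, rfl⟩ | ⟨rfl, rfl⟩ | ⟨rfl, rfl⟩ | ⟨rfl, rfl⟩
    · rw [show [x, z, x] = [x, z] ++ [x] by rfl, suf_snoc] at hs
      obtain ⟨rfl, p, rfl⟩ := hs
      refine ⟨p ++ [t], TB_rev_t x z t hxz htx htz hi.left, ?_, ?_, ?_⟩
      · exact RM_one _ _ _ _ (by simp) (by simp) (by simp) (by simp) (WordEq.rule hm')
      · simp
      · simp
    · rw [show [z, x, z] = [z, x] ++ [z] by rfl, suf_snoc] at hs
      obtain ⟨rfl, p, rfl⟩ := hs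
      refine ⟨p ++ [t], TB_rev_t x z t hxz htx htz hi.left, ?_, ?_, ?_⟩
      · exact RM_one _ _ _ _ (by simp) (by simp) (by simp) (by simp) (WordEq.rule hm')
      · simp
      · simp
    · rw [show [t, x] = [t] ++ [x] by rfl, suf_snoc] at hs
      obtain ⟨rfl, p, rfl⟩ := hs
      obtain ⟨u, hu, hRM, hl1, hl2⟩ := ih p.length (by simp at hv; omega) p le_rfl hi.left z (Or.inr rfl)
      refine ⟨u ++ [t], TB_rev_t x z t hxz htx htz hu, ?_, by simp; omega, by simp; omega⟩
      refine RM_ext hRM (by simp) _ _ _ (by simp) (by simp) (by simp) (WordEq.rule hm') ?_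
      rw [abs_le]; simp; omega
    · rw [show [t, z] = [t] ++ [z] by rfl, suf_snoc] at hs
      obtain ⟨rfl, p, rfl⟩ := hs
      obtain ⟨u, hu, hRM, hl1, hl2⟩ := ih p.length (by simp at hv; omega) p le_rfl hi.left x (Or.inl rfl)
      refine ⟨u ++ [t], TB_rev_t x z t hxz htx htz hu, ?_, by simp; omega, by simp; omega⟩
      refine RM_ext hRM (by simp) _ _ _ (by simp) (by simp) (by simp) (WordEq.rule hm') ?_
      rw [abs_le]; simp; omega

theorem TB_good2
    {γ : Type} (x z t : γ) (hxz : x ≠ z) (htx : t ≠ x) (htz : t ≠ z) : GoodR (Rrev (TB x z t)) 4 := by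
  intro p l r b hm hi
  have hcase : b = x ∨ b = z := by
    rw [TB_rev_mem] at hm
    rcases hm with ⟨e, -⟩ | ⟨e, -⟩ | ⟨e, -⟩ | ⟨e, -⟩
    · have := List.append_inj' (show l ++ [b] = [x, z] ++ [x] from e) rfl
      simp at this; tauto
    · have := List.append_inj' (show l ++ [b] = [z, x] ++ [z] from e) rfl
      simp at this; tauto
    · have := List.append_inj' (show l ++ [b] = [t] ++ [x] from e) rfl
      simp at this; tauto
    · have := List.append_inj' (show l ++ [b] = [t] ++ [z] from e) rfl
      simp at this; tauto
  obtain ⟨u, hu, hRM, -, -⟩ := TB_rev_sweep x z t hxz htx htz _ (p ++ l) le_rfl hi b hcase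
  exact ⟨u, hu, hRM⟩

theorem TB_crit
    {γ : Type} (x z t : γ) (hxz : x ≠ z) (htx : t ≠ x) (htz : t ≠ z) : CritPairs (TB x z t) := by
  have hzx := hxz.symm
  have hd : ∀ a, Joinable (TB x z t) a a := fun a => Joinable.of_eq rfl
  have r1 : ∀ p s, Red (TB x z t) (p ++ [x, z, x] ++ s) (p ++ [t] ++ s) := fun p s =>
      red_step p s (by simp [TB])
  have r2 : ∀ p s, Red (TB x z t) (p ++ [z, x, z] ++ s) (p ++ [t] ++ s) := fun p s =>
      red_step p s (by simp [TB])
  have r3 : ∀ p s, Red (TB x z t) (p ++ [x, t] ++ s) (p ++ [t, z] ++ s) := fun p s =>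
      red_step p s (by simp [TB])
  have r4 : ∀ p s, Red (TB x z t) (p ++ [z, t] ++ s) (p ++ [t, x] ++ s) := fun p s =>
      red_step p s (by simp [TB])
  have hm : ∀ l r, (l, r) ∈ TB x z t ↔ _ := fun l r => TB_mem
  generalize hR : TB x z t = R at *
  have j1 : Joinable R [t, z] [x, t] := Joinable.of_red (by simpa using r3 [] [])
  have j2 : Joinable R [t, x] [z, t] := Joinable.of_red (by simpa using r4 [] [])
  have s3 : Red R [x, z, t] [t, z, x] :=
    (by simpa using r4 [x] [] : Red R [x, z, t] [x, t, x]).trans (by simpa using r3 [] [x])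
  have s4 : Red R [z, x, t] [t, x, z] :=
    (by simpa using r3 [z] [] : Red R [z, x, t] [z, t, z]).trans (by simpa using r4 [] [z])
  have j3 := Joinable.of_red s3
  have j4 := Joinable.of_red s4
  have j5 : Joinable R [t, t] [x, z, t, z] := Joinable.of_red
    ((by simpa using s3.ctx [] [z] : Red R _ [t, z, x, z]).trans (by simpa using r2 [t] []))
  have j6 : Joinable R [t, t] [z, x, t, x] := Joinable.of_red
    ((by simpa using s4.ctx [] [x] : Red R _ [t, x, z, x]).trans (by simpa using r1 [t] []))
  apply crit_of_take
  intro l1 r1 h1 l2 r2 h2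
  rw [hm] at h1 h2
  rcases h1 with ⟨rfl, rfl⟩ | ⟨rfl, rfl⟩ | ⟨rfl, rfl⟩ | ⟨rfl, rfl⟩ <;>
  rcases h2 with ⟨rfl, rfl⟩ | ⟨rfl, rfl⟩ | ⟨rfl, rfl⟩ | ⟨rfl, rfl⟩ <;>
  refine ⟨fun k hk => ?_, fun k hk => ?_⟩ <;> (have hk' : k < 8 := by simp at hk; try omega) <;>
  interval_cases k <;> simp [hxz, hzx, hd, j1, j2, j3, j4, j5, j6, htx, htz, htx.symm, htz.symm] at hk ⊢

theorem TB_bi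
    {γ : Type} (x z t : γ) (hxz : x ≠ z) (htx : t ≠ x) (htz : t ≠ z) [Fintype γ] : MonBiautomatic (TB x z t) := by
  classical
  refine biauto_of_rewriting _ (by simp [TB]) (term_tval _ t ?_)
    (TB_crit x z t hxz htx htz) 4 (by simp)
    (TB_good1 x z t hxz htx htz) (TB_good2 x z t hxz htx htz)
  intro l r hm n hn
  rw [TB_mem] at hm
  rcases hm with ⟨rfl, rfl⟩ | ⟨rfl, rfl⟩ | ⟨rfl, rfl⟩ | ⟨rfl, rfl⟩ <;>
    simp [tval, htx.symm, htz.symm] <;> omega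

end B

theorem bi_braid {α : Type} [Fintype α] (x z : α) (hxz : x ≠ z) :
    MonBiautomatic {([x, z, x], [z, x, z])} := by
  have hbi := TB_bi (some x) (some z) none (by simpa) (by simp) (by simp)
  have hr : WordEq {([x, z, x], [z, x, z])} [x, z, x] [z, x, z] := WordEq.rule rfl
  refine biauto_transfer _ _ (fun o => match o with | none => [x, z, x] | some a => [a])
    (fun a => [some a]) ?_ ?_ ?_ ?_ hbi
  · intro l r h
    rw [TB_mem] at h
    rcases h with ⟨rfl, rfl⟩ | ⟨rfl, rfl⟩ | ⟨rfl, rfl⟩ | ⟨rfl, rfl⟩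
    · exact WordEq.of_eq (by simp)
    · simpa using hr.symm
    · simpa using hr.ctx [x] []
    · simpa using hr.symm.ctx [] [x]
  · intro l r h
    simp only [Set.mem_singleton_iff, Prod.mk.injEq] at h
    obtain ⟨rfl, rfl⟩ := h
    have h1 : WordEq (TB (some x) (some z) none) [some x, some z, some x] [none] :=
      WordEq.rule (by simp [TB])
    have h2 : WordEq (TB (some x) (some z) none) [some z, some x, some z] [none] :=
      WordEq.rule (by simp [TB])
    simpa using h1.trans h2.symm
  · rintro (_ | a)
    · simpa using WordEq.rule (R := TB (some x) (some z) none) (u := [some x, some z, some x]) (v := [none]) (by simp [TB])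
    · exact WordEq.of_eq (by simp)
  · intro a
    exact WordEq.of_eq (by simp)


set_option linter.unusedSimpArgs false
set_option linter.flexible false
set_option linter.unusedVariables false

/-! ### The relation ab = a -/

def lead {α : Type} [DecidableEq α] (b : α) : List α → ℕ
  | [] => 0
  | c :: l => if c = b then lead b l + 1 else 0

theorem lead_indep {α : Type} [DecidableEq α] (a b : α) (hab : a ≠ b) (p s s' : List α) :
    lead b (p ++ a :: s) = lead b (p ++ a :: s') := by
  induction p with
  | nil => simp [lead, hab]
  | cons c p ih => simp [lead, ih]

theorem lead_le {α : Type} [DecidableEq α] (b : α) (p : List α) : lead b p ≤ p.length := by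
  induction p with
  | nil => simp [lead]
  | cons c p ih => simp only [lead, List.length_cons]; split <;> omega

theorem lead_rep {α : Type} [DecidableEq α] (a b : α) (hab : a ≠ b) (i j : ℕ) :
    lead b (List.replicate i b ++ List.replicate j a) = i := by
  induction i with
  | zero => cases j <;> simp [lead, List.replicate_succ, hab]
  | succ i ih => simp [lead, List.replicate_succ, ih]

theorem lead_init_part {α : Type} [DecidableEq α] (a b : α) (hab : a ≠ b) (p s : List α)
    (h : p.length ≤ lead b (p ++ s)) : p.count a = 0 := by
  induction p with
  | nil => simp
  | cons c p ih =>
    simp only [lead, List.cons_append, List.length_cons] at h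
    split at h
    · rename_i hc
      subst hc
      rw [List.count_cons_of_ne hab.symm]
      exact ih (by omega)
    · omega

theorem inv_ab {α : Type} [DecidableEq α] (a b : α) (hab : a ≠ b) {u v : List α}
    (h : WordEq {([a, b], [a])} u v) : u.count a = v.count a ∧ lead b u = lead b v ∧
      ((∀ c ∈ u, c = a ∨ c = b) ↔ (∀ c ∈ v, c = a ∨ c = b)) := by
  induction h with
  | rel x y h =>
    obtain ⟨p, u, v, s, hm, rfl, rfl⟩ := h
    simp only [Set.mem_singleton_iff, Prod.mk.injEq] at hm
    obtain ⟨rfl, rfl⟩ := hm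
    refine ⟨by simp [List.count_append, List.count_cons, hab.symm], ?_, ?_⟩
    · simpa using lead_indep a b hab p (b :: s) s
    · simp; grind
  | refl => simp
  | symm x y _ ih => exact ⟨ih.1.symm, ih.2.1.symm, ih.2.2.symm⟩
  | trans x y z _ _ h1 h2 => exact ⟨h1.1.trans h2.1, h1.2.1.trans h2.2.1, h1.2.2.trans h2.2.2⟩

theorem class_a {α : Type} [DecidableEq α] (a b : α) (hab : a ≠ b) {u : List α}
    (h : WordEq {([a, b], [a])} u [a]) : ∃ k, u = a :: List.replicate k b := by
  obtain ⟨h1, h2, h3⟩ := inv_ab a b hab h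
  have h3 := h3.2 (by simp)
  rcases u with _ | ⟨c, u⟩
  · simp at h1
  · have hc : c = a := by
      rcases h3 c (by simp) with h | h
      · exact h
      · subst h; simp [lead, hab] at h2
    subst hc
    refine ⟨u.length, ?_⟩
    rw [List.cons.injEq]
    refine ⟨rfl, List.eq_replicate_iff.2 ⟨rfl, fun d hd => ?_⟩⟩
    rcases h3 d (by simp [hd]) with h | h
    · subst h
      simp at h1
      exact (List.count_eq_zero.1 h1 hd).elim
    · exact h

theorem absorb {α : Type} (a b : α) (k : ℕ) :
    WordEq {([a, b], [a])} (a :: List.replicate k b) [a] := by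
  induction k with
  | zero => exact WordEq.refl _
  | succ k ih =>
    have h : WordEq {([a, b], [a])} [a, b] [a] := WordEq.rule rfl
    have := h.ctx [] (List.replicate k b)
    exact (by simpa [List.replicate_succ] using this : WordEq _ _ _).trans ih

theorem gen_a {α β : Type} (a b : α) (g : β → List α) (x : List β) (k : ℕ)
    (h : expandW g x = a :: List.replicate k b) : ∃ c j, g c = a :: List.replicate j b := by
  induction x with
  | nil => simp at h
  | cons c x ih =>
    rw [expandW_cons] at h
    rcases hg : g c with _ | ⟨d, s⟩
    · rw [hg] at h; exact ih (by simpa using h)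
    · rw [hg, List.cons_append, List.cons.injEq] at h
      obtain ⟨rfl, h⟩ := h
      refine ⟨c, s.length, ?_⟩
      rw [hg, List.cons.injEq]
      refine ⟨rfl, List.eq_replicate_iff.2 ⟨rfl, fun e he => ?_⟩⟩
      have : e ∈ List.replicate k b := by rw [← h]; simp [he]
      exact List.eq_of_mem_replicate this

theorem padR_append {β : Type} (x y x' y' : List β) (h : x.length = y.length) :
    padR (x ++ x') (y ++ y') = padR x y ++ padR x' y' := by
  induction x generalizing y with
  | nil => cases y <;> simp_all
  | cons a x ih =>
    cases y with
    | nil => simp at h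
    | cons b y => simp at h; simp [ih y h]

theorem expandW_length {α β : Type} (g : β → List α) (G : ℕ) (hG : ∀ c, (g c).length ≤ G)
    (x : List β) : (expandW g x).length ≤ G * x.length := by
  induction x with
  | nil => simp
  | cons c x ih =>
    have := hG c
    simp only [expandW_cons, List.length_append, List.length_cons]
    nlinarith

theorem not_bi_ab {α : Type} (a b : α) (hab : a ≠ b) : ¬ MonBiautomatic {([a, b], [a])} := by
  classical
  rintro ⟨β, _, g, L, hS⟩
  obtain ⟨x, -, hx⟩ := hS.onto [a]
  obtain ⟨k, hk⟩ := class_a a b hab hx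
  obtain ⟨b0, m, hb0⟩ := gen_a a b g x k hk
  obtain ⟨G, hG⟩ : ∃ G, ∀ c, (g c).length ≤ G :=
    ⟨Finset.univ.sup fun c => (g c).length, fun c => Finset.le_sup (f := fun c => (g c).length) (Finset.mem_univ c)⟩
  have hreg := hS.mulLR_reg b0
  generalize hD : {p | ∃ x ∈ L, ∃ y ∈ L,
      WordEq {([a, b], [a])} (g b0 ++ expandW g x) (expandW g y) ∧ p = padR x y} = D at hreg
  have hfin := Language.IsRegular.finite_range_leftQuotient hreg
  -- the test pairs
  have htest : ∀ j : ℕ, ∃ x1 x2 y, x1.length = y.length ∧ padR x1 y ++ padR x2 [] ∈ D ∧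
      (expandW g x1).count a = 0 ∧ (expandW g x2).count a = j ∧ (expandW g y).count a = j + 1 := by
    intro j
    obtain ⟨y, hyL, hy⟩ := hS.onto (List.replicate (j + 1) a)
    obtain ⟨x, hxL, hx⟩ := hS.onto (List.replicate (G * y.length + 1) b ++ List.replicate j a)
    obtain ⟨hy1, -, -⟩ := inv_ab a b hab hy
    obtain ⟨hx1, hx2, -⟩ := inv_ab a b hab hx
    rw [lead_rep a b hab] at hx2
    have hlen : y.length < x.length := by
      have h1 := lead_le b (expandW g x)
      have h2 := expandW_length g G hG x
      by_contra hc
      have : G * x.length ≤ G * y.length := Nat.mul_le_mul_left _ (by omega)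
      omega
    have hsplit : x = x.take y.length ++ x.drop y.length := (List.take_append_drop _ _).symm
    have hl1 : (x.take y.length).length = y.length := by simp; omega
    have hc1 : (expandW g (x.take y.length)).count a = 0 := by
      refine lead_init_part a b hab _ (expandW g (x.drop y.length)) ?_
      rw [← expandW_append, ← hsplit, hx2]
      have := expandW_length g G hG (x.take y.length)
      rw [hl1] at this; omega
    refine ⟨x.take y.length, x.drop y.length, y, hl1, ?_, hc1, ?_, ?_⟩
    · rw [← padR_append _ _ _ _ hl1, List.append_nil, ← hsplit, ← hD]
      refine ⟨x, hxL, y, hyL, ?_, rfl⟩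
      rw [hb0]
      have e1 := WordEq.app (WordEq.refl (R := {([a, b], [a])}) (a :: List.replicate m b)) hx
      have e2 : (a :: List.replicate m b) ++ (List.replicate (G * y.length + 1) b ++ List.replicate j a)
          = (a :: List.replicate (m + (G * y.length + 1)) b) ++ List.replicate j a := by
        simp only [List.replicate_add, List.cons_append, List.append_assoc]
      rw [e2] at e1
      have e3 := WordEq.app (absorb a b (m + (G * y.length + 1)))
        (WordEq.refl (R := {([a, b], [a])}) (List.replicate j a))
      refine e1.trans (e3.trans (WordEq.trans ?_ hy.symm))
      exact WordEq.of_eq (by simp [List.replicate_succ])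
    · rw [hsplit, expandW_append, List.count_append, hc1] at hx1
      simp [List.count_append, List.count_replicate, hab, hab.symm] at hx1
      simpa [hab] using hx1
    · simpa using hy1
  choose x1 x2 y h1 h2 h3 h4 h5 using htest
  have : ¬ Function.Injective (fun j => Language.leftQuotient D (padR (x1 j) (y j))) := by
    intro hinj
    have := Set.infinite_range_of_injective hinj
    refine this (hfin.subset ?_)
    rintro _ ⟨j, rfl⟩
    exact ⟨_, rfl⟩
  rw [Function.Injective] at this
  push Not at this
  obtain ⟨i, j, he, hne⟩ := this
  have hmem : padR (x2 j) [] ∈ Language.leftQuotient D (padR (x1 j) (y j)) := h2 j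
  rw [← he] at hmem
  have hmem : padR (x1 i) (y i) ++ padR (x2 j) [] ∈ D := hmem
  rw [← padR_append _ _ _ _ (h1 i), List.append_nil, ← hD] at hmem
  obtain ⟨x', -, y', -, hw, hp⟩ := hmem
  obtain ⟨rfl, rfl⟩ := padR_inj hp
  have hc := (inv_ab a b hab hw).1
  rw [List.count_append, expandW_append, List.count_append, h3, h4, h5, hb0] at hc
  simp [List.count_cons, List.count_replicate, hab.symm] at hc
  omega



/-! ### The final case analysis -/

theorem bi_33 {α : Type} [Fintype α] (a b c d e f : α) :
    MonBiautomatic {([a, b, c], [d, e, f])} := by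
  by_cases hne : [a, b, c] = [d, e, f]
  · rw [hne]; exact bi_refl _
  by_cases hac : a = c
  swap
  · exact bi_unb3 a b c d e f hac hne
  by_cases hdf : d = f
  swap
  · exact swap_rel _ _ (bi_unb3 d e f a b c hdf (Ne.symm hne))
  subst hac hdf
  by_cases had : a = d
  · subst had
    have hbe : b ≠ e := by rintro rfl; exact hne rfl
    by_cases hab : a = b
    · exact swap_rel _ _ (bi_aba_aca a e b (by rintro rfl; exact hbe hab.symm) hbe.symm)
    · exact bi_aba_aca a b e hab hbe
  by_cases hed : e = d
  · subst hed
    by_cases hba : b = a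
    · subst hba; exact bi_xxx_zzz e b (Ne.symm had)
    by_cases hbe : b = e
    · subst hbe; exact bi_zxz_xxx b a (Ne.symm had)
    · exact swap_rel _ _ (bi_T e e a b (Ne.symm had) hba (fun _ => hbe))
  by_cases hea : e = a
  · subst hea
    by_cases hba : b = e
    · subst hba; exact swap_rel _ _ (bi_zxz_xxx b d had)
    by_cases hbd : b = d
    · subst hbd; exact bi_braid e b had
    · exact bi_T e b d e had hed (by rintro (h | h) <;> contradiction)
  · exact bi_T a b d e had hed (fun _ => hea)

theorem bi_22 {α : Type} [Fintype α] (a b c d : α) : MonBiautomatic {([a, b], [c, d])} := by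
  by_cases hne : [a, b] = [c, d]
  · rw [hne]; exact bi_refl _
  by_cases hab : a = b
  swap
  · exact bi_unb2 a b c d hab hne
  by_cases hcd : c = d
  swap
  · exact swap_rel _ _ (bi_unb2 c d a b hcd (Ne.symm hne))
  subst hab hcd
  exact bi_xx_zz c a (by rintro rfl; exact hne rfl)

theorem bi_21 {α : Type} [Fintype α] (a b c : α) (h : a ≠ b → c ≠ a ∧ c ≠ b) :
    MonBiautomatic {([a, b], [c])} := by
  by_cases hab : a = b
  · subst hab
    by_cases hac : c = a
    · subst hac; exact bi_idem c
    · exact swap_rel _ _ (bi_elim c [a, a] (by simp [hac]))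
  · exact swap_rel _ _ (bi_elim c [a, b] (by simp [h hab]))

theorem not_bi_ba {α : Type} (a b : α) (hab : a ≠ b) : ¬ MonBiautomatic {([a, b], [b])} := by
  intro h
  have := biauto_rev _ h
  rw [Rrev_single] at this
  exact not_bi_ab b a hab.symm (by simpa using this)

/-- let `S = sgp⟨α ∣ u = v⟩` be a one-relator monoid with
`|α| = n ≥ 2` and `|v| ≤ |u| ≤ 3`.  Then `S` is biautomatic if (i) `|u| = 3`
and `|v| = 0`, or (ii) `|u| = |v| = 3`, or (iii) `|u| = 2` and the relation is
not of the form `ab = a` or `ab = b` for distinct letters `a, b`; if the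
relation is of the form `ab = a` or `ab = b` then `S` is not biautomatic. -/
theorem statement_12 {α : Type} [Fintype α] (hcard : 2 ≤ Fintype.card α)
    (u v : List α) (hvu : v.length ≤ u.length) (hu3 : u.length ≤ 3)
    (R : Set (List α × List α)) (hRdef : R = {(u, v)}) :
    (((u.length = 3 ∧ v.length = 0) ∨ (u.length = 3 ∧ v.length = 3) ∨
        (u.length = 2 ∧ ¬ ∃ a b : α, a ≠ b ∧
          ((u = [a, b] ∧ v = [a]) ∨ (u = [a, b] ∧ v = [b])))) →
      MonBiautomatic R) ∧
    ((∃ a b : α, a ≠ b ∧ ((u = [a, b] ∧ v = [a]) ∨ (u = [a, b] ∧ v = [b]))) →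
      ¬ MonBiautomatic R) := by
  subst hRdef
  constructor
  · rintro (⟨hu, hv⟩ | ⟨hu, hv⟩ | ⟨hu, hn⟩)
    · obtain ⟨a, b, c, rfl⟩ := List.length_eq_three.1 hu
      obtain rfl := List.length_eq_zero_iff.1 hv
      by_cases h : a = c ∧ a ≠ b
      · obtain ⟨rfl, h⟩ := h
        exact bi_aba a b h
      · exact bi_del3 a b c h
    · obtain ⟨a, b, c, rfl⟩ := List.length_eq_three.1 hu
      obtain ⟨d, e, f, rfl⟩ := List.length_eq_three.1 hv
      exact bi_33 a b c d e f
    · obtain ⟨a, b, rfl⟩ := List.length_eq_two.1 hu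
      rcases v with _ | ⟨c, _ | ⟨d, _ | ⟨e, v⟩⟩⟩
      · exact bi_del2 a b
      · refine bi_21 a b c fun hab => ⟨?_, ?_⟩
        · rintro rfl; exact hn ⟨c, b, hab, Or.inl ⟨rfl, rfl⟩⟩
        · rintro rfl; exact hn ⟨a, c, hab, Or.inr ⟨rfl, rfl⟩⟩
      · exact bi_22 a b c d
      · simp at hvu
  · rintro ⟨a, b, hab, ⟨rfl, rfl⟩ | ⟨rfl, rfl⟩⟩
    · exact not_bi_ab a b hab
    · exact not_bi_ba a b hab
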